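/- Let M ⊆ I^a and N ⊆ I^b be subcomplexes whose geometric realizations are compact topological manifolds without boundary of dimensions m = dim M and n = dim N respectively (in particular ℤ/2-homology manifolds, the paper's hypothesis), with m ≥ n ≥ 3. Let k be an integer with k ≥ ⌊m/2⌋ + 1. If Skel_k M and Skel_k N are isomorphic, then M and N are isomorphic. -/

import Mathlib

/-- A face of the cube `I^n`: `none` marks a free coordinate. -/
def CubeFace (n : ℕ) : Type := Fin n → Option Bool

namespace CubeFace

/-- The order on faces of the cube: `F ≤ G` iff every coordinate of `G` is free
or agrees with the corresponding coordinate of `F`. -/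
instance (n : ℕ) : PartialOrder (CubeFace n) where
  le F G := ∀ i, G i = none ∨ F i = G i
  le_refl F i := Or.inr rfl
  le_trans F G H h1 h2 i := by
    rcases h2 i with h | h
    · exact Or.inl h
    · rcases h1 i with h' | h'
      · exact Or.inl (h ▸ h')
      · exact Or.inr (h' ▸ h)
  le_antisymm F G h1 h2 := by
    funext i
    rcases h1 i with h | h
    · rcases h2 i with h' | h'
      · rw [h, h']
      · rw [← h', h]
    · exact h

/-- The face of `I^n` corresponding to a vertex. -/
def toFace {n : ℕ} (v : Fin n → Bool) : CubeFace n := fun i => some (v i)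

/-- The vertex set of a face. -/
def verts {n : ℕ} (F : CubeFace n) : Set (Fin n → Bool) := {v | toFace v ≤ F}

/-- The dimension of a face: its number of free coordinates. -/
def dim {n : ℕ} (F : CubeFace n) : ℕ :=
  letI : DecidablePred (fun i => F i = none) := fun i => decEq (F i) none
  (Finset.univ.filter (fun i => F i = none)).card

/-- A subcomplex of `I^n`: a nonempty, downward closed set of faces. -/
def IsSubcomplex {n : ℕ} (K : Set (CubeFace n)) : Prop :=
  K.Nonempty ∧ ∀ F ∈ K, ∀ G : CubeFace n, G ≤ F → G ∈ K

/-- The vertex set of a subcomplex. -/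
def cvert {n : ℕ} (K : Set (CubeFace n)) : Set (Fin n → Bool) := {v | toFace v ∈ K}

/-- A subcomplex `Γ ⊆ K` is face-like if, for every face `F` of `K`, the set of vertices
of `F` belonging to `Γ` is empty or the vertex set of a face of `Γ`. -/
def FaceLike {n : ℕ} (K Γ : Set (CubeFace n)) : Prop :=
  ∀ F ∈ K, verts F ∩ cvert Γ = ∅ ∨ ∃ G ∈ Γ, verts F ∩ cvert Γ = verts G

/-- The deletion `K ∖ Γ`: the faces of `K` with no vertex in `Γ`. -/
def delete {n : ℕ} (K Γ : Set (CubeFace n)) : Set (CubeFace n) :=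
  {F | F ∈ K ∧ verts F ∩ cvert Γ = ∅}

/-- The geometric realization of a subcomplex of `I^n`, as a subset of `ℝ^n`. -/
def real {n : ℕ} (K : Set (CubeFace n)) : Set (Fin n → ℝ) :=
  ⋃ F ∈ K, {x | (∀ i, 0 ≤ x i ∧ x i ≤ 1) ∧
    ∀ i, (F i = some false → x i = 0) ∧ (F i = some true → x i = 1)}

/-- The boundary `∂F̂` of a face `F`: all faces strictly below `F`. -/
def bdryHat {n : ℕ} (F : CubeFace n) : Set (CubeFace n) := {G | G ≤ F ∧ G ≠ F}

/-- The boundary of the cube `I^k`: all faces except the top one. -/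
def boundaryCube (k : ℕ) : Set (CubeFace k) := {F | F ≠ fun _ => none}

/-- The `k`-skeleton of a subcomplex. -/
def skel {n : ℕ} (k : ℕ) (K : Set (CubeFace n)) : Set (CubeFace n) :=
  {F | F ∈ K ∧ dim F ≤ k}

/-- Isomorphism of cubical subcomplexes: a bijection between the vertex sets under which
vertex sets of faces correspond to vertex sets of faces. -/
def Iso {m n : ℕ} (K : Set (CubeFace m)) (L : Set (CubeFace n)) : Prop :=
  ∃ f : (Fin m → Bool) → (Fin n → Bool),
    Set.BijOn f (cvert K) (cvert L) ∧
    ∀ W : Set (Fin m → Bool), W ⊆ cvert K →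
      ((∃ F ∈ K, verts F = W) ↔ (∃ G ∈ L, verts G = f '' W))

/-- `K` has dimension `d`. -/
def HasDim {n : ℕ} (K : Set (CubeFace n)) (d : ℕ) : Prop :=
  (∀ F ∈ K, dim F ≤ d) ∧ ∃ F ∈ K, dim F = d

end CubeFace

open CategoryTheory in
/-- The `j`-th singular homology of a topological space with coefficients in `R`. -/
noncomputable def sHomology (R : Type) [CommRing R] (X : Type) [TopologicalSpace X]
    (j : ℕ) : ModuleCat R :=
  ((AlgebraicTopology.alternatingFaceMapComplex (ModuleCat R)).obj
    (((SimplicialObject.whiskering _ _).obj (ModuleCat.free R)).obj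
      (TopCat.toSSet.obj (TopCat.of X)))).homology j

/-- `X` is a compact topological `d`-manifold without boundary. -/
def IsCompactManifold (X : Type) [TopologicalSpace X] (d : ℕ) : Prop :=
  CompactSpace X ∧ Nonempty (ChartedSpace (EuclideanSpace ℝ (Fin d)) X)



namespace SkelProof

set_option linter.unusedSectionVars false
set_option linter.unusedDecidableInType false
set_option linter.unusedFintypeInType false

section Chains

variable {V : Type*} [Fintype V] [DecidableEq V]

/-- Chains with `ℤ/2` coefficients on the full simplex with vertex set `V`, graded by cardinality. -/
abbrev Chain (V : Type*) : Type _ := Finset V → ZMod 2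

/-- The link part of a chain at a vertex. -/
def lkc (v : V) : Chain V →ₗ[ZMod 2] Chain V where
  toFun z τ := if v ∈ τ then 0 else z (insert v τ)
  map_add' x y := by funext τ; by_cases h : v ∈ τ <;> simp [h]
  map_smul' c x := by funext τ; by_cases h : v ∈ τ <;> simp [h]

/-- The cone of a chain over a vertex. -/
def cone (v : V) : Chain V →ₗ[ZMod 2] Chain V where
  toFun z τ := if v ∈ τ then z (τ.erase v) else 0
  map_add' x y := by funext τ; by_cases h : v ∈ τ <;> simp [h]
  map_smul' c x := by funext τ; by_cases h : v ∈ τ <;> simp [h]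

/-- The part of a chain away from a vertex. -/
def del (v : V) : Chain V →ₗ[ZMod 2] Chain V where
  toFun z τ := if v ∈ τ then 0 else z τ
  map_add' x y := by funext τ; by_cases h : v ∈ τ <;> simp [h]
  map_smul' c x := by funext τ; by_cases h : v ∈ τ <;> simp [h]

/-- The (augmented) boundary. -/
def bd : Chain V →ₗ[ZMod 2] Chain V := ∑ v, lkc v

theorem lkc_apply (v : V) (z : Chain V) (τ : Finset V) :
    lkc v z τ = if v ∈ τ then 0 else z (insert v τ) := rfl

theorem cone_apply (v : V) (z : Chain V) (τ : Finset V) :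
    cone v z τ = if v ∈ τ then z (τ.erase v) else 0 := rfl

theorem del_apply (v : V) (z : Chain V) (τ : Finset V) :
    del v z τ = if v ∈ τ then 0 else z τ := rfl

theorem bd_eq (z : Chain V) : bd z = ∑ v, lkc v z := by
  simp [bd]

theorem bd_apply (z : Chain V) (τ : Finset V) :
    bd z τ = ∑ v, if v ∈ τ then 0 else z (insert v τ) := by
  simp [bd_eq, lkc_apply]

theorem lkc_comm (v w : V) (z : Chain V) : lkc v (lkc w z) = lkc w (lkc v z) := by
  funext τ
  simp only [lkc_apply, Finset.mem_insert]
  by_cases hvw : v = w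
  · subst hvw; rfl
  · have hwv : w ≠ v := fun h => hvw h.symm
    by_cases h1 : v ∈ τ <;> by_cases h2 : w ∈ τ <;> simp [h1, h2, hvw, hwv, Finset.insert_comm]

theorem lkc_self (v : V) (z : Chain V) : lkc v (lkc v z) = 0 := by
  funext τ
  simp [lkc_apply]

theorem chain_add_self {M : Type*} [AddCommGroup M] [Module (ZMod 2) M] (z : M) : z + z = 0 := by
  have h : (2 : ZMod 2) = 0 := by decide
  rw [← two_smul (ZMod 2) z, h, zero_smul]

theorem eq_of_add_eq_zero2 {M : Type*} [AddCommGroup M] [Module (ZMod 2) M] {x y : M}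
    (h : x + y = 0) : x = y := by
  have h2 := chain_add_self y
  exact add_right_cancel (h.trans h2.symm)

theorem lkc_bd (v : V) (z : Chain V) : lkc v (bd z) = bd (lkc v z) := by
  rw [bd_eq, bd_eq, map_sum]
  exact Finset.sum_congr rfl fun w _ => lkc_comm v w z

theorem bd_bd (z : Chain V) : bd (bd z) = 0 := by
  rw [bd_eq (bd z)]
  simp_rw [bd_eq z, map_sum]
  rw [← Finset.sum_product']
  refine Finset.sum_involution (fun p _ => (p.2, p.1)) ?_ ?_ ?_ ?_
  · intro p _
    simp only
    rw [lkc_comm p.2 p.1]; exact chain_add_self _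
  · intro p _ hp h
    apply hp
    have : p.1 = p.2 := by
      have := congrArg Prod.fst h; simpa using this.symm
    rw [this]; exact lkc_self _ _
  · simp
  · simp

theorem lkc_cone_self (v : V) (z : Chain V) : lkc v (cone v z) + cone v (lkc v z) = z := by
  funext τ
  simp only [Pi.add_apply, lkc_apply, cone_apply]
  by_cases h : v ∈ τ
  · simp [h]
  · simp [h]

theorem lkc_cone_ne {v w : V} (h : w ≠ v) (z : Chain V) :
    lkc w (cone v z) = cone v (lkc w z) := by
  funext τ
  simp only [lkc_apply, cone_apply]
  by_cases h1 : v ∈ τ <;> by_cases h2 : w ∈ τ <;> simp [h1, h2, h, h.symm, Finset.erase_insert_of_ne]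

theorem bd_cone (v : V) (z : Chain V) : bd (cone v z) = z + cone v (bd z) := by
  have key : bd (cone v z) + cone v (bd z) = z := by
    rw [bd_eq, bd_eq, map_sum, ← Finset.sum_add_distrib]
    rw [Finset.sum_eq_single v]
    · exact lkc_cone_self v z
    · intro w _ hw
      rw [lkc_cone_ne hw]; exact chain_add_self _
    · simp
  rw [← key, add_assoc, key, chain_add_self, add_zero]

theorem decomp (v : V) (z : Chain V) : z = cone v (lkc v z) + del v z := by
  funext τ
  simp only [Pi.add_apply, lkc_apply, cone_apply, del_apply]
  by_cases h : v ∈ τ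
  · simp [h]
  · simp [h]

theorem cone_cone_self (v : V) (z : Chain V) : cone v (cone v z) = 0 := by
  funext τ
  simp [cone_apply]

theorem lkc_del (v : V) (z : Chain V) : lkc v (del v z) = 0 := by
  funext τ
  simp [lkc_apply, del_apply]

/-- boundary of a decomposed chain. -/
theorem bd_del (v : V) (z : Chain V) :
    bd (del v z) = bd z + lkc v z + cone v (lkc v (bd z)) := by
  have h := congrArg bd (decomp v z)
  rw [map_add, bd_cone, ← lkc_bd] at h
  generalize cone v (lkc v (bd z)) = q at h ⊢
  rw [h, show lkc v z + q + bd (del v z) + lkc v z + q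
    = (lkc v z + lkc v z) + (q + q) + bd (del v z) by abel,
    chain_add_self, chain_add_self]
  simp

/-- Chains supported on faces of `K` of cardinality `c`. -/
def Ch (K : Set (Finset V)) (c : ℕ) : Submodule (ZMod 2) (Chain V) where
  carrier := {z | ∀ τ, z τ ≠ 0 → τ ∈ K ∧ τ.card = c}
  add_mem' {x y} hx hy τ h := by
    by_cases h1 : x τ = 0
    · exact hy τ (by intro h2; apply h; simp [h1, h2])
    · exact hx τ h1
  zero_mem' τ h := by simp at h
  smul_mem' r x hx τ h := hx τ (by intro h2; apply h; simp [h2])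

theorem mem_Ch {K : Set (Finset V)} {c : ℕ} {z : Chain V} :
    z ∈ Ch K c ↔ ∀ τ, z τ ≠ 0 → τ ∈ K ∧ τ.card = c := Iff.rfl

theorem Ch_mono {K K' : Set (Finset V)} {c : ℕ} {z : Chain V}
    (h : ∀ τ ∈ K, τ.card = c → τ ∈ K') (hz : z ∈ Ch K c) : z ∈ Ch K' c :=
  fun τ hτ => ⟨h τ (hz τ hτ).1 (hz τ hτ).2, (hz τ hτ).2⟩

/-- Downward closed. -/
def DC (K : Set (Finset V)) : Prop := ∀ σ ∈ K, ∀ τ ⊆ σ, τ ∈ K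

/-- Every `c`-cycle of `K` bounds. -/
def Triv (c : ℕ) (K : Set (Finset V)) : Prop :=
  ∀ z ∈ Ch K c, bd z = 0 → ∃ w ∈ Ch K (c + 1), bd w = z

/-- The homology of `K` in cardinality `c` is one-dimensional. -/
def Sph (c : ℕ) (K : Set (Finset V)) : Prop :=
  (∃ z ∈ Ch K c, bd z = 0 ∧ ¬ ∃ w ∈ Ch K (c + 1), bd w = z) ∧
  ∀ z ∈ Ch K c, bd z = 0 → ∀ z' ∈ Ch K c, bd z' = 0 →
    (¬ ∃ w ∈ Ch K (c + 1), bd w = z) → (¬ ∃ w ∈ Ch K (c + 1), bd w = z') →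
    ∃ w ∈ Ch K (c + 1), bd w = z + z'

/-- The link of `τ` in `K`. -/
def Lk (K : Set (Finset V)) (τ : Finset V) : Set (Finset V) := {T | Disjoint T τ ∧ T ∪ τ ∈ K}

/-- The faces of `K` avoiding `σ`. -/
def Dl (K : Set (Finset V)) (σ : Finset V) : Set (Finset V) := {T | T ∈ K ∧ Disjoint T σ}

theorem Lk_dc {K : Set (Finset V)} (hK : DC K) (τ : Finset V) : DC (Lk K τ) := by
  intro σ hσ ρ hρ
  exact ⟨Finset.disjoint_of_subset_left hρ hσ.1, hK _ hσ.2 _ (Finset.union_subset_union_left hρ)⟩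

theorem Dl_dc {K : Set (Finset V)} (hK : DC K) (τ : Finset V) : DC (Dl K τ) := by
  intro σ hσ ρ hρ
  exact ⟨hK _ hσ.1 _ hρ, Finset.disjoint_of_subset_left hρ hσ.2⟩

theorem lkc_mem {K : Set (Finset V)} {c : ℕ} {z : Chain V} (v : V) (hz : z ∈ Ch K (c + 1)) :
    lkc v z ∈ Ch (Lk K {v}) c := by
  intro τ hτ
  rw [lkc_apply] at hτ
  by_cases h : v ∈ τ
  · simp [h] at hτ
  · rw [if_neg h] at hτ
    obtain ⟨h1, h2⟩ := hz _ hτ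
    rw [Finset.card_insert_of_notMem h] at h2
    refine ⟨⟨by simpa using h, ?_⟩, by omega⟩
    rwa [Finset.union_comm, ← Finset.insert_eq]

theorem lkc_zero {K : Set (Finset V)} {z : Chain V} (v : V) (hz : z ∈ Ch K 0) :
    lkc v z = 0 := by
  funext τ
  rw [lkc_apply]
  by_cases h : v ∈ τ
  · simp [h]
  · rw [if_neg h]
    by_contra h3
    have := (hz _ h3).2
    simp at this

theorem bd_zero_card {K : Set (Finset V)} {z : Chain V} (hz : z ∈ Ch K 0) : bd z = 0 := by
  rw [bd_eq]
  exact Finset.sum_eq_zero fun v _ => lkc_zero v hz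

theorem bd_mem {K : Set (Finset V)} (hK : DC K) {c : ℕ} {z : Chain V} (hz : z ∈ Ch K (c + 1)) :
    bd z ∈ Ch K c := by
  rw [bd_eq]
  refine Submodule.sum_mem _ fun v _ => Ch_mono ?_ (lkc_mem v hz)
  intro τ hτ _
  exact hK _ hτ.2 _ Finset.subset_union_left

theorem cone_mem {K K' : Set (Finset V)} {c : ℕ} {z : Chain V} (v : V)
    (h : ∀ τ ∈ K, v ∉ τ → insert v τ ∈ K') (hz : z ∈ Ch K c) :
    cone v z ∈ Ch K' (c + 1) := by
  intro τ hτ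
  rw [cone_apply] at hτ
  by_cases hv : v ∈ τ
  · rw [if_pos hv] at hτ
    obtain ⟨h1, h2⟩ := hz _ hτ
    refine ⟨?_, ?_⟩
    · have := h _ h1 (by simp)
      rwa [Finset.insert_erase hv] at this
    · rw [Finset.card_erase_of_mem hv] at h2
      have : 0 < τ.card := Finset.card_pos.mpr ⟨v, hv⟩
      omega
  · simp [hv] at hτ

theorem del_mem {K : Set (Finset V)} {c : ℕ} {z : Chain V} (v : V)
    (hz : z ∈ Ch K c) : del v z ∈ Ch (Dl K {v}) c := by
  intro τ hτ
  rw [del_apply] at hτ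
  by_cases hv : v ∈ τ
  · simp [hv] at hτ
  · rw [if_neg hv] at hτ
    exact ⟨⟨(hz _ hτ).1, by simpa using hv⟩, (hz _ hτ).2⟩

theorem lkc_eq_zero_of_avoid {K : Set (Finset V)} {c : ℕ} {z : Chain V} (v : V)
    (hK : ∀ τ ∈ K, v ∉ τ) (hz : z ∈ Ch K c) : lkc v z = 0 := by
  funext τ
  rw [lkc_apply]
  by_cases h : v ∈ τ
  · simp [h]
  · rw [if_neg h]
    by_contra h3
    exact hK _ (hz _ h3).1 (by simp)

theorem Lk_sub_Dl {K : Set (Finset V)} (hK : DC K) (v : V) : ∀ τ ∈ Lk K {v}, τ ∈ Dl K {v} :=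
  fun _ h => ⟨hK _ h.2 _ Finset.subset_union_left, h.1⟩

/-- A cycle away from `v` that bounds is homologous to a cycle of the link of `v`. -/
theorem push_to_link {K : Set (Finset V)} {c : ℕ} {y : Chain V} (v : V)
    (hy : y ∈ Ch (Dl K {v}) c) {u : Chain V} (hu : u ∈ Ch K (c + 1)) (hbu : bd u = y) :
    lkc v u ∈ Ch (Lk K {v}) c ∧ bd (lkc v u) = 0 ∧ del v u ∈ Ch (Dl K {v}) (c + 1) ∧
      bd (del v u) = y + lkc v u := by
  have h0 : lkc v y = 0 := lkc_eq_zero_of_avoid v (fun τ hτ => by simpa using hτ.2) hy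
  refine ⟨lkc_mem v hu, ?_, del_mem v hu, ?_⟩
  · rw [← lkc_bd, hbu, h0]
  · rw [bd_del, hbu, h0, map_zero, add_zero]

theorem triv_del {K : Set (Finset V)} (hK : DC K) {c : ℕ} (v : V) (h1 : Triv c K)
    (h2 : Triv c (Lk K {v})) : Triv c (Dl K {v}) := by
  intro y hy hby
  obtain ⟨u, hu, hbu⟩ := h1 y (Ch_mono (fun τ h _ => h.1) hy) hby
  obtain ⟨a1, a2, a3, a4⟩ := push_to_link v hy hu hbu
  obtain ⟨w, hw, hbw⟩ := h2 _ a1 a2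
  refine ⟨del v u + w, Submodule.add_mem _ a3 (Ch_mono (fun τ h _ => Lk_sub_Dl hK v τ h) hw), ?_⟩
  rw [map_add, a4, hbw, add_assoc, chain_add_self, add_zero]

theorem cone_link_mem {K : Set (Finset V)} {c : ℕ} {z : Chain V} (v : V)
    (hz : z ∈ Ch (Lk K {v}) c) : cone v z ∈ Ch K (c + 1) :=
  cone_mem v (fun τ hτ _ => by
    have := hτ.2; rwa [Finset.union_comm, ← Finset.insert_eq] at this) hz

theorem triv_link_of_del {K : Set (Finset V)} {c : ℕ} (v : V) (h1 : Triv (c + 1) K)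
    (h2 : Triv c (Dl K {v})) (hK : DC K) : Triv c (Lk K {v}) := by
  intro z hz hbz
  obtain ⟨u, hu, hbu⟩ := h2 z (Ch_mono (fun τ h _ => Lk_sub_Dl hK v τ h) hz) hbz
  have hm : cone v z + u ∈ Ch K (c + 1) :=
    Submodule.add_mem _ (cone_link_mem v hz) (Ch_mono (fun τ h _ => h.1) hu)
  obtain ⟨w, hw, hbw⟩ := h1 _ hm (by rw [map_add, bd_cone, hbz, hbu, map_zero, add_zero,
    chain_add_self])
  refine ⟨lkc v w, lkc_mem v hw, ?_⟩
  rw [← lkc_bd, hbw, map_add,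
    lkc_eq_zero_of_avoid (K := Dl K {v}) v (fun τ hτ => by simpa using hτ.2) hu, add_zero]
  have h3 := lkc_cone_self v z
  rwa [lkc_eq_zero_of_avoid (K := Lk K {v}) v (fun τ hτ => by simpa using hτ.1) hz, map_zero,
    add_zero] at h3

/-- `K` is a homology sphere (with faces of cardinality at most `e`). -/
structure HS (e : ℕ) (K : Set (Finset V)) : Prop where
  dc : DC K
  empty_mem : ∅ ∈ K
  card_le : ∀ τ ∈ K, τ.card ≤ e
  sph : ∀ τ ∈ K, Sph (e - τ.card) (Lk K τ)
  triv : ∀ τ ∈ K, ∀ c, c ≠ e - τ.card → Triv c (Lk K τ)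

theorem Lk_empty (K : Set (Finset V)) : Lk K ∅ = K := by
  ext T; simp [Lk]

theorem Lk_Lk (K : Set (Finset V)) (τ ρ : Finset V) (h : Disjoint ρ τ) :
    Lk (Lk K τ) ρ = Lk K (ρ ∪ τ) := by
  ext T
  simp only [Lk, Set.mem_ofPred_eq, Finset.disjoint_union_left, Finset.disjoint_union_right,
    Finset.union_assoc]
  tauto

theorem HS.link {e : ℕ} {K : Set (Finset V)} (h : HS (e + 1) K) {v : V} (hv : {v} ∈ K) :
    HS e (Lk K {v}) := by
  have hc : ∀ τ ∈ Lk K {v}, (τ ∪ {v}).card = τ.card + 1 := by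
    intro τ hτ
    rw [Finset.card_union_of_disjoint hτ.1]; simp
  refine ⟨Lk_dc h.dc _, ⟨by simp, by simpa using hv⟩, ?_, ?_, ?_⟩
  · intro τ hτ
    have := h.card_le _ hτ.2
    rw [hc τ hτ] at this; omega
  · intro τ hτ
    rw [Lk_Lk _ _ _ hτ.1]
    have := h.sph _ hτ.2
    rwa [hc τ hτ, Nat.add_sub_add_right] at this
  · intro τ hτ c hcne
    rw [Lk_Lk _ _ _ hτ.1]
    refine h.triv _ hτ.2 c ?_
    rwa [hc τ hτ, Nat.add_sub_add_right]

theorem HS.sph0 {e : ℕ} {K : Set (Finset V)} (h : HS e K) : Sph e K := by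
  have := h.sph ∅ h.empty_mem
  rwa [Lk_empty] at this

theorem HS.triv0 {e : ℕ} {K : Set (Finset V)} (h : HS e K) {c : ℕ} (hc : c ≠ e) : Triv c K := by
  have := h.triv ∅ h.empty_mem c (by simpa using hc)
  rwa [Lk_empty] at this

theorem HS.pos {e : ℕ} {K : Set (Finset V)} (h : HS e K) {v : V} (hv : {v} ∈ K) : 1 ≤ e := by
  simpa using h.card_le _ hv

theorem HS.eq_zero {e : ℕ} {K : Set (Finset V)} (h : HS e K) {z : Chain V} (hz : z ∈ Ch K (e + 1)) :
    z = 0 := by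
  funext τ
  by_contra h3
  have h4 := hz τ h3
  have := h.card_le _ h4.1
  omega

/-- the basis chain -/
def dl (σ : Finset V) : Chain V := Pi.single σ 1

theorem dl_apply (σ τ : Finset V) : dl σ τ = if τ = σ then 1 else 0 := by
  simp [dl, Pi.single_apply]

theorem dl_mem {K : Set (Finset V)} {σ : Finset V} (h : σ ∈ K) : dl σ ∈ Ch K σ.card := by
  intro τ hτ
  rw [dl_apply] at hτ
  by_cases h1 : τ = σ
  · subst h1; exact ⟨h, rfl⟩
  · simp [h1] at hτ

theorem dl_insert {v : V} {σ : Finset V} (h : v ∉ σ) : dl (insert v σ) = cone v (dl σ) := by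
  funext τ
  rw [dl_apply, cone_apply]
  by_cases hv : v ∈ τ
  · rw [if_pos hv, dl_apply]
    congr 1
    apply propext
    constructor
    · rintro rfl; simp [h]
    · intro h2; rw [← h2, Finset.insert_erase hv]
  · rw [if_neg hv, if_neg]
    rintro rfl; simp at hv

theorem bd_dl_empty : bd (dl (∅ : Finset V)) = 0 := 
  bd_zero_card (K := Set.univ) (dl_mem (σ := ∅) (by simp))

theorem bd_dl_singleton (v : V) : bd (dl ({v} : Finset V)) = dl ∅ := by
  have := dl_insert (v := v) (σ := ∅) (by simp)
  rw [insert_empty_eq] at this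
  rw [this, bd_cone, bd_dl_empty]; simp

theorem zmod2_ne_zero {x : ZMod 2} (h : x ≠ 0) : x = 1 := by
  revert x; decide

/-- A nonzero top cycle of a homology sphere involves every vertex. -/
theorem top_cycle {e : ℕ} : ∀ {K : Set (Finset V)}, HS (e + 1) K → ∀ {z : Chain V},
    z ∈ Ch K (e + 1) → bd z = 0 → z ≠ 0 → ∀ v : V, {v} ∈ K → lkc v z ≠ 0 := by
  induction e with
  | zero =>
    intro K hK z hz hbz hz0 v hv hvz
    obtain ⟨τ, hτ⟩ := Function.ne_iff.mp hz0
    obtain ⟨hτK, hτc⟩ := hz τ hτ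
    obtain ⟨a, rfl⟩ := Finset.card_eq_one.mp hτc
    have hav : v ≠ a := by
      rintro rfl
      have := congrFun hvz ∅
      rw [lkc_apply, if_neg (by simp)] at this
      exact hτ (by simpa using this)
    have hzm : dl {a} + dl {v} ∈ Ch K (0 + 1) := Submodule.add_mem _ (dl_mem hτK) (dl_mem hv)
    have hzv : lkc v (dl {a} + dl {v}) ≠ 0 := by
      intro h
      have := congrFun h ∅
      rw [lkc_apply, if_neg (by simp)] at this
      simp [dl_apply, hav] at this
    have nb : ∀ y ∈ Ch K (0 + 1), y ≠ 0 → ¬ ∃ w ∈ Ch K (0 + 1 + 1), bd w = y := by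
      rintro y hy hy0 ⟨w, hw, rfl⟩
      rw [hK.eq_zero hw, map_zero] at hy0
      exact hy0 rfl
    obtain ⟨w, hw, hbw⟩ := hK.sph0.2 z hz hbz _ hzm
      (by rw [map_add, bd_dl_singleton, bd_dl_singleton, chain_add_self])
      (nb _ hz hz0) (nb _ hzm (by rintro h; rw [h] at hzv; simp at hzv))
    rw [hK.eq_zero hw, map_zero] at hbw
    rw [← eq_of_add_eq_zero2 hbw.symm] at hzv
    exact hzv hvz
  | succ e ih =>
    intro K hK z hz hbz hz0 v hv hvz
    -- adjacency
    have adj : ∀ a b : V, a ≠ b → {a, b} ∈ K → lkc a z ≠ 0 → lkc b z ≠ 0 := by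
      intro a b hab habK ha hb
      have haK : {a} ∈ K := hK.dc _ habK _ (by simp)
      have := ih (hK.link haK) (lkc_mem a hz) (by rw [← lkc_bd, hbz, map_zero]) ha b
        ⟨by simpa using hab.symm, by
          rw [Finset.union_comm, ← Finset.insert_eq]; exact habK⟩
      rw [lkc_comm, hb, map_zero] at this
      exact this rfl
    obtain ⟨τ, hτ⟩ := Function.ne_iff.mp hz0
    obtain ⟨hτK, hτc⟩ := hz τ hτ
    obtain ⟨a, ha⟩ : τ.Nonempty := by rw [← Finset.card_pos]; omega
    have haz : lkc a z ≠ 0 := by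
      intro h
      have := congrFun h (τ.erase a)
      rw [lkc_apply, if_neg (by simp), Finset.insert_erase ha] at this
      exact hτ this
    have haK : {a} ∈ K := hK.dc _ hτK _ (by simpa using ha)
    obtain ⟨u, hu, hbu⟩ := hK.triv0 (c := 1) (by omega) (dl {a} + dl {v})
      (Submodule.add_mem _ (dl_mem haK) (dl_mem hv))
      (by rw [map_add, bd_dl_singleton, bd_dl_singleton, chain_add_self])
    classical
    let uA : Chain V := fun τ => if ∀ x ∈ τ, lkc x z ≠ 0 then u τ else 0
    have hav : v ≠ a := by rintro rfl; exact haz hvz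
    have huA : bd uA = dl {a} := by
      funext ρ
      by_cases hρ : ∀ x ∈ ρ, lkc x z ≠ 0
      · have e1 : bd uA ρ = bd u ρ := by
          rw [bd_apply, bd_apply]
          refine Finset.sum_congr rfl fun w _ => ?_
          by_cases hw : w ∈ ρ
          · simp [hw]
          · rw [if_neg hw, if_neg hw]
            by_cases h0 : u (insert w ρ) = 0
            · simp [uA, h0]
            · simp only [uA]
              rw [if_pos]
              obtain ⟨hk, hcard⟩ := hu _ h0
              rw [Finset.card_insert_of_notMem hw] at hcard
              obtain ⟨b, rfl⟩ := Finset.card_eq_one.mp (show ρ.card = 1 by omega)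
              intro x hx
              rw [Finset.mem_insert] at hx
              rcases hx with rfl | hx
              · refine adj b _ (by simpa using Ne.symm (by simpa using hw)) ?_ (hρ b (by simp))
                rw [Finset.pair_comm]; exact hk
              · exact hρ x hx
        rw [e1, hbu, Pi.add_apply, dl_apply {v}, if_neg, add_zero]
        rintro rfl
        exact hρ v (by simp) hvz
      · have e1 : bd uA ρ = 0 := by
          rw [bd_apply]
          refine Finset.sum_eq_zero fun w _ => ?_
          by_cases hw : w ∈ ρ
          · simp [hw]
          · rw [if_neg hw]
            simp only [uA]
            rw [if_neg]
            intro h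
            exact hρ fun x hx => h x (Finset.mem_insert_of_mem hx)
        rw [e1, dl_apply, if_neg]
        rintro rfl
        apply hρ
        intro x hx
        rw [Finset.mem_singleton] at hx
        rwa [hx]
    have h5 := bd_bd uA
    rw [huA, bd_dl_singleton] at h5
    have := congrFun h5 ∅
    simp [dl_apply] at this

/-- Deleting a vertex of a homology sphere leaves an acyclic complex. -/
theorem HS.del_vertex {e : ℕ} {K : Set (Finset V)} (h : HS e K) {v : V} (hv : {v} ∈ K) (c : ℕ) :
    Triv c (Dl K {v}) := by
  obtain ⟨e, rfl⟩ : ∃ e', e = e' + 1 := ⟨e - 1, by have := h.pos hv; omega⟩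
  have hl := h.link hv
  by_cases h1 : c = e + 1
  · subst h1
    intro y hy hby
    refine ⟨0, Submodule.zero_mem _, ?_⟩
    rw [map_zero]
    by_contra hne
    exact top_cycle h (Ch_mono (fun τ h _ => h.1) hy) hby (Ne.symm hne) v hv
      (lkc_eq_zero_of_avoid v (fun τ hτ => by simpa using hτ.2) hy)
  by_cases h2 : c = e
  · subst h2
    intro y hy hby
    obtain ⟨u, hu, hbu⟩ := h.triv0 h1 y (Ch_mono (fun τ h _ => h.1) hy) hby
    obtain ⟨a1, a2, a3, a4⟩ := push_to_link v hy hu hbu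
    by_cases hb : ∃ w ∈ Ch (Lk K {v}) (c + 1), bd w = lkc v u
    · obtain ⟨w, hw, hbw⟩ := hb
      refine ⟨del v u + w, Submodule.add_mem _ a3
        (Ch_mono (fun τ h' _ => Lk_sub_Dl h.dc v τ h') hw), ?_⟩
      rw [map_add, a4, hbw, add_assoc, chain_add_self, add_zero]
    · obtain ⟨z0, hz0, hbz0, hn0⟩ := h.sph0.1
      have hz0ne : z0 ≠ 0 := by
        rintro rfl
        exact hn0 ⟨0, Submodule.zero_mem _, map_zero _⟩
      have hlz := top_cycle h hz0 hbz0 hz0ne v hv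
      obtain ⟨w, hw, hbw⟩ := hl.sph0.2 _ a1 a2 (lkc v z0) (lkc_mem v hz0)
        (by rw [← lkc_bd, hbz0, map_zero]) hb
        (by
          rintro ⟨w, hw, hbw⟩
          rw [hl.eq_zero hw, map_zero] at hbw
          exact hlz hbw.symm)
      refine ⟨del v u + w + del v z0, Submodule.add_mem _ (Submodule.add_mem _ a3
        (Ch_mono (fun τ h' _ => Lk_sub_Dl h.dc v τ h') hw)) (del_mem v hz0), ?_⟩
      rw [map_add, map_add, a4, hbw, bd_del v z0, hbz0, map_zero, map_zero, add_zero, zero_add,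
        show y + lkc v u + (lkc v u + lkc v z0) + lkc v z0
          = y + (lkc v u + lkc v u) + (lkc v z0 + lkc v z0) by abel, chain_add_self,
          chain_add_self, add_zero, add_zero]
  · exact triv_del h.dc v (h.triv0 h1) (hl.triv0 h2)

theorem Dl_insert (K : Set (Finset V)) (σ : Finset V) (v : V) :
    Dl K (insert v σ) = Dl (Dl K σ) {v} := by
  ext T
  simp only [Dl, Set.mem_ofPred_eq, Finset.disjoint_insert_right, Finset.disjoint_singleton_right]
  tauto

theorem Lk_Dl (K : Set (Finset V)) (σ : Finset V) (v : V) (h : v ∉ σ) :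
    Lk (Dl K σ) {v} = Dl (Lk K {v}) σ := by
  ext T
  simp only [Dl, Lk, Set.mem_ofPred_eq, Finset.disjoint_union_left, Finset.disjoint_singleton_left,
    Finset.disjoint_singleton_right]
  tauto

theorem Dl_empty (K : Set (Finset V)) : Dl K ∅ = K := by
  ext T; simp [Dl]

theorem mem_Lk_singleton {K : Set (Finset V)} {v : V} {σ : Finset V} (h : v ∉ σ) :
    σ ∈ Lk K {v} ↔ insert v σ ∈ K := by
  simp only [Lk, Set.mem_ofPred_eq, Finset.disjoint_singleton_right, h, not_false_eq_true, true_and]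
  rw [Finset.union_comm, ← Finset.insert_eq]

/-- Deleting a nonempty face of a homology sphere leaves an acyclic complex. -/
theorem del_face (σ : Finset V) : ∀ {e : ℕ} {K : Set (Finset V)}, HS e K → σ ∈ K → σ.Nonempty →
    ∀ c, Triv c (Dl K σ) := by
  induction σ using Finset.induction with
  | empty => intro e K _ _ h; simp at h
  | insert v σ hv ih =>
    intro e K hK hσ _ c
    have hvK : {v} ∈ K := hK.dc _ hσ _ (by simp)
    rcases σ.eq_empty_or_nonempty with rfl | hne
    · exact hK.del_vertex hvK c
    · obtain ⟨e, rfl⟩ : ∃ e', e = e' + 1 := ⟨e - 1, by have := hK.pos hvK; omega⟩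
      rw [Dl_insert]
      refine triv_del (Dl_dc hK.dc _) v (ih hK (hK.dc _ hσ _ (Finset.subset_insert _ _)) hne c) ?_
      rw [Lk_Dl _ _ _ hv]
      exact ih (hK.link hvK) ((mem_Lk_singleton hv).mpr hσ) hne c

/-- Deleting the boundary of a missing face does not leave an acyclic complex. -/
theorem del_missing (σ : Finset V) : ∀ {e j : ℕ} {K : Set (Finset V)}, HS e K → σ ∉ K →
    (∀ v ∈ σ, σ.erase v ∈ K) → σ.card = j + 1 → ¬ Triv (e - j) (Dl K σ) := by
  induction σ using Finset.induction with
  | empty => intro e j K _ _ _ h; simp at h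
  | insert v σ hv ih =>
    intro e j K hK hσ hbdry hcard htriv
    rw [Finset.card_insert_of_notMem hv] at hcard
    have hcard : σ.card = j := by omega
    rcases σ.eq_empty_or_nonempty with rfl | hne
    · simp only [Finset.card_empty] at hcard
      subst hcard
      have : Dl K (insert v ∅) = K := by
        ext T
        simp only [Dl, insert_empty_eq, Finset.disjoint_singleton_right, Set.mem_ofPred_eq,
          and_iff_left_iff_imp]
        intro hT hvT
        exact hσ (hK.dc _ hT _ (by simpa using hvT))
      rw [this] at htriv
      obtain ⟨z, hz, hbz, hn⟩ := hK.sph0.1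
      exact hn (htriv z hz hbz)
    · have hσK : σ ∈ K := by
        have := hbdry v (by simp)
        rwa [Finset.erase_insert hv] at this
      obtain ⟨w, hw⟩ := hne
      have hwv : w ≠ v := by rintro rfl; exact hv hw
      have hvK : {v} ∈ K := hK.dc _ (hbdry w (by simp [hw])) _ (by simp [hwv.symm])
      obtain ⟨e, rfl⟩ : ∃ e', e = e' + 1 := ⟨e - 1, by have := hK.pos hvK; omega⟩
      obtain ⟨j, rfl⟩ : ∃ j', j = j' + 1 := ⟨j - 1, by
        have := Finset.card_pos.mpr ⟨w, hw⟩; omega⟩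
      rw [Nat.add_sub_add_right, Dl_insert] at htriv
      have := triv_link_of_del v (del_face σ hK hσK ⟨w, hw⟩ _) htriv (Dl_dc hK.dc _)
      rw [Lk_Dl _ _ _ hv] at this
      refine ih (hK.link hvK) (by rwa [mem_Lk_singleton hv]) ?_ hcard this
      intro u hu
      have huv : u ≠ v := by rintro rfl; exact hv hu
      rw [mem_Lk_singleton (by simp [hv])]
      have := hbdry u (by simp [hu])
      rwa [Finset.erase_insert_of_ne huv.symm] at this

end Chains

end SkelProof



namespace SkelProof

set_option linter.unusedSectionVars false
set_option linter.unusedDecidableInType false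
set_option linter.unusedFintypeInType false

section Susp

variable {V : Type*} [Fintype V] [DecidableEq V]

/-- `K'` is the suspension of `K` with apexes `a`, `b`. -/
structure IsSusp (K K' : Set (Finset V)) (a b : V) : Prop where
  hab : a ≠ b
  na : ∀ T ∈ K, a ∉ T
  nb : ∀ T ∈ K, b ∉ T
  sub : ∀ T ∈ K, T ∈ K'
  insa : ∀ T ∈ K, insert a T ∈ K'
  insb : ∀ T ∈ K, insert b T ∈ K'
  era : ∀ T ∈ K', a ∈ T → T.erase a ∈ K
  nab : ∀ T ∈ K', a ∉ T → b ∉ T → T ∈ K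

variable {K K' : Set (Finset V)} {a b : V}

theorem susp_mem (h : IsSusp K K' a b) {c : ℕ} {z : Chain V} (hz : z ∈ Ch K c) :
    cone a z + cone b z ∈ Ch K' (c + 1) :=
  Submodule.add_mem _ (cone_mem a (fun τ hτ _ => h.insa τ hτ) hz)
    (cone_mem b (fun τ hτ _ => h.insb τ hτ) hz)

theorem susp_bd (z : Chain V) :
    bd (cone a z + cone b z) = cone a (bd z) + cone b (bd z) := by
  rw [map_add, bd_cone, bd_cone, show z + cone a (bd z) + (z + cone b (bd z))
    = (z + z) + (cone a (bd z) + cone b (bd z)) by abel, chain_add_self, zero_add]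

theorem susp_lkc (h : IsSusp K K' a b) {c : ℕ} {z : Chain V} (hz : z ∈ Ch K c) :
    lkc a (cone a z + cone b z) = z := by
  have h0 : lkc a z = 0 := lkc_eq_zero_of_avoid a h.na hz
  have h1 := lkc_cone_self a z
  rw [h0, map_zero, add_zero] at h1
  rw [map_add, h1, lkc_cone_ne h.hab, h0, map_zero, add_zero]

theorem susp_lkc_mem (h : IsSusp K K' a b) {c : ℕ} {y : Chain V} (hy : y ∈ Ch K' (c + 1)) :
    lkc a y ∈ Ch K c := by
  refine Ch_mono ?_ (lkc_mem a hy)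
  intro τ hτ _
  have ha : a ∉ τ := by simpa using hτ.1
  have h2 := h.era _ hτ.2 (by simp)
  rwa [Finset.union_comm, ← Finset.insert_eq, Finset.erase_insert ha] at h2

theorem susp_bounds (h : IsSusp K K' a b) {c : ℕ} {z : Chain V} (hz : z ∈ Ch K c) :
    (∃ w ∈ Ch K' (c + 1 + 1), bd w = cone a z + cone b z) ↔ ∃ w ∈ Ch K (c + 1), bd w = z := by
  constructor
  · rintro ⟨w, hw, hbw⟩
    exact ⟨lkc a w, susp_lkc_mem h hw, by rw [← lkc_bd, hbw, susp_lkc h hz]⟩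
  · rintro ⟨w, hw, rfl⟩
    exact ⟨_, susp_mem h hw, susp_bd w⟩

theorem susp_surj (h : IsSusp K K' a b) {c : ℕ} {y : Chain V} (hy : y ∈ Ch K' (c + 1))
    (hby : bd y = 0) : ∃ z ∈ Ch K c, bd z = 0 ∧
      ∃ u ∈ Ch K' (c + 1 + 1), bd u = y + (cone a z + cone b z) := by
  have hz := susp_lkc_mem h hy
  refine ⟨lkc a y, hz, by rw [← lkc_bd, hby, map_zero], cone b (y + (cone a (lkc a y)
    + cone b (lkc a y))), ?_, ?_⟩
  · have hy1 : y + (cone a (lkc a y) + cone b (lkc a y)) ∈ Ch {T | T ∈ K' ∧ a ∉ T} (c + 1) := by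
      intro T hT
      obtain ⟨h1, h2⟩ := Submodule.add_mem _ hy (susp_mem h hz) T hT
      refine ⟨⟨h1, fun haT => hT ?_⟩, h2⟩
      have h3 : lkc a (y + (cone a (lkc a y) + cone b (lkc a y))) = 0 := by
        rw [map_add, susp_lkc h hz, chain_add_self]
      have h4 := congrFun h3 (T.erase a)
      rwa [lkc_apply, if_neg (by simp), Finset.insert_erase haT] at h4
    exact cone_mem b (fun τ hτ hb => h.insb _ (h.nab _ hτ.1 hτ.2 hb)) hy1
  · rw [bd_cone, map_add, susp_bd, hby, ← lkc_bd, hby]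
    simp

theorem bounds_congr {L : Set (Finset V)} {c : ℕ} {y z : Chain V} 
    (h : ∃ u ∈ Ch L c, bd u = y + z) : (∃ w ∈ Ch L c, bd w = y) ↔ (∃ w ∈ Ch L c, bd w = z) := by
  obtain ⟨u, hu, hbu⟩ := h
  constructor
  · rintro ⟨w, hw, rfl⟩
    exact ⟨u + w, Submodule.add_mem _ hu hw, by
      rw [map_add, hbu, add_comm (bd w), add_assoc, chain_add_self, add_zero]⟩
  · rintro ⟨w, hw, rfl⟩
    exact ⟨u + w, Submodule.add_mem _ hu hw, by
      rw [map_add, hbu, add_assoc, chain_add_self, add_zero]⟩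

theorem susp_triv (h : IsSusp K K' a b) (c : ℕ) : Triv (c + 1) K' ↔ Triv c K := by
  constructor
  · intro ht z hz hbz
    exact (susp_bounds h hz).mp (ht _ (susp_mem h hz) (by rw [susp_bd, hbz]; simp))
  · intro ht y hy hby
    obtain ⟨z, hz, hbz, hu⟩ := susp_surj h hy hby
    exact (bounds_congr hu).mpr ((susp_bounds h hz).mpr (ht z hz hbz))

theorem susp_sph (h : IsSusp K K' a b) (c : ℕ) : Sph (c + 1) K' ↔ Sph c K := by
  constructor
  · rintro ⟨⟨y, hy, hby, hn⟩, h2⟩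
    refine ⟨?_, ?_⟩
    · obtain ⟨z, hz, hbz, hu⟩ := susp_surj h hy hby
      exact ⟨z, hz, hbz, fun hw => hn ((bounds_congr hu).mpr ((susp_bounds h hz).mpr hw))⟩
    · intro z hz hbz z' hz' hbz' hn hn'
      have := h2 _ (susp_mem h hz) (by rw [susp_bd, hbz]; simp) _ (susp_mem h hz')
        (by rw [susp_bd, hbz']; simp) (fun hw => hn ((susp_bounds h hz).mp hw))
        (fun hw => hn' ((susp_bounds h hz').mp hw))
      refine (susp_bounds h (Submodule.add_mem _ hz hz')).mp ?_
      rwa [map_add, map_add, add_add_add_comm]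
  · rintro ⟨⟨z, hz, hbz, hn⟩, h2⟩
    refine ⟨⟨_, susp_mem h hz, by rw [susp_bd, hbz]; simp, fun hw =>
      hn ((susp_bounds h hz).mp hw)⟩, ?_⟩
    intro y hy hby y' hy' hby' hn hn'
    obtain ⟨z, hz, hbz, u, hu, hbu⟩ := susp_surj h hy hby
    obtain ⟨z', hz', hbz', u', hu', hbu'⟩ := susp_surj h hy' hby'
    have := h2 z hz hbz z' hz' hbz'
      (fun hw => hn ((bounds_congr ⟨u, hu, hbu⟩).mpr ((susp_bounds h hz).mpr hw)))
      (fun hw => hn' ((bounds_congr ⟨u', hu', hbu'⟩).mpr ((susp_bounds h hz').mpr hw)))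
    have h3 := (susp_bounds h (Submodule.add_mem _ hz hz')).mpr this
    refine (bounds_congr ⟨u + u', Submodule.add_mem _ hu hu', ?_⟩).mpr h3
    rw [map_add, hbu, hbu', map_add, map_add]
    abel

theorem susp_triv_zero (h : IsSusp K K' a b) : Triv 0 K' := by
  intro z hz hbz
  refine ⟨cone a z, ?_, by rw [bd_cone, hbz]; simp⟩
  intro τ hτ
  rw [cone_apply] at hτ
  by_cases ha : a ∈ τ
  · rw [if_pos ha] at hτ
    obtain ⟨h1, h2⟩ := hz _ hτ
    rw [Finset.card_eq_zero] at h2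
    rw [h2] at h1
    have : τ = insert a ∅ := by rw [← h2, Finset.insert_erase ha]
    rw [this]
    exact ⟨h.insa _ (h.nab _ h1 (by simp) (by simp)), by simp⟩
  · simp [ha] at hτ

theorem point_sph : Sph 0 ({∅} : Set (Finset V)) := by
  have key : ∀ w ∈ Ch ({∅} : Set (Finset V)) (0 + 1), w = 0 := by
    intro w hw
    funext τ
    by_contra h
    obtain ⟨h1, h2⟩ := hw τ h
    rw [Set.mem_singleton_iff] at h1
    subst h1
    simp at h2
  refine ⟨⟨dl ∅, dl_mem (σ := ∅) (by simp), bd_dl_empty, ?_⟩, ?_⟩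
  · rintro ⟨w, hw, hbw⟩
    rw [key w hw, map_zero] at hbw
    have := congrFun hbw ∅
    simp [dl_apply] at this
  · intro z hz _ z' hz' _ hn hn'
    have aux : ∀ z ∈ Ch ({∅} : Set (Finset V)) 0, (¬ ∃ w ∈ Ch {∅} (0 + 1), bd w = z) →
        z = dl ∅ := by
      intro z hz hn
      have h0 : ∀ τ, τ ≠ ∅ → z τ = 0 := by
        intro τ hτ; by_contra h3; exact hτ (hz τ h3).1
      funext τ
      by_cases hτ : τ = ∅
      · subst hτ
        rw [dl_apply, if_pos rfl]
        apply zmod2_ne_zero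
        intro h3
        apply hn
        refine ⟨0, Submodule.zero_mem _, ?_⟩
        rw [map_zero]
        funext ρ
        by_cases hρ : ρ = ∅
        · subst hρ; exact h3.symm
        · exact (h0 ρ hρ).symm
      · rw [h0 τ hτ, dl_apply, if_neg hτ]
    rw [aux z hz hn, aux z' hz' hn', chain_add_self]
    exact ⟨0, Submodule.zero_mem _, map_zero _⟩

theorem point_triv (c : ℕ) : Triv (c + 1) ({∅} : Set (Finset V)) := by
  intro w hw _
  refine ⟨0, Submodule.zero_mem _, ?_⟩
  rw [map_zero]
  funext τ
  by_contra h
  obtain ⟨h1, h2⟩ := hw τ (Ne.symm h)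
  rw [Set.mem_singleton_iff] at h1
  subst h1
  simp at h2

end Susp

section Relabel

variable {V V' : Type*} [Fintype V] [DecidableEq V] [Fintype V'] [DecidableEq V']

open Classical in
/-- Pull back a chain along a map of vertices, on subsets of `X`. -/
noncomputable def pull (φ : V → V') (X : Set V) (z : Chain V') : Chain V :=
  fun T => if ∀ v ∈ T, v ∈ X then z (T.image φ) else 0

theorem image_image_inv {φ : V → V'} {ψ : V' → V} {X : Set V} (hφ : ∀ v ∈ X, ψ (φ v) = v)
    {T : Finset V} (hT : ∀ v ∈ T, v ∈ X) : (T.image φ).image ψ = T := by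
  rw [Finset.image_image]
  ext v
  simp only [Finset.mem_image, Function.comp]
  constructor
  · rintro ⟨w, hw, rfl⟩; rw [hφ w (hT w hw)]; exact hw
  · intro hv; exact ⟨v, hv, hφ v (hT v hv)⟩

theorem card_image_inv {φ : V → V'} {ψ : V' → V} {X : Set V} (hφ : ∀ v ∈ X, ψ (φ v) = v)
    {T : Finset V} (hT : ∀ v ∈ T, v ∈ X) : (T.image φ).card = T.card := by
  apply Finset.card_image_of_injOn
  intro x hx y hy hxy
  rw [← hφ x (hT x hx), ← hφ y (hT y hy), hxy]

theorem pull_mem {φ : V → V'} {ψ : V' → V} {X : Set V} (hφ : ∀ v ∈ X, ψ (φ v) = v)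
    {K : Set (Finset V)} {K' : Set (Finset V')} {n : ℕ}
    (hK' : ∀ T ∈ K', T.card = n → T.image ψ ∈ K) {z : Chain V'} (hz : z ∈ Ch K' n) :
    pull φ X z ∈ Ch K n := by
  intro T hT
  by_cases hX : ∀ v ∈ T, v ∈ X
  · rw [pull, if_pos hX] at hT
    obtain ⟨h1, h2⟩ := hz _ hT
    have h3 := hK' _ h1 h2
    rw [image_image_inv hφ hX] at h3
    exact ⟨h3, by rw [← h2, card_image_inv hφ hX]⟩
  · rw [pull, if_neg hX] at hT
    exact absurd rfl hT

theorem pull_pull {φ : V → V'} {ψ : V' → V} {X : Set V} {X' : Set V'}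
    (hψ : ∀ v ∈ X', φ (ψ v) = v) (hψX : ∀ v ∈ X', ψ v ∈ X)
    {z : Chain V'} (hz : ∀ T, z T ≠ 0 → ∀ v ∈ T, v ∈ X') :
    pull ψ X' (pull φ X z) = z := by
  funext T
  by_cases hT : ∀ v ∈ T, v ∈ X'
  · rw [pull, if_pos hT, pull, if_pos, image_image_inv hψ hT]
    intro v hv
    obtain ⟨w, hw, rfl⟩ := Finset.mem_image.mp hv
    exact hψX w (hT w hw)
  · rw [pull, if_neg hT]
    by_contra h
    exact hT (hz T (Ne.symm h))

theorem bd_pull {φ : V → V'} {ψ : V' → V} {X : Set V} {X' : Set V'}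
    (hφ : ∀ v ∈ X, ψ (φ v) = v) (hφX : ∀ v ∈ X, φ v ∈ X')
    (hψ : ∀ v ∈ X', φ (ψ v) = v) (hψX : ∀ v ∈ X', ψ v ∈ X)
    {z : Chain V'} (hz : ∀ T, z T ≠ 0 → ∀ v ∈ T, v ∈ X') :
    bd (pull φ X z) = pull φ X (bd z) := by
  classical
  funext T
  rw [bd_apply]
  by_cases hT : ∀ v ∈ T, v ∈ X
  · rw [pull, if_pos hT, bd_apply]
    have e1 : ∀ v, (if v ∈ T then 0 else pull φ X z (insert v T)) =
        if v ∈ X then (if v ∈ T then 0 else z (insert (φ v) (T.image φ))) else 0 := by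
      intro v
      by_cases hv : v ∈ T
      · simp [hv]
      · by_cases hvX : v ∈ X
        · rw [if_neg hv, if_pos hvX, if_neg hv, pull, if_pos, Finset.image_insert]
          intro w hw
          rcases Finset.mem_insert.mp hw with rfl | hw
          · exact hvX
          · exact hT w hw
        · rw [if_neg hv, if_neg hvX, pull, if_neg]
          intro h
          exact hvX (h v (by simp))
    have e2 : ∀ v, (if v ∈ T.image φ then 0 else z (insert v (T.image φ))) =
        if v ∈ X' then (if v ∈ T.image φ then 0 else z (insert v (T.image φ))) else 0 := by
      intro v
      by_cases hvX : v ∈ X'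
      · rw [if_pos hvX]
      · rw [if_neg hvX]
        by_cases hv : v ∈ T.image φ
        · rw [if_pos hv]
        · rw [if_neg hv]
          by_contra h
          exact hvX (hz _ h v (by simp))
    rw [Finset.sum_congr rfl fun v _ => e1 v, Finset.sum_congr rfl fun v _ => e2 v,
      ← Finset.sum_filter, ← Finset.sum_filter]
    refine Finset.sum_bij' (fun v _ => φ v) (fun v _ => ψ v) ?_ ?_ ?_ ?_ ?_
    · intro v hv; simp only [Finset.mem_filter, Finset.mem_univ, true_and] at hv ⊢; exact hφX v hv
    · intro v hv; simp only [Finset.mem_filter, Finset.mem_univ, true_and] at hv ⊢; exact hψX v hv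
    · intro v hv; simp only [Finset.mem_filter, Finset.mem_univ, true_and] at hv; exact hφ v hv
    · intro v hv; simp only [Finset.mem_filter, Finset.mem_univ, true_and] at hv; exact hψ v hv
    · intro v hv
      simp only [Finset.mem_filter, Finset.mem_univ, true_and] at hv
      have : v ∈ T ↔ φ v ∈ T.image φ := by
        constructor
        · exact Finset.mem_image_of_mem _
        · intro h
          obtain ⟨w, hw, hwv⟩ := Finset.mem_image.mp h
          have : w = v := by rw [← hφ w (hT w hw), hwv, hφ v hv]
          rwa [← this]
      simp only [this]
  · rw [pull, if_neg hT]
    refine Finset.sum_eq_zero fun v _ => ?_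
    by_cases hv : v ∈ T
    · simp [hv]
    · rw [if_neg hv, pull, if_neg]
      intro h
      exact hT fun w hw => h w (Finset.mem_insert_of_mem hw)

/-- A bijection between vertex sets that identifies low-dimensional faces transports `Triv`. -/
theorem triv_relabel {φ : V → V'} {ψ : V' → V} {X : Set V} {X' : Set V'}
    (hφ : ∀ v ∈ X, ψ (φ v) = v) (hφX : ∀ v ∈ X, φ v ∈ X')
    (hψ : ∀ v ∈ X', φ (ψ v) = v) (hψX : ∀ v ∈ X', ψ v ∈ X)
    {K : Set (Finset V)} {K' : Set (Finset V')} {c : ℕ}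
    (hKX : ∀ T ∈ K, ∀ v ∈ T, v ∈ X) (hKX' : ∀ T ∈ K', ∀ v ∈ T, v ∈ X')
    (hK : ∀ T ∈ K, T.card ≤ c + 1 → T.image φ ∈ K')
    (hK' : ∀ T ∈ K', T.card ≤ c + 1 → T.image ψ ∈ K)
    (h : Triv c K) : Triv c K' := by
  intro z hz hbz
  have hzX : ∀ T, z T ≠ 0 → ∀ v ∈ T, v ∈ X' := fun T hT => hKX' T (hz T hT).1
  obtain ⟨w, hw, hbw⟩ := h (pull φ X z) (pull_mem hφ (fun T hT hc => hK' T hT (by omega)) hz)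
    (by
      rw [bd_pull hφ hφX hψ hψX hzX, hbz]
      funext T; simp [pull])
  have hwX : ∀ T, w T ≠ 0 → ∀ v ∈ T, v ∈ X := fun T hT => hKX T (hw T hT).1
  refine ⟨pull ψ X' w, pull_mem hψ (fun T hT hc => hK T hT (by omega)) hw, ?_⟩
  rw [bd_pull hψ hψX hφ hφX hwX, hbw, pull_pull hψ hψX hzX]

theorem comb_step {φ : V → V'} {ψ : V' → V} {X : Set V} {X' : Set V'}
    (hφ : ∀ v ∈ X, ψ (φ v) = v) (hφX : ∀ v ∈ X, φ v ∈ X')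
    (hψ : ∀ v ∈ X', φ (ψ v) = v) (hψX : ∀ v ∈ X', ψ v ∈ X)
    {L : Set (Finset V)} {L' : Set (Finset V')} {e e' j : ℕ} (hL : HS e L) (hL' : HS e' L')
    (hLX : ∀ T ∈ L, ∀ v ∈ T, v ∈ X) (hLX' : ∀ T ∈ L', ∀ v ∈ T, v ∈ X')
    (hj : 1 ≤ j) (hje : e' + 1 ≤ 2 * j)
    (hlow : ∀ T : Finset V, (∀ v ∈ T, v ∈ X) → T.card ≤ j → (T ∈ L ↔ T.image φ ∈ L'))
    {σ : Finset V} (hσ : σ ∈ L) (hσc : σ.card = j + 1) : σ.image φ ∈ L' := by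
  by_contra hn
  have hσX := hLX σ hσ
  have hc := card_image_inv hφ hσX
  refine del_missing (σ.image φ) hL' hn ?_ (by rw [hc, hσc]) ?_
  · intro v' hv'
    obtain ⟨v, hv, rfl⟩ := Finset.mem_image.mp hv'
    have h1 : (σ.image φ).erase (φ v) = (σ.erase v).image φ := by
      ext w
      simp only [Finset.mem_erase, Finset.mem_image]
      constructor
      · rintro ⟨h1, u, hu, rfl⟩
        exact ⟨u, ⟨fun h => h1 (by rw [h]), hu⟩, rfl⟩
      · rintro ⟨u, ⟨h1, hu⟩, rfl⟩
        refine ⟨fun h => h1 ?_, u, hu, rfl⟩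
        rw [← hφ u (hσX u hu), h, hφ v (hσX v hv)]
    rw [h1, ← hlow _ (fun w hw => hσX w (Finset.mem_of_mem_erase hw))
      (by rw [Finset.card_erase_of_mem hv]; omega)]
    exact hL.dc _ hσ _ (Finset.erase_subset _ _)
  · refine triv_relabel (K := Dl L σ) hφ hφX hψ hψX (fun T hT => hLX T hT.1)
      (fun T hT => hLX' T hT.1) ?_ ?_ (del_face σ hL hσ
        (by rw [← Finset.card_pos]; omega) _)
    · intro T hT hTc
      refine ⟨(hlow T (hLX T hT.1) (by omega)).mp hT.1, ?_⟩
      rw [Finset.disjoint_left]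
      intro w hw hw2
      obtain ⟨u, hu, rfl⟩ := Finset.mem_image.mp hw
      obtain ⟨v, hv, huv⟩ := Finset.mem_image.mp hw2
      have : v = u := by rw [← hφ v (hσX v hv), huv, hφ u (hLX T hT.1 u hu)]
      subst this
      exact (Finset.disjoint_left.mp hT.2) hu hv
    · intro T hT hTc
      have hTX := hLX' T hT.1
      refine ⟨?_, ?_⟩
      · rw [hlow _ ?_ ?_, image_image_inv hψ hTX]
        · exact hT.1
        · intro v hv
          obtain ⟨w, hw, rfl⟩ := Finset.mem_image.mp hv
          exact hψX w (hTX w hw)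
        · rw [card_image_inv hψ hTX]; omega
      · rw [Finset.disjoint_left]
        intro w hw hw2
        obtain ⟨u, hu, rfl⟩ := Finset.mem_image.mp hw
        refine (Finset.disjoint_left.mp hT.2) hu ?_
        rw [← hψ u (hTX u hu)]
        exact Finset.mem_image_of_mem _ hw2

/-- Homology spheres are determined by half of their skeleton. -/
theorem comb_main {φ : V → V'} {ψ : V' → V} {X : Set V} {X' : Set V'}
    (hφ : ∀ v ∈ X, ψ (φ v) = v) (hφX : ∀ v ∈ X, φ v ∈ X')
    (hψ : ∀ v ∈ X', φ (ψ v) = v) (hψX : ∀ v ∈ X', ψ v ∈ X)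
    {L : Set (Finset V)} {L' : Set (Finset V')} {e e' k : ℕ} (hL : HS e L) (hL' : HS e' L')
    (hLX : ∀ T ∈ L, ∀ v ∈ T, v ∈ X) (hLX' : ∀ T ∈ L', ∀ v ∈ T, v ∈ X')
    (hk : e + 1 ≤ 2 * k) (hk' : e' + 1 ≤ 2 * k)
    (hlow : ∀ T : Finset V, (∀ v ∈ T, v ∈ X) → T.card ≤ k → (T ∈ L ↔ T.image φ ∈ L')) :
    ∀ T : Finset V, (∀ v ∈ T, v ∈ X) → (T ∈ L ↔ T.image φ ∈ L') := by
  suffices H : ∀ j, k ≤ j → ∀ T : Finset V, (∀ v ∈ T, v ∈ X) → T.card ≤ j →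
      (T ∈ L ↔ T.image φ ∈ L') from
    fun T hT => H (max k T.card) (le_max_left _ _) T hT (le_max_right _ _)
  intro j hj
  induction j, hj using Nat.le_induction with
  | base => exact hlow
  | succ j hj ih =>
    intro T hT hTc
    rcases Nat.lt_or_ge T.card (j + 1) with h | h
    · exact ih T hT (by omega)
    have hTc : T.card = j + 1 := by omega
    constructor
    · intro hTL
      exact comb_step hφ hφX hψ hψX hL hL' hLX hLX' (by omega) (by omega) ih hTL hTc
    · intro hTL
      have := comb_step hψ hψX hφ hφX hL' hL hLX' hLX (j := j) (by omega) (by omega) ?_ hTL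
        (by rw [card_image_inv hφ hT, hTc])
      · rwa [image_image_inv hφ hT] at this
      · intro S hS hSc
        rw [ih (S.image ψ) ?_ (by rw [card_image_inv hψ hS]; exact hSc), image_image_inv hψ hS]
        intro v hv
        obtain ⟨w, hw, rfl⟩ := Finset.mem_image.mp hv
        exact hψX w (hS w hw)

end Relabel

end SkelProof



namespace SkelProof

set_option linter.unusedSectionVars false
set_option linter.unusedDecidableInType false
set_option linter.unusedFintypeInType false

section ListChains

variable {E F : Type*}

/-- Chains of lists of points. -/
abbrev LC (E : Type*) : Type _ := List E →₀ ZMod 2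

/-- The list as a chain -/
noncomputable abbrev sg (l : List E) : LC E := Finsupp.single l 1

noncomputable def consL (a : E) : LC E →ₗ[ZMod 2] LC E := Finsupp.lmapDomain _ _ (List.cons a)

noncomputable def mapL (f : E → F) : LC E →ₗ[ZMod 2] LC F := Finsupp.lmapDomain _ _ (List.map f)

noncomputable def bdl : List E → LC E
  | [] => 0
  | a :: l => sg l + consL a (bdl l)

noncomputable def dL : LC E →ₗ[ZMod 2] LC E := Finsupp.linearCombination (ZMod 2) bdl

theorem consL_sg (a : E) (l : List E) : consL a (sg l) = sg (a :: l) := by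
  simp [consL, Finsupp.mapDomain_single]

theorem mapL_sg (f : E → F) (l : List E) : mapL f (sg l) = sg (l.map f) := by
  simp [mapL, Finsupp.mapDomain_single]

theorem dL_sg (l : List E) : dL (sg l) = bdl l := by
  simp [dL]

theorem LC_ext {M : Type*} [AddCommGroup M] [Module (ZMod 2) M] {S T : LC E →ₗ[ZMod 2] M}
    (h : ∀ l, S (sg l) = T (sg l)) : S = T :=
  Finsupp.lhom_ext' fun l => LinearMap.ext_ring (h l)

theorem LC_ext' {M : Type*} [AddCommGroup M] [Module (ZMod 2) M] (S T : LC E →ₗ[ZMod 2] M)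
    (h : ∀ l, S (sg l) = T (sg l)) (y : LC E) : S y = T y := by
  rw [LC_ext h]

theorem nsmul2 {M : Type*} [AddCommGroup M] [Module (ZMod 2) M] (x : M) : (2 : ℕ) • x = 0 := by
  rw [two_nsmul]; exact chain_add_self x

theorem zsmul2 {M : Type*} [AddCommGroup M] [Module (ZMod 2) M] (x : M) : (2 : ℤ) • x = 0 := by
  rw [two_zsmul]; exact chain_add_self x

theorem dL_consL (a : E) (y : LC E) : dL (consL a y) = y + consL a (dL y) := by
  refine LC_ext' (dL ∘ₗ consL a) (LinearMap.id + consL a ∘ₗ dL) (fun l => ?_) y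
  simp only [LinearMap.comp_apply, LinearMap.add_apply, LinearMap.id_apply, consL_sg, dL_sg, bdl]

theorem dL_dL (y : LC E) : dL (dL y) = 0 := by
  refine LC_ext' (dL ∘ₗ dL) 0 (fun l => ?_) y
  simp only [LinearMap.comp_apply, LinearMap.zero_apply, dL_sg]
  induction l with
  | nil => simp [bdl]
  | cons a l ih => rw [bdl, map_add, dL_sg, dL_consL, ih, map_zero, add_zero, chain_add_self]

theorem mapL_consL (f : E → F) (a : E) (y : LC E) :
    mapL f (consL a y) = consL (f a) (mapL f y) := by
  refine LC_ext' (mapL f ∘ₗ consL a) (consL (f a) ∘ₗ mapL f) (fun l => ?_) y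
  simp only [LinearMap.comp_apply, consL_sg, mapL_sg, List.map_cons]

theorem mapL_dL (f : E → F) (y : LC E) : mapL f (dL y) = dL (mapL f y) := by
  refine LC_ext' (mapL f ∘ₗ dL) (dL ∘ₗ mapL f) (fun l => ?_) y
  simp only [LinearMap.comp_apply, dL_sg, mapL_sg]
  induction l with
  | nil => simp [bdl]
  | cons a l ih => rw [List.map_cons, bdl, bdl, map_add, mapL_consL, ih, mapL_sg]

theorem mapL_mapL {G : Type*} (g : F → G) (f : E → F) (y : LC E) :
    mapL g (mapL f y) = mapL (fun x => g (f x)) y := by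
  refine LC_ext' (mapL g ∘ₗ mapL f) (mapL (fun x => g (f x))) (fun l => ?_) y
  simp only [LinearMap.comp_apply, mapL_sg, List.map_map]
  rfl

noncomputable def prl (f g : E → F) : List E → LC F
  | [] => 0
  | a :: l => sg (f a :: g a :: l.map g) + consL (f a) (prl f g l)

noncomputable def prL (f g : E → F) : LC E →ₗ[ZMod 2] LC F :=
  Finsupp.linearCombination (ZMod 2) (prl f g)

theorem prL_sg (f g : E → F) (l : List E) : prL f g (sg l) = prl f g l := by
  simp [prL]

theorem prL_consL (f g : E → F) (a : E) (y : LC E) :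
    prL f g (consL a y) = consL (f a) (consL (g a) (mapL g y)) + consL (f a) (prL f g y) := by
  refine LC_ext' (prL f g ∘ₗ consL a)
    (consL (f a) ∘ₗ consL (g a) ∘ₗ mapL g + consL (f a) ∘ₗ prL f g) (fun l => ?_) y
  simp only [LinearMap.comp_apply, LinearMap.add_apply, consL_sg, prL_sg, mapL_sg, prl]

theorem prism (f g : E → F) (y : LC E) :
    dL (prL f g y) + prL f g (dL y) = mapL f y + mapL g y := by
  refine LC_ext' (dL ∘ₗ prL f g + prL f g ∘ₗ dL) (mapL f + mapL g) (fun l => ?_) y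
  simp only [LinearMap.comp_apply, LinearMap.add_apply]
  induction l with
  | nil => simp [dL_sg, prL_sg, bdl, prl, mapL_sg]; exact (chain_add_self _).symm
  | cons a l ih =>
    have ih2 := congrArg (consL (f a)) ih
    simp only [map_add, mapL_sg, consL_sg] at ih2
    rw [← consL_sg a l, dL_consL, prL_consL, map_add, map_add, dL_consL, dL_consL, dL_consL,
      prL_consL, mapL_consL, mapL_consL, mapL_sg, mapL_sg, mapL_dL, mapL_sg, consL_sg, consL_sg]
    apply eq_of_add_eq_zero2
    have h3 := chain_add_self (consL (f a) (dL (prL f g (sg l))) + consL (f a) (prL f g (dL (sg l))))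
    nth_rewrite 1 [ih2] at h3
    rw [← h3]
    apply eq_of_add_eq_zero2
    simp only [map_add, consL_sg]
    abel_nf
    simp only [nsmul2, zsmul2, zero_add, add_zero]

/-- Chains supported on lists with a property. -/
abbrev sup (P : List E → Prop) : Submodule (ZMod 2) (LC E) :=
  Finsupp.supported (ZMod 2) (ZMod 2) {l | P l}

theorem sg_mem {P : List E → Prop} {l : List E} (h : P l) : sg l ∈ sup P :=
  Finsupp.single_mem_supported _ _ h

theorem sup_ind {M : Type*} [AddCommGroup M] [Module (ZMod 2) M] {P : List E → Prop}
    (T : LC E →ₗ[ZMod 2] M) (Q : Submodule (ZMod 2) M) (h : ∀ l, P l → T (sg l) ∈ Q) {y : LC E}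
    (hy : y ∈ sup P) : T y ∈ Q := by
  have h2 : sup P ≤ Q.comap T := by
    unfold sup; rw [Finsupp.supported_eq_span_single, Submodule.span_le]
    rintro _ ⟨l, hl, rfl⟩
    exact h l hl
  exact h2 hy

theorem sup_eq {M : Type*} [AddCommGroup M] [Module (ZMod 2) M] {P : List E → Prop}
    (S T : LC E →ₗ[ZMod 2] M) (h : ∀ l, P l → S (sg l) = T (sg l)) {y : LC E}
    (hy : y ∈ sup P) : S y = T y := by
  have := sup_ind (S - T) ⊥ (fun l hl => by simp [h l hl]) hy
  rw [Submodule.mem_bot, LinearMap.sub_apply, sub_eq_zero] at this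
  exact this

theorem sup_mono {P Q : List E → Prop} (h : ∀ l, P l → Q l) {y : LC E} (hy : y ∈ sup P) :
    y ∈ sup Q :=
  Finsupp.supported_mono (fun l hl => h l hl) hy

theorem consL_mem {P Q : List E → Prop} (a : E) (h : ∀ l, P l → Q (a :: l)) {y : LC E}
    (hy : y ∈ sup P) : consL a y ∈ sup Q :=
  sup_ind (consL a) _ (fun l hl => by rw [consL_sg]; exact sg_mem (h l hl)) hy

theorem mapL_mem {P : List E → Prop} {Q : List F → Prop} (f : E → F) (h : ∀ l, P l → Q (l.map f))
    {y : LC E} (hy : y ∈ sup P) : mapL f y ∈ sup Q :=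
  sup_ind (mapL f) _ (fun l hl => by rw [mapL_sg]; exact sg_mem (h l hl)) hy

theorem bdl_mem (l : List E) :
    bdl l ∈ sup (fun l' => l'.length + 1 = l.length ∧ ∀ x ∈ l', x ∈ l) := by
  induction l with
  | nil => simp [bdl]
  | cons a l ih =>
    rw [bdl]
    refine Submodule.add_mem _ (sg_mem ⟨by simp, fun x hx => by simp [hx]⟩) (consL_mem a ?_ ih)
    rintro l' ⟨h1, h2⟩
    refine ⟨by simp [h1], ?_⟩
    intro x hx
    rw [List.mem_cons] at hx ⊢
    exact hx.imp id (h2 x)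

theorem prl_mem (f g : E → F) (l : List E) :
    prl f g l ∈ sup (fun l' => l'.length = l.length + 1 ∧ ∀ y ∈ l', ∃ x ∈ l, y = f x ∨ y = g x) := by
  induction l with
  | nil => simp [prl]
  | cons a l ih =>
    rw [prl]
    refine Submodule.add_mem _ (sg_mem ⟨by simp, ?_⟩) (consL_mem _ ?_ ih)
    · intro y hy
      simp only [List.mem_cons, List.mem_map] at hy
      rcases hy with h | h | ⟨x, hx, rfl⟩
      · exact ⟨a, by simp, Or.inl h⟩
      · exact ⟨a, by simp, Or.inr h⟩
      · exact ⟨x, by simp [hx], Or.inr rfl⟩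
    · rintro l' ⟨h1, h2⟩
      refine ⟨by simp [h1], ?_⟩
      intro y hy
      rw [List.mem_cons] at hy
      rcases hy with h | h
      · exact ⟨a, by simp, Or.inl h⟩
      · obtain ⟨x, hx, hxy⟩ := h2 y h
        exact ⟨x, by simp [hx], hxy⟩

theorem prism_sum (h : ℕ → E → F) (N : ℕ) (y : LC E) :
    dL (∑ j ∈ Finset.range N, prL (h j) (h (j + 1)) y) +
      ∑ j ∈ Finset.range N, prL (h j) (h (j + 1)) (dL y) = mapL (h 0) y + mapL (h N) y := by
  induction N with
  | zero => simp [chain_add_self]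
  | succ N ih =>
    rw [Finset.sum_range_succ, Finset.sum_range_succ, map_add]
    have h2 := prism (h N) (h (N + 1)) y
    have h3 : (dL (∑ j ∈ Finset.range N, prL (h j) (h (j + 1)) y) +
      ∑ j ∈ Finset.range N, prL (h j) (h (j + 1)) (dL y)) +
      (dL (prL (h N) (h (N + 1)) y) + prL (h N) (h (N + 1)) (dL y))
       = mapL (h 0) y + mapL (h (N + 1)) y := by
      rw [ih, h2]
      apply eq_of_add_eq_zero2
      abel_nf
      simp only [nsmul2, zsmul2, zero_add, add_zero]
    rw [← h3]; abel

end ListChains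

section Contraction

variable {V : Type*} [Fintype V] [DecidableEq V]

/-- straight-line homotopy -/
noncomputable def hst (N : ℕ) (c : V → ℝ) (j : ℕ) (x : V → ℝ) : V → ℝ :=
  (1 - (j : ℝ) / N) • x + ((j : ℝ) / N) • c

/-- the cone contraction subdivided into `N` steps -/
noncomputable def Dc (N : ℕ) (c : V → ℝ) : LC (V → ℝ) →ₗ[ZMod 2] LC (V → ℝ) :=
  ∑ j ∈ Finset.range N, prL (hst N c j) (hst N c (j + 1)) + consL c ∘ₗ mapL (fun _ => c)

theorem Dc_spec {N : ℕ} (hN : 0 < N) (c : V → ℝ) (y : LC (V → ℝ)) :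
    dL (Dc N c y) + Dc N c (dL y) = y := by
  have h1 := prism_sum (hst N c) N y
  have h0 : hst N c 0 = id := by funext x; simp [hst]
  have hNN : hst N c N = fun _ => c := by
    funext x
    have : (N : ℝ) ≠ 0 := by positivity
    simp [hst, this]
  have hid : mapL (id : (V → ℝ) → (V → ℝ)) y = y :=
    LC_ext' (mapL id) LinearMap.id (fun l => by simp [mapL_sg]) y
  rw [h0, hNN, hid] at h1
  simp only [Dc, LinearMap.add_apply, LinearMap.sum_apply, LinearMap.comp_apply, map_add, dL_consL,
    mapL_dL] at h1 ⊢
  generalize consL c (dL (mapL (fun x => c) y)) = q at *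
  have h2 : ∀ A B : LC (V → ℝ), A + B = y + mapL (fun _ => c) y →
      A + (mapL (fun _ => c) y + q) + (B + q) = y := by
    intro A B h
    rw [show A + (mapL (fun _ => c) y + q) + (B + q) = (A + B) + mapL (fun _ => c) y + (q + q) by
      abel, h, chain_add_self, add_zero, add_assoc, chain_add_self, add_zero]
  exact h2 _ _ h1

/-- lists of small diameter -/
def Sm (s : ℝ) (l : List (V → ℝ)) : Prop := ∀ x ∈ l, ∀ y ∈ l, dist x y ≤ s

theorem dist_std {x y : V → ℝ} (hx : x ∈ stdSimplex ℝ V) (hy : y ∈ stdSimplex ℝ V) :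
    dist x y ≤ 1 := by
  rw [dist_pi_le_iff zero_le_one]
  intro v
  rw [Real.dist_eq, abs_le]
  have h1 := hx.1 v
  have h2 := hy.1 v
  have h3 : x v ≤ 1 := by rw [← hx.2]; exact Finset.single_le_sum (fun i _ => hx.1 i) (Finset.mem_univ v)
  have h4 : y v ≤ 1 := by rw [← hy.2]; exact Finset.single_le_sum (fun i _ => hy.1 i) (Finset.mem_univ v)
  constructor <;> linarith

theorem dist_hst {N : ℕ} (hN : 0 < N) {c x x' : V → ℝ} {j j' : ℕ} (hj' : j' ≤ N)
    (h1 : |(j : ℝ) - j'| ≤ 1) (hx : dist x c ≤ 1) :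
    dist (hst N c j x) (hst N c j' x') ≤ dist x x' + 1 / N := by
  have hN' : (0 : ℝ) < N := by exact_mod_cast hN
  have e1 : dist (hst N c j x) (hst N c j' x) ≤ 1 / N := by
    have : hst N c j x - hst N c j' x = (((j' : ℝ) - j) / N) • (x - c) := by
      funext v; simp [hst]; ring
    rw [dist_eq_norm, this, norm_smul, ← dist_eq_norm, Real.norm_eq_abs, abs_div,
      abs_of_pos hN', abs_sub_comm]
    calc |(j : ℝ) - j'| / N * dist x c ≤ |(j : ℝ) - j'| / N * 1 := by gcongr
      _ ≤ 1 / N := by rw [mul_one]; gcongr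
  have e2 : dist (hst N c j' x) (hst N c j' x') ≤ dist x x' := by
    have : hst N c j' x - hst N c j' x' = (1 - (j' : ℝ) / N) • (x - x') := by
      funext v; simp [hst]; ring
    have hj : (j' : ℝ) ≤ N := by exact_mod_cast hj'
    have h3 : (j' : ℝ) / N ≤ 1 := by rw [div_le_one hN']; exact hj
    have h4 : 0 ≤ (j' : ℝ) / N := by positivity
    rw [dist_eq_norm, this, norm_smul, Real.norm_eq_abs, abs_of_nonneg (by linarith), ← dist_eq_norm]
    nlinarith [dist_nonneg (x := x) (y := x')]
  linarith [dist_triangle (hst N c j x) (hst N c j' x) (hst N c j' x')]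

/-- The condition on lists: length `n`, entries in `A`, diameter at most `s`. -/
def GdL (A : Set (V → ℝ)) (n : ℕ) (s : ℝ) (l : List (V → ℝ)) : Prop :=
  l.length = n ∧ (∀ x ∈ l, x ∈ A) ∧ Sm s l

/-- star-shaped sets in the standard simplex -/
structure Star (A : Set (V → ℝ)) (c : V → ℝ) : Prop where
  sub : ∀ x ∈ A, x ∈ stdSimplex ℝ V
  mem : c ∈ A
  star : ∀ x ∈ A, ∀ t : ℝ, 0 ≤ t → t ≤ 1 → (1 - t) • x + t • c ∈ A

theorem Dc_mem {N : ℕ} (hN : 0 < N) {A : Set (V → ℝ)} {c : V → ℝ} (hA : Star A c) {n : ℕ} {s : ℝ}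
    (hs : 0 ≤ s) {y : LC (V → ℝ)} (hy : y ∈ sup (GdL A n s)) :
    Dc N c y ∈ sup (GdL A (n + 1) (s + 1 / N)) := by
  have hN' : (0 : ℝ) < N := by exact_mod_cast hN
  refine sup_ind _ _ ?_ hy
  rintro l ⟨h1, h2, h3⟩
  simp only [Dc, LinearMap.add_apply, LinearMap.sum_apply, LinearMap.comp_apply, mapL_sg, consL_sg,
    prL_sg]
  refine Submodule.add_mem _ (Submodule.sum_mem _ fun j hj => ?_) (sg_mem ?_)
  · rw [Finset.mem_range] at hj
    refine sup_mono ?_ (prl_mem _ _ l)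
    rintro l' ⟨a1, a2⟩
    have a3 : ∀ y ∈ l', ∃ x ∈ l, ∃ i : ℕ, (i = j ∨ i = j + 1) ∧ y = hst N c i x := by
      intro y hy
      obtain ⟨x, hx, h | h⟩ := a2 y hy
      · exact ⟨x, hx, j, Or.inl rfl, h⟩
      · exact ⟨x, hx, j + 1, Or.inr rfl, h⟩
    refine ⟨by omega, ?_, ?_⟩
    · intro y hy
      obtain ⟨x, hx, i, hi, rfl⟩ := a3 y hy
      have hiN : i ≤ N := by omega
      refine hA.star x (h2 x hx) _ (by positivity) ?_
      rw [div_le_one hN']; exact_mod_cast hiN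
    · intro y hy y' hy'
      obtain ⟨x, hx, i, hi, rfl⟩ := a3 y hy
      obtain ⟨x', hx', i', hi', rfl⟩ := a3 y' hy'
      refine (dist_hst hN (by omega) ?_ (dist_std (hA.sub _ (h2 x hx)) (hA.sub _ hA.mem))).trans ?_
      · rcases hi with rfl | rfl <;> rcases hi' with rfl | rfl <;> simp
      · gcongr; exact h3 x hx x' hx'
  · refine ⟨by simp [h1], ?_, ?_⟩
    · intro x hx
      have : x = c := by
        simp only [List.mem_cons, List.mem_map] at hx
        rcases hx with h | ⟨_, _, h⟩
        · exact h
        · exact h.symm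
      rw [this]; exact hA.mem
    · have key : ∀ x ∈ c :: l.map (fun _ => c), x = c := by
        intro x hx
        simp only [List.mem_cons, List.mem_map] at hx
        rcases hx with h | ⟨_, _, h⟩
        · exact h
        · exact h.symm
      intro x hx y hy
      rw [key x hx, key y hy, dist_self]; positivity

end Contraction

end SkelProof



namespace SkelProof

set_option linter.unusedSectionVars false
set_option linter.unusedDecidableInType false
set_option linter.unusedFintypeInType false

section Labels

variable {V : Type*} [Fintype V] [DecidableEq V] [Nonempty V]

theorem exists_label (x : V → ℝ) :
    ∃ v, x ∈ stdSimplex ℝ V → 1 / (Fintype.card V : ℝ) ≤ x v := by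
  by_cases hx : x ∈ stdSimplex ℝ V
  · by_contra! h
    have h1 : ∑ v : V, x v < ∑ v : V, 1 / (Fintype.card V : ℝ) :=
      Finset.sum_lt_sum_of_nonempty Finset.univ_nonempty fun v _ => (h v).2
    rw [hx.2] at h1
    have : (Fintype.card V : ℝ) ≠ 0 := by exact_mod_cast Fintype.card_ne_zero
    simp [this] at h1
  · exact ⟨Classical.arbitrary V, fun h => absurd h hx⟩

noncomputable def lab (x : V → ℝ) : V := (exists_label x).choose

theorem lab_spec {x : V → ℝ} (hx : x ∈ stdSimplex ℝ V) : 1 / (Fintype.card V : ℝ) ≤ x (lab x) :=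
  (exists_label x).choose_spec hx

theorem inv_card_pos : 0 < 1 / (Fintype.card V : ℝ) := by
  have : 0 < (Fintype.card V : ℝ) := by exact_mod_cast Fintype.card_pos
  positivity

/-- the simplex spanned by `σ` -/
def Dsx (σ : Finset V) : Set (V → ℝ) := {x | x ∈ stdSimplex ℝ V ∧ ∀ v, v ∉ σ → x v = 0}

/-- The geometric realization of a simplicial complex -/
def Re (K : Set (Finset V)) : Set (V → ℝ) := {x | ∃ σ ∈ K, x ∈ Dsx σ}

/-- support -/
noncomputable def spt (x : V → ℝ) : Finset V := Finset.univ.filter fun v => x v ≠ 0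

theorem mem_spt {x : V → ℝ} {v : V} : v ∈ spt x ↔ x v ≠ 0 := by simp [spt]

theorem spt_sub {x : V → ℝ} {σ : Finset V} (h : x ∈ Dsx σ) : spt x ⊆ σ := by
  intro v hv
  by_contra h2
  exact mem_spt.mp hv (h.2 v h2)

theorem spt_self {x : V → ℝ} (h : x ∈ stdSimplex ℝ V) : x ∈ Dsx (spt x) :=
  ⟨h, fun v hv => by by_contra h2; exact hv (mem_spt.mpr h2)⟩

theorem Re_spt {K : Set (Finset V)} (hK : DC K) {x : V → ℝ} (h : x ∈ Re K) : spt x ∈ K := by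
  obtain ⟨σ, h1, h2⟩ := h
  exact hK σ h1 _ (spt_sub h2)

theorem Dsx_mono {σ τ : Finset V} (h : σ ⊆ τ) {x : V → ℝ} (hx : x ∈ Dsx σ) : x ∈ Dsx τ :=
  ⟨hx.1, fun v hv => hx.2 v fun h2 => hv (h h2)⟩

theorem Re_std {K : Set (Finset V)} {x : V → ℝ} (h : x ∈ Re K) : x ∈ stdSimplex ℝ V := by
  obtain ⟨σ, h1, h2⟩ := h
  exact h2.1

theorem Re_compact (K : Set (Finset V)) : IsCompact (Re K) := by
  have h1 : Re K = ⋃ σ ∈ K, Dsx σ := by ext x; simp [Re]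
  rw [h1]
  refine (Set.toFinite K).isCompact_biUnion fun σ _ => ?_
  have h2 : Dsx σ = stdSimplex ℝ V ∩ ⋂ v : V, {x : V → ℝ | v ∉ σ → x v = 0} := by
    ext x; simp [Dsx]
  rw [h2]
  refine (isCompact_stdSimplex ℝ V).inter_right (isClosed_iInter fun v => ?_)
  by_cases hv : v ∈ σ
  · simp [hv]
  · simp only [hv, not_false_eq_true, forall_true_left]
    exact isClosed_eq (continuous_apply v) continuous_const

/-- vertices of the simplex -/
noncomputable def ev (v : V) : V → ℝ := Pi.single v 1

theorem ev_mem {v : V} {σ : Finset V} (h : v ∈ σ) : ev v ∈ Dsx σ := by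
  refine ⟨single_mem_stdSimplex ℝ v, ?_⟩
  intro w hw
  have : w ≠ v := by rintro rfl; exact hw h
  simp [ev, this]

theorem Dsx_comb {σ : Finset V} {x y : V → ℝ} (hx : x ∈ Dsx σ) (hy : y ∈ Dsx σ) {t : ℝ}
    (h0 : 0 ≤ t) (h1 : t ≤ 1) : (1 - t) • x + t • y ∈ Dsx σ := by
  refine ⟨convex_stdSimplex ℝ V hx.1 hy.1 (by linarith) h0 (by ring), ?_⟩
  intro v hv
  simp [hx.2 v hv, hy.2 v hv]

theorem Dsx_star {v : V} {σ : Finset V} (h : v ∈ σ) : Star (Dsx σ) (ev v) :=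
  ⟨fun _ hx => hx.1, ev_mem h, fun _ hx _ h0 h1 => Dsx_comb hx (ev_mem h) h0 h1⟩

/-- the chain of labels of a list -/
noncomputable def phl : List (V → ℝ) → Chain V
  | [] => dl ∅
  | x :: l => cone (lab x) (phl l)

noncomputable def phL : LC (V → ℝ) →ₗ[ZMod 2] Chain V := Finsupp.linearCombination (ZMod 2) phl

theorem phL_sg (l : List (V → ℝ)) : phL (sg l) = phl l := by simp [phL]

theorem phL_consL (x : V → ℝ) (y : LC (V → ℝ)) : phL (consL x y) = cone (lab x) (phL y) := by
  refine LC_ext' (phL ∘ₗ consL x) (cone (lab x) ∘ₗ phL) (fun l => ?_) y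
  simp only [LinearMap.comp_apply, consL_sg, phL_sg, phl]

theorem bd_phL (y : LC (V → ℝ)) : bd (phL y) = phL (dL y) := by
  refine LC_ext' (bd ∘ₗ phL) (phL ∘ₗ dL) (fun l => ?_) y
  simp only [LinearMap.comp_apply, phL_sg, dL_sg]
  induction l with
  | nil => simp [phl, bdl, bd_dl_empty]
  | cons x l ih => rw [phl, bdl, map_add, phL_consL, bd_cone, ih, phL_sg]

theorem phl_mem {σ : Finset V} (l : List (V → ℝ)) (h : ∀ x ∈ l, lab x ∈ σ) :
    phl l ∈ Ch {τ | τ ⊆ σ} l.length := by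
  induction l with
  | nil => exact dl_mem (σ := ∅) (by simp)
  | cons x l ih =>
    rw [phl, List.length_cons]
    refine cone_mem (lab x) ?_ (ih fun x hx => h x (by simp [hx]))
    intro τ hτ _
    exact Finset.insert_subset (h x (by simp)) hτ

theorem lab_small {s : ℝ} (hs : s < 1 / (Fintype.card V : ℝ)) {x y : V → ℝ}
    (hy : y ∈ stdSimplex ℝ V) (h : dist x y ≤ s) : lab y ∈ spt x := by
  have h1 := lab_spec hy
  have h2 := (dist_le_pi_dist x y (lab y)).trans h
  rw [Real.dist_eq, abs_le] at h2
  rw [mem_spt]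
  intro h3
  linarith [h2.1]

theorem phl_mem_K {K : Set (Finset V)} (hK : DC K) (h0 : ∅ ∈ K) {s : ℝ}
    (hs : s < 1 / (Fintype.card V : ℝ)) {n : ℕ} {l : List (V → ℝ)} (h : GdL (Re K) n s l) :
    phl l ∈ Ch K n := by
  obtain ⟨h1, h2, h3⟩ := h
  subst h1
  cases l with
  | nil => exact dl_mem h0
  | cons x l =>
    refine Ch_mono ?_ (phl_mem (σ := spt x) (x :: l) ?_)
    · intro τ hτ _
      exact hK _ (Re_spt hK (h2 x (by simp))) _ hτ
    · intro y hy
      exact lab_small hs (Re_std (h2 y hy)) (h3 x (by simp) y hy)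

theorem phL_mem_K {K : Set (Finset V)} (hK : DC K) (h0 : ∅ ∈ K) {s : ℝ}
    (hs : s < 1 / (Fintype.card V : ℝ)) {n : ℕ} {y : LC (V → ℝ)} (h : y ∈ sup (GdL (Re K) n s)) :
    phL y ∈ Ch K n :=
  sup_ind _ _ (fun l hl => by rw [phL_sg]; exact phl_mem_K hK h0 hs hl) h

theorem exists_vtx (σ : Finset V) : ∃ v, σ.Nonempty → v ∈ σ := by
  by_cases h : σ.Nonempty
  · exact ⟨h.choose, fun _ => h.choose_spec⟩
  · exact ⟨Classical.arbitrary V, fun h2 => absurd h2 h⟩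

noncomputable def vtx (σ : Finset V) : V := (exists_vtx σ).choose

theorem vtx_mem {σ : Finset V} (h : σ.Nonempty) : vtx σ ∈ σ := (exists_vtx σ).choose_spec h

theorem chain_sum (z : Chain V) : ∑ σ, z σ • dl σ = z := by
  funext τ
  simp [Finset.sum_apply, dl_apply]

theorem Ch_ind {M : Type*} [AddCommGroup M] [Module (ZMod 2) M] {K : Set (Finset V)} {n : ℕ}
    (T : Chain V →ₗ[ZMod 2] M) (Q : Submodule (ZMod 2) M)
    (h : ∀ σ ∈ K, σ.card = n → T (dl σ) ∈ Q) {z : Chain V} (hz : z ∈ Ch K n) : T z ∈ Q := by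
  rw [← chain_sum z, map_sum]
  refine Submodule.sum_mem _ fun σ _ => ?_
  by_cases h0 : z σ = 0
  · simp [h0]
  · rw [map_smul]
    exact Submodule.smul_mem _ _ (h σ (hz σ h0).1 (hz σ h0).2)

/-- the subdivision operator -/
noncomputable def Sd (N : ℕ) : ℕ → Chain V →ₗ[ZMod 2] LC (V → ℝ)
  | 0 => (LinearMap.proj (∅ : Finset V)).smulRight (sg [])
  | n + 1 => ∑ σ : Finset V, (LinearMap.proj σ).smulRight (Dc N (ev (vtx σ)) (Sd N n (bd (dl σ))))

theorem Sd_zero (N : ℕ) (z : Chain V) : Sd N 0 z = z ∅ • sg [] := by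
  simp [Sd]

theorem Sd_succ (N n : ℕ) (z : Chain V) :
    Sd N (n + 1) z = ∑ σ : Finset V, z σ • Dc N (ev (vtx σ)) (Sd N n (bd (dl σ))) := by
  simp [Sd]

theorem Sd_dl (N n : ℕ) (σ : Finset V) :
    Sd N (n + 1) (dl σ) = Dc N (ev (vtx σ)) (Sd N n (bd (dl σ))) := by
  rw [Sd_succ, Finset.sum_eq_single σ]
  · simp [dl_apply]
  · intro τ _ h; simp [dl_apply, h]
  · simp

theorem dL_Sd_zero (N : ℕ) (z : Chain V) : dL (Sd N 0 z) = 0 := by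
  rw [Sd_zero, map_smul, dL_sg, bdl, smul_zero]

theorem Ch_hom_ext {M : Type*} [AddCommGroup M] [Module (ZMod 2) M] (S T : Chain V →ₗ[ZMod 2] M)
    (h : ∀ σ, S (dl σ) = T (dl σ)) (z : Chain V) : S z = T z := by
  rw [← chain_sum z]
  simp [map_sum, h]

theorem dL_Sd {N : ℕ} (hN : 0 < N) (n : ℕ) : ∀ z : Chain V, dL (Sd N (n + 1) z) = Sd N n (bd z) := by
  induction n with
  | zero =>
    intro z
    refine Ch_hom_ext (dL ∘ₗ Sd N (0 + 1)) (Sd N 0 ∘ₗ bd) (fun σ => ?_) z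
    simp only [LinearMap.comp_apply]
    rw [Sd_dl]
    have := Dc_spec hN (ev (vtx σ)) (Sd N 0 (bd (dl σ)))
    rwa [dL_Sd_zero, map_zero, add_zero] at this
  | succ n ih =>
    intro z
    refine Ch_hom_ext (dL ∘ₗ Sd N (n + 1 + 1)) (Sd N (n + 1) ∘ₗ bd) (fun σ => ?_) z
    simp only [LinearMap.comp_apply]
    rw [Sd_dl]
    have := Dc_spec hN (ev (vtx σ)) (Sd N (n + 1) (bd (dl σ)))
    rwa [ih, bd_bd, map_zero, map_zero, add_zero] at this

theorem dL_Sd_cycle {N : ℕ} (hN : 0 < N) (n : ℕ) {z : Chain V} (hz : bd z = 0) :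
    dL (Sd N n z) = 0 := by
  cases n with
  | zero => exact dL_Sd_zero N z
  | succ n => rw [dL_Sd hN, hz, map_zero]

theorem GdL_mono {A B : Set (V → ℝ)} {n : ℕ} {s t : ℝ} (hAB : ∀ x ∈ A, x ∈ B) (hst : s ≤ t)
    {l : List (V → ℝ)} (h : GdL A n s l) : GdL B n t l :=
  ⟨h.1, fun x hx => hAB x (h.2.1 x hx), fun x hx y hy => (h.2.2 x hx y hy).trans hst⟩

theorem bd_dl_mem {n : ℕ} {σ : Finset V} (h : σ.card = n + 1) : bd (dl σ) ∈ Ch {τ | τ ⊆ σ} n := by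
  refine bd_mem (K := {τ | τ ⊆ σ}) (fun τ hτ ρ hρ => hρ.trans hτ) ?_
  rw [← h]
  exact dl_mem (K := {τ | τ ⊆ σ}) (Finset.Subset.refl σ)

theorem Sd_dl_mem {N : ℕ} (hN : 0 < N) (n : ℕ) : ∀ σ : Finset V, σ.card = n →
    Sd N n (dl σ) ∈ sup (GdL (Dsx σ) n (n * (1 / N))) := by
  induction n with
  | zero =>
    intro σ _
    rw [Sd_zero]
    exact Submodule.smul_mem _ _ (sg_mem ⟨rfl, by simp, fun x hx => by simp at hx⟩)
  | succ n ih =>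
    intro σ hσ
    rw [Sd_dl]
    have hne : σ.Nonempty := by rw [← Finset.card_pos]; omega
    have h1 : Sd N n (bd (dl σ)) ∈ sup (GdL (Dsx σ) n (n * (1 / N))) := by
      refine Ch_ind (Sd N n) _ ?_ (bd_dl_mem hσ)
      intro τ hτ hc
      exact sup_mono (fun l hl => GdL_mono (fun x hx => Dsx_mono hτ hx) le_rfl hl) (ih τ hc)
    have h2 := Dc_mem hN (Dsx_star (vtx_mem hne)) (by positivity) h1
    refine sup_mono (fun l hl => GdL_mono (fun x hx => hx) (le_of_eq ?_) hl) h2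
    push_cast; ring

theorem Sd_mem {N : ℕ} (hN : 0 < N) {n : ℕ} {K : Set (Finset V)} {z : Chain V} (hz : z ∈ Ch K n) :
    Sd N n z ∈ sup (GdL (Re K) n (n * (1 / N))) := by
  refine Ch_ind (Sd N n) _ ?_ hz
  intro σ hσ hc
  exact sup_mono (fun l hl => GdL_mono (B := Re K) (fun x hx => ⟨σ, hσ, hx⟩) le_rfl hl) (Sd_dl_mem hN n σ hc)

theorem bd_dl_ne {σ : Finset V} (h : σ.Nonempty) : bd (dl σ) ≠ 0 := by
  obtain ⟨v, hv⟩ := h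
  intro h
  have h1 := congrFun h (σ.erase v)
  rw [bd_apply, Finset.sum_eq_single v] at h1
  · simp [Finset.insert_erase hv, dl_apply] at h1
  · intro w _ hw
    split_ifs with h2
    · rfl
    · rw [dl_apply, if_neg]
      intro h3
      apply h2
      have : v ∈ insert w (σ.erase v) := by rw [h3]; exact hv
      simp [hw.symm] at this
  · simp

theorem phL_Sd {N : ℕ} (hN : 0 < N) (n : ℕ) (hn : (n : ℝ) * (1 / N) < 1 / (Fintype.card V : ℝ)) :
    ∀ z ∈ Ch (Set.univ : Set (Finset V)) n, phL (Sd N n z) = z := by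
  have hN' : (0 : ℝ) < N := by exact_mod_cast hN
  have hpos : (0 : ℝ) < 1 / N := by positivity
  induction n with
  | zero =>
    intro z hz
    rw [Sd_zero, map_smul, phL_sg, phl]
    funext τ
    rw [Pi.smul_apply, dl_apply]
    by_cases h : τ = ∅
    · simp [h]
    · simp only [if_neg h, smul_zero]
      by_contra h2
      have := (hz τ (Ne.symm h2)).2
      rw [Finset.card_eq_zero] at this
      exact h this
  | succ n ih =>
    have hn' : (n : ℝ) * (1 / N) < 1 / (Fintype.card V : ℝ) := by
      refine lt_of_le_of_lt ?_ hn
      push_cast; nlinarith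
    intro z hz
    have hb : ∀ σ : Finset V, σ.card = n + 1 → phL (Sd N (n + 1) (dl σ)) = dl σ := by
      intro σ hσ
      have hne : σ.Nonempty := by rw [← Finset.card_pos]; omega
      have h1 : Sd N (n + 1) (dl σ) ∈ sup (GdL (Re {τ | τ ⊆ σ}) (n + 1) ((n + 1 : ℕ) * (1 / N))) := by
        refine Sd_mem hN ?_
        rw [← hσ]
        exact dl_mem (K := {τ | τ ⊆ σ}) (Finset.Subset.refl σ)
      have h2 := phL_mem_K (K := {τ | τ ⊆ σ}) (fun τ hτ ρ hρ => hρ.trans hτ) (by simp) hn h1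
      have h3 : phL (Sd N (n + 1) (dl σ)) = phL (Sd N (n + 1) (dl σ)) σ • dl σ := by
        funext τ
        rw [Pi.smul_apply, dl_apply]
        by_cases h : τ = σ
        · simp [h]
        · simp only [if_neg h, smul_zero]
          by_contra h4
          obtain ⟨h5, h6⟩ := h2 τ h4
          exact h (Finset.eq_of_subset_of_card_le h5 (by omega))
      have h4 : bd (phL (Sd N (n + 1) (dl σ))) = bd (dl σ) := by
        rw [bd_phL, dL_Sd hN]
        exact ih hn' _ (Ch_mono (fun _ _ _ => Set.mem_univ _) (bd_dl_mem hσ))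
      by_cases h5 : phL (Sd N (n + 1) (dl σ)) σ = 0
      · rw [h5, zero_smul] at h3
        rw [h3, map_zero] at h4
        exact absurd h4.symm (bd_dl_ne hne)
      · rw [h3, zmod2_ne_zero h5, one_smul]
    have := Ch_ind (phL ∘ₗ Sd N (n + 1) - LinearMap.id) ⊥ (K := Set.univ) (n := n + 1)
      (fun σ _ hσ => by simp [hb σ hσ]) hz
    simpa [sub_eq_zero] using this

/-- the comparison homotopy -/
noncomputable def Hl (N : ℕ) : ℕ → LC (V → ℝ) →ₗ[ZMod 2] LC (V → ℝ)
  | 0 => 0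
  | n + 1 => Finsupp.linearCombination (ZMod 2) fun l =>
      Dc N (ev (lab (l.headD 0))) (sg l + Sd N (n + 1) (phl l) + Hl N n (bdl l))

theorem Hl_sg (N n : ℕ) (l : List (V → ℝ)) : Hl N (n + 1) (sg l) =
    Dc N (ev (lab (l.headD 0))) (sg l + Sd N (n + 1) (phl l) + Hl N n (bdl l)) := by
  simp [Hl]

theorem Sd_ph_zero {N : ℕ} {y : LC (V → ℝ)} (hy : y ∈ sup (fun l => l.length = 0)) :
    y + Sd N 0 (phL y) = 0 := by
  refine sup_eq (LinearMap.id + Sd N 0 ∘ₗ phL) 0 ?_ hy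
  intro l hl
  rw [List.length_eq_zero_iff] at hl
  subst hl
  simp only [LinearMap.add_apply, LinearMap.id_apply, LinearMap.comp_apply, phL_sg, phl, Sd_zero,
    LinearMap.zero_apply]
  rw [dl_apply, if_pos rfl, one_smul, chain_add_self]

theorem bdl_len {n : ℕ} {l : List (V → ℝ)} (h : l.length = n + 1) :
    bdl l ∈ sup (fun l' => l'.length = n) :=
  sup_mono (fun l' hl' => by omega) (bdl_mem l)

theorem Hl_spec {N : ℕ} (hN : 0 < N) (n : ℕ) : ∀ y : LC (V → ℝ), y ∈ sup (fun l => l.length = n + 1) →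
    dL (Hl N (n + 1) y) = y + Sd N (n + 1) (phL y) + Hl N n (dL y) := by
  induction n with
  | zero =>
    intro y hy
    suffices key : ∀ l : List (V → ℝ), l.length = 0 + 1 → (dL ∘ₗ Hl N (0 + 1)) (sg l) =
        (LinearMap.id + Sd N (0 + 1) ∘ₗ phL + Hl N 0 ∘ₗ dL : LC (V → ℝ) →ₗ[ZMod 2] LC (V → ℝ)) (sg l) by
      have h := sup_eq (dL ∘ₗ Hl N (0 + 1)) (LinearMap.id + Sd N (0 + 1) ∘ₗ phL + Hl N 0 ∘ₗ dL) key hy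
      simpa only [LinearMap.add_apply, LinearMap.id_apply, LinearMap.comp_apply] using h
    intro l hl
    simp only [LinearMap.add_apply, LinearMap.id_apply, LinearMap.comp_apply, Hl_sg, phL_sg, dL_sg]
    have h1 := Dc_spec hN (ev (lab (l.headD 0))) (sg l + Sd N (0 + 1) (phl l) + Hl N 0 (bdl l))
    have h2 : dL (sg l + Sd N (0 + 1) (phl l) + Hl N 0 (bdl l)) = 0 := by
      rw [map_add, map_add, dL_sg, dL_Sd hN, Hl, LinearMap.zero_apply, map_zero, add_zero,
        ← phL_sg, bd_phL, dL_sg]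
      exact Sd_ph_zero (bdl_len hl)
    rwa [h2, map_zero, add_zero] at h1
  | succ n ih =>
    intro y hy
    suffices key : ∀ l : List (V → ℝ), l.length = n + 1 + 1 → (dL ∘ₗ Hl N (n + 1 + 1)) (sg l) =
        (LinearMap.id + Sd N (n + 1 + 1) ∘ₗ phL + Hl N (n + 1) ∘ₗ dL :
          LC (V → ℝ) →ₗ[ZMod 2] LC (V → ℝ)) (sg l) by
      have h := sup_eq (dL ∘ₗ Hl N (n + 1 + 1))
        (LinearMap.id + Sd N (n + 1 + 1) ∘ₗ phL + Hl N (n + 1) ∘ₗ dL) key hy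
      simpa only [LinearMap.add_apply, LinearMap.id_apply, LinearMap.comp_apply] using h
    intro l hl
    simp only [LinearMap.add_apply, LinearMap.id_apply, LinearMap.comp_apply, Hl_sg, phL_sg, dL_sg]
    have h1 := Dc_spec hN (ev (lab (l.headD 0)))
      (sg l + Sd N (n + 1 + 1) (phl l) + Hl N (n + 1) (bdl l))
    have h2 : dL (sg l + Sd N (n + 1 + 1) (phl l) + Hl N (n + 1) (bdl l)) = 0 := by
      rw [map_add, map_add, dL_sg, dL_Sd hN, ih _ (bdl_len hl), ← phL_sg, bd_phL, ← dL_sg,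
        dL_dL, map_zero, add_zero, chain_add_self]
    rwa [h2, map_zero, add_zero] at h1

theorem Hl_cycle {N : ℕ} (hN : 0 < N) (n : ℕ) {y : LC (V → ℝ)} (hy : y ∈ sup (fun l => l.length = n))
    (h : dL y = 0) : dL (Hl N n y) = y + Sd N n (phL y) := by
  cases n with
  | zero => rw [Sd_ph_zero hy, Hl, LinearMap.zero_apply, map_zero]
  | succ n => rw [Hl_spec hN n y hy, h, map_zero, add_zero]

/-- the carrier of a list -/
def Yl (l : List (V → ℝ)) : Set (V → ℝ) := {y | ∃ x ∈ l, y ∈ Dsx (spt x)}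

theorem Hl_mem {N : ℕ} (hN : 0 < N) {s : ℝ} (hs0 : 0 ≤ s) (hs : s < 1 / (Fintype.card V : ℝ))
    (hsN : s ≤ 1 / N) (n : ℕ) : ∀ l, GdL (stdSimplex ℝ V) n s l →
    Hl N n (sg l) ∈ sup (GdL (Yl l) (n + 1) ((n + 1) * (1 / N))) := by
  have hN' : (0 : ℝ) < N := by exact_mod_cast hN
  have hpos : (0 : ℝ) < 1 / N := by positivity
  induction n with
  | zero => intro l _; simp [Hl]
  | succ n ih =>
    rintro l ⟨h1, h2, h3⟩
    rw [Hl_sg]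
    cases l with
    | nil => simp at h1
    | cons x0 l =>
    rw [List.headD_cons]
    have hlab : ∀ x ∈ x0 :: l, ∀ y ∈ x0 :: l, lab y ∈ spt x := fun x hx y hy =>
      lab_small hs (h2 y hy) (h3 x hx y hy)
    have hstar : Star (Yl (x0 :: l)) (ev (lab x0)) := by
      refine ⟨?_, ?_, ?_⟩
      · rintro y ⟨x, _, hy⟩; exact hy.1
      · exact ⟨x0, by simp, ev_mem (hlab x0 (by simp) x0 (by simp))⟩
      · rintro y ⟨x, hx, hy⟩ t ht0 ht1
        exact ⟨x, hx, Dsx_comb hy (ev_mem (hlab x hx x0 (by simp))) ht0 ht1⟩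
    have hmain : sg (x0 :: l) + Sd N (n + 1) (phl (x0 :: l)) + Hl N n (bdl (x0 :: l)) ∈
        sup (GdL (Yl (x0 :: l)) (n + 1) ((n + 1) * (1 / N))) := by
      refine Submodule.add_mem _ (Submodule.add_mem _ (sg_mem ⟨h1, ?_, ?_⟩) ?_) ?_
      · intro x hx; exact ⟨x, hx, spt_self (h2 x hx)⟩
      · intro x hx y hy
        refine (h3 x hx y hy).trans (hsN.trans ?_)
        have : (0 : ℝ) ≤ n := by positivity
        nlinarith
      · have a1 := phl_mem (σ := spt x0) (x0 :: l) (fun y hy => hlab x0 (by simp) y hy)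
        rw [h1] at a1
        refine sup_mono (fun l' hl' => GdL_mono ?_ (le_of_eq (by push_cast; ring)) hl') (Sd_mem hN a1)
        rintro y ⟨τ, hτ, hy⟩
        exact ⟨x0, by simp, Dsx_mono hτ hy⟩
      · refine sup_ind (Hl N n) _ ?_ (bdl_mem (x0 :: l))
        rintro l' ⟨b1, b2⟩
        refine sup_mono (fun l'' hl'' => GdL_mono ?_ le_rfl hl'') (ih l' ⟨by omega, ?_, ?_⟩)
        · rintro y ⟨x, hx, hy⟩; exact ⟨x, b2 x hx, hy⟩
        · intro x hx; exact h2 x (b2 x hx)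
        · intro x hx y hy; exact h3 x (b2 x hx) y (b2 y hy)
    have := Dc_mem hN hstar (by positivity) hmain
    refine sup_mono (fun l'' hl'' => GdL_mono (fun x hx => hx) (le_of_eq ?_) hl'') this
    push_cast; ring

theorem Hl_mem_K {K : Set (Finset V)} (hK : DC K) {N : ℕ} (hN : 0 < N) {s : ℝ} (hs0 : 0 ≤ s)
    (hs : s < 1 / (Fintype.card V : ℝ)) (hsN : s ≤ 1 / N) {n : ℕ} {y : LC (V → ℝ)}
    (hy : y ∈ sup (GdL (Re K) n s)) : Hl N n y ∈ sup (GdL (Re K) (n + 1) ((n + 1) * (1 / N))) := by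
  refine sup_ind (Hl N n) _ ?_ hy
  intro l hl
  refine sup_mono (fun l'' hl'' => GdL_mono ?_ le_rfl hl'')
    (Hl_mem hN hs0 hs hsN n l (GdL_mono (fun x hx => Re_std hx) le_rfl hl))
  rintro y ⟨x, hx, h⟩
  exact ⟨spt x, Re_spt hK (hl.2.1 x hx), h⟩

end Labels

end SkelProof



namespace SkelProof

set_option linter.unusedSectionVars false
set_option linter.unusedDecidableInType false
set_option linter.unusedFintypeInType false

section Invariance

variable {V : Type*} [Fintype V] [DecidableEq V] [Nonempty V]
variable {V' : Type*} [Fintype V'] [DecidableEq V'] [Nonempty V']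

theorem exists_fine (c : ℕ) {r : ℝ} (hr : 0 < r) : ∃ N : ℕ, 0 < N ∧ ((c : ℝ) + 1) * (1 / N) < r := by
  obtain ⟨N, hN⟩ := exists_nat_gt (((c : ℝ) + 1) / r)
  have h1 : (0 : ℝ) < ((c : ℝ) + 1) / r := by positivity
  have h2 : (0 : ℝ) < N := h1.trans hN
  refine ⟨N, by exact_mod_cast h2, ?_⟩
  rw [mul_one_div, div_lt_iff₀ h2]
  rw [div_lt_iff₀ hr] at hN
  linarith

theorem transfer {K : Set (Finset V)} {K' : Set (Finset V')} (hK : DC K) (h0 : ∅ ∈ K)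
    (hK' : DC K') (h0' : ∅ ∈ K') (f : (V → ℝ) → (V' → ℝ)) (g : (V' → ℝ) → (V → ℝ))
    (Hm : ℝ × (V → ℝ) → (V → ℝ)) (hf : ContinuousOn f (Re K)) (hfm : ∀ x ∈ Re K, f x ∈ Re K')
    (hg : ContinuousOn g (Re K')) (hgm : ∀ x ∈ Re K', g x ∈ Re K)
    (hH : ContinuousOn Hm (Set.Icc (0 : ℝ) 1 ×ˢ Re K))
    (hHm : ∀ t ∈ Set.Icc (0 : ℝ) 1, ∀ x ∈ Re K, Hm (t, x) ∈ Re K)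
    (hH0 : ∀ x ∈ Re K, Hm (0, x) = g (f x)) (hH1 : ∀ x ∈ Re K, Hm (1, x) = x) (c : ℕ) :
    ∃ F : Chain V →ₗ[ZMod 2] Chain V', ∀ z ∈ Ch K c, bd z = 0 →
      F z ∈ Ch K' c ∧ bd (F z) = 0 ∧
      ((∃ w ∈ Ch K' (c + 1), bd w = F z) → ∃ w ∈ Ch K (c + 1), bd w = z) := by
  have hε : 0 < 1 / (Fintype.card V : ℝ) := inv_card_pos
  have hε' : 0 < 1 / (Fintype.card V' : ℝ) := inv_card_pos
  set ε := 1 / (Fintype.card V : ℝ) with hεdef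
  set ε' := 1 / (Fintype.card V' : ℝ) with hε'def
  obtain ⟨δg, hδg, ug⟩ := Metric.uniformContinuousOn_iff.mp
    ((Re_compact K').uniformContinuousOn_of_continuous hg) (ε / 2) (by linarith)
  obtain ⟨N', hN', hN'2⟩ := exists_fine c (lt_min hδg hε')
  have hN'p : (0 : ℝ) < 1 / N' := by
    have : (0 : ℝ) < N' := by exact_mod_cast hN'
    positivity
  have hc0 : (0 : ℝ) ≤ c := by positivity
  have hs' : (1 : ℝ) / N' < ε' := by
    have := hN'2.trans_le (min_le_right _ _)
    nlinarith
  obtain ⟨δf, hδf, uf⟩ := Metric.uniformContinuousOn_iff.mp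
    ((Re_compact K).uniformContinuousOn_of_continuous hf) (1 / N') hN'p
  obtain ⟨δh, hδh, uh⟩ := Metric.uniformContinuousOn_iff.mp
    ((isCompact_Icc.prod (Re_compact K)).uniformContinuousOn_of_continuous hH) (ε / 2) (by linarith)
  obtain ⟨N, hN, hN2⟩ := exists_fine c (lt_min (lt_min hδf hδh) hε)
  have hNp : (0 : ℝ) < 1 / N := by
    have : (0 : ℝ) < N := by exact_mod_cast hN
    positivity
  have hcN : (c : ℝ) * (1 / N) < min (min δf δh) ε := by nlinarith
  have hcf : (c : ℝ) * (1 / N) < δf := hcN.trans_le ((min_le_left _ _).trans (min_le_left _ _))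
  have hch : (c : ℝ) * (1 / N) < δh := hcN.trans_le ((min_le_left _ _).trans (min_le_right _ _))
  have hcε : (c : ℝ) * (1 / N) < ε := hcN.trans_le (min_le_right _ _)
  obtain ⟨J, hJ, hJ2⟩ := exists_fine 0 hδh
  have hJ3 : 1 / (J : ℝ) < δh := by simpa using hJ2
  have hJp : (0 : ℝ) < J := by exact_mod_cast hJ
  refine ⟨phL ∘ₗ mapL f ∘ₗ Sd N c, ?_⟩
  intro z hz hbz
  simp only [LinearMap.comp_apply]
  have hS := Sd_mem hN hz
  have hSc := dL_Sd_cycle hN c hbz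
  have hφS : phL (Sd N c z) = z :=
    phL_Sd hN c hcε z (Ch_mono (fun _ _ _ => Set.mem_univ _) hz)
  generalize Sd N c z = y at hS hSc hφS
  have hfy : mapL f y ∈ sup (GdL (Re K') c (1 / N')) := by
    refine mapL_mem f ?_ hS
    rintro l ⟨a1, a2, a3⟩
    refine ⟨by simp [a1], ?_, ?_⟩
    · intro x hx
      obtain ⟨u, hu, rfl⟩ := List.mem_map.mp hx
      exact hfm u (a2 u hu)
    · intro x hx x' hx'
      obtain ⟨u, hu, rfl⟩ := List.mem_map.mp hx
      obtain ⟨u', hu', rfl⟩ := List.mem_map.mp hx'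
      exact (uf u (a2 u hu) u' (a2 u' hu') ((a3 u hu u' hu').trans_lt hcf)).le
  have hfyc : dL (mapL f y) = 0 := by rw [← mapL_dL, hSc, map_zero]
  refine ⟨phL_mem_K hK' h0' hs' hfy, by rw [bd_phL, hfyc, map_zero], ?_⟩
  rintro ⟨w, hw, hbw⟩
  set u := Hl N' c (mapL f y) + Sd N' (c + 1) w with hu
  have hum : u ∈ sup (GdL (Re K') (c + 1) ((c + 1) * (1 / N'))) := by
    refine Submodule.add_mem _ (Hl_mem_K hK' hN' hN'p.le hs' le_rfl hfy) ?_
    have := Sd_mem hN' hw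
    push_cast at this
    exact this
  have hbu : dL u = mapL f y := by
    rw [hu, map_add, Hl_cycle hN' c (sup_mono (fun l hl => hl.1) hfy) hfyc, dL_Sd hN', hbw,
      add_assoc, chain_add_self, add_zero]
  have hgu : mapL g u ∈ sup (GdL (Re K) (c + 1) (ε / 2)) := by
    refine mapL_mem g ?_ hum
    rintro l ⟨a1, a2, a3⟩
    refine ⟨by simp [a1], ?_, ?_⟩
    · intro x hx
      obtain ⟨u, hu, rfl⟩ := List.mem_map.mp hx
      exact hgm u (a2 u hu)
    · intro x hx x' hx'
      obtain ⟨u, hu, rfl⟩ := List.mem_map.mp hx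
      obtain ⟨u', hu', rfl⟩ := List.mem_map.mp hx'
      exact (ug u (a2 u hu) u' (a2 u' hu') ((a3 u hu u' hu').trans_lt
        (hN'2.trans_le (min_le_left _ _)))).le
  have hp := prism_sum (fun (j : ℕ) x => Hm ((j : ℝ) / J, x)) J y
  rw [hSc] at hp
  simp only [map_zero, Finset.sum_const_zero, add_zero] at hp
  have e0 : mapL (fun x => Hm (((0 : ℕ) : ℝ) / J, x)) y = mapL g (mapL f y) := by
    rw [mapL_mapL]
    refine sup_eq (mapL _) (mapL _) ?_ hS
    rintro l ⟨a1, a2, a3⟩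
    rw [mapL_sg, mapL_sg]
    congr 1
    refine List.map_congr_left fun x hx => ?_
    rw [← hH0 x (a2 x hx)]; simp
  have e1 : mapL (fun x => Hm ((J : ℝ) / J, x)) y = y := by
    refine sup_eq (mapL _) LinearMap.id ?_ hS
    rintro l ⟨a1, a2, a3⟩
    rw [mapL_sg, LinearMap.id_apply]
    congr 1
    conv_rhs => rw [← List.map_id l]
    refine List.map_congr_left fun x hx => ?_
    rw [div_self hJp.ne', hH1 x (a2 x hx), id]
  rw [e0, e1] at hp
  set Q := ∑ j ∈ Finset.range J, prL (fun x => Hm ((j : ℝ) / J, x))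
    (fun x => Hm (((j + 1 : ℕ) : ℝ) / J, x)) y with hQ
  have hQm : Q ∈ sup (GdL (Re K) (c + 1) (ε / 2)) := by
    refine Submodule.sum_mem _ fun j hj => ?_
    rw [Finset.mem_range] at hj
    refine sup_ind (prL _ _) _ ?_ hS
    rintro l ⟨a1, a2, a3⟩
    rw [prL_sg]
    refine sup_mono ?_ (prl_mem _ _ l)
    rintro l' ⟨b1, b2⟩
    have b3 : ∀ y ∈ l', ∃ x ∈ l, ∃ i : ℕ, (i = j ∨ i = j + 1) ∧ y = Hm ((i : ℝ) / J, x) := by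
      intro y hy
      obtain ⟨x, hx, h | h⟩ := b2 y hy
      · exact ⟨x, hx, j, Or.inl rfl, h⟩
      · exact ⟨x, hx, j + 1, Or.inr rfl, h⟩
    have b4 : ∀ i : ℕ, (i = j ∨ i = j + 1) → (i : ℝ) / J ∈ Set.Icc (0 : ℝ) 1 := by
      intro i hi
      refine ⟨by positivity, ?_⟩
      rw [div_le_one hJp]
      have : i ≤ J := by omega
      exact_mod_cast this
    refine ⟨by omega, ?_, ?_⟩
    · intro y hy
      obtain ⟨x, hx, i, hi, rfl⟩ := b3 y hy
      exact hHm _ (b4 i hi) x (a2 x hx)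
    · intro y hy y' hy'
      obtain ⟨x, hx, i, hi, rfl⟩ := b3 y hy
      obtain ⟨x', hx', i', hi', rfl⟩ := b3 y' hy'
      refine (uh _ ⟨b4 i hi, a2 x hx⟩ _ ⟨b4 i' hi', a2 x' hx'⟩ ?_).le
      rw [Prod.dist_eq]
      refine max_lt ?_ ((a3 x hx x' hx').trans_lt hch)
      refine lt_of_le_of_lt ?_ hJ3
      simp only
      rw [Real.dist_eq, ← sub_div, abs_div, abs_of_pos hJp]
      gcongr
      rcases hi with rfl | rfl <;> rcases hi' with rfl | rfl <;> simp
  refine ⟨phL (mapL g u) + phL Q, Submodule.add_mem _ (phL_mem_K hK h0 (by linarith) hgu)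
    (phL_mem_K hK h0 (by linarith) hQm), ?_⟩
  rw [map_add, bd_phL, bd_phL, ← mapL_dL, hbu, hp, map_add, hφS, ← add_assoc, chain_add_self, zero_add]

/-- homotopy equivalence of realizations -/
structure HE (K : Set (Finset V)) (K' : Set (Finset V')) : Prop where
  dc : DC K
  em : ∅ ∈ K
  dc' : DC K'
  em' : ∅ ∈ K'
  ex : ∃ (f : (V → ℝ) → (V' → ℝ)) (g : (V' → ℝ) → (V → ℝ)) (Hm : ℝ × (V → ℝ) → (V → ℝ))
    (Hm' : ℝ × (V' → ℝ) → (V' → ℝ)),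
    ContinuousOn f (Re K) ∧ (∀ x ∈ Re K, f x ∈ Re K') ∧
    ContinuousOn g (Re K') ∧ (∀ x ∈ Re K', g x ∈ Re K) ∧
    ContinuousOn Hm (Set.Icc (0 : ℝ) 1 ×ˢ Re K) ∧
    (∀ t ∈ Set.Icc (0 : ℝ) 1, ∀ x ∈ Re K, Hm (t, x) ∈ Re K) ∧
    (∀ x ∈ Re K, Hm (0, x) = g (f x)) ∧ (∀ x ∈ Re K, Hm (1, x) = x) ∧
    ContinuousOn Hm' (Set.Icc (0 : ℝ) 1 ×ˢ Re K') ∧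
    (∀ t ∈ Set.Icc (0 : ℝ) 1, ∀ x ∈ Re K', Hm' (t, x) ∈ Re K') ∧
    (∀ x ∈ Re K', Hm' (0, x) = f (g x)) ∧ (∀ x ∈ Re K', Hm' (1, x) = x)

theorem HE.maps {K : Set (Finset V)} {K' : Set (Finset V')} (h : HE K K') (c : ℕ) :
    (∃ F : Chain V →ₗ[ZMod 2] Chain V', ∀ z ∈ Ch K c, bd z = 0 →
      F z ∈ Ch K' c ∧ bd (F z) = 0 ∧
      ((∃ w ∈ Ch K' (c + 1), bd w = F z) → ∃ w ∈ Ch K (c + 1), bd w = z)) ∧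
    (∃ F : Chain V' →ₗ[ZMod 2] Chain V, ∀ z ∈ Ch K' c, bd z = 0 →
      F z ∈ Ch K c ∧ bd (F z) = 0 ∧
      ((∃ w ∈ Ch K (c + 1), bd w = F z) → ∃ w ∈ Ch K' (c + 1), bd w = z)) := by
  obtain ⟨f, g, Hm, Hm', h1, h2, h3, h4, h5, h6, h7, h8, h9, h10, h11, h12⟩ := h.ex
  exact ⟨transfer h.dc h.em h.dc' h.em' f g Hm h1 h2 h3 h4 h5 h6 h7 h8 c,
    transfer h.dc' h.em' h.dc h.em g f Hm' h3 h4 h1 h2 h9 h10 h11 h12 c⟩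

theorem HE.triv {K : Set (Finset V)} {K' : Set (Finset V')} (h : HE K K') {c : ℕ}
    (ht : Triv c K') : Triv c K := by
  obtain ⟨⟨F, hF⟩, -⟩ := h.maps c
  intro z hz hbz
  obtain ⟨a1, a2, a3⟩ := hF z hz hbz
  exact a3 (ht _ a1 a2)

theorem HE.sph {K : Set (Finset V)} {K' : Set (Finset V')} (h : HE K K') {c : ℕ}
    (hs : Sph c K') : Sph c K := by
  obtain ⟨⟨F, hF⟩, ⟨G, hG⟩⟩ := h.maps c
  refine ⟨?_, ?_⟩
  · obtain ⟨z, hz, hbz, hnz⟩ := hs.1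
    obtain ⟨a1, a2, a3⟩ := hG z hz hbz
    exact ⟨G z, a1, a2, fun h => hnz (a3 h)⟩
  · intro z hz hbz z' hz' hbz' hn hn'
    obtain ⟨a1, a2, a3⟩ := hF z hz hbz
    obtain ⟨b1, b2, b3⟩ := hF z' hz' hbz'
    obtain ⟨w, hw, hbw⟩ := hs.2 _ a1 a2 _ b1 b2 (fun h => hn (a3 h)) (fun h => hn' (b3 h))
    refine (hF (z + z') (Submodule.add_mem _ hz hz') (by rw [map_add, hbz, hbz', add_zero])).2.2 ?_
    exact ⟨w, hw, by rw [hbw, map_add]⟩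

end Invariance

end SkelProof



namespace SkelProof

set_option linter.unusedSectionVars false
set_option linter.unusedDecidableInType false
set_option linter.unusedFintypeInType false

section Cones

variable {a b : ℕ} [Nonempty (Fin a)] [Nonempty (Fin b)]

noncomputable def lft (u : Fin a → ℝ) : Fin a × Bool → ℝ :=
  fun p => if p.2 = true then max (u p.1) 0 else max (- u p.1) 0

noncomputable def n1 (u : Fin a → ℝ) : ℝ := ∑ i, |u i|

noncomputable def nrm (u : Fin a → ℝ) : Fin a × Bool → ℝ := (n1 u)⁻¹ • lft u

def jj (y : Fin a × Bool → ℝ) : Fin a → ℝ := fun i => y (i, true) - y (i, false)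

noncomputable def sp (u : Fin a → ℝ) : Finset (Fin a × Bool) := spt (lft u)

/-- the cone on a complex -/
def Cn (D : Set (Finset (Fin a × Bool))) : Set (Fin a → ℝ) := {u | sp u ∈ D}

def AF (D : Set (Finset (Fin a × Bool))) : Prop := ∀ T ∈ D, ∀ i, ¬ ((i, true) ∈ T ∧ (i, false) ∈ T)

theorem lft_nonneg (u : Fin a → ℝ) (p : Fin a × Bool) : 0 ≤ lft u p := by
  unfold lft; split_ifs <;> exact le_max_right _ _

theorem lft_sum (u : Fin a → ℝ) : ∑ p, lft u p = n1 u := by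
  rw [Fintype.sum_prod_type, n1]
  refine Finset.sum_congr rfl fun i _ => ?_
  simp only [Fintype.sum_bool, lft]
  rcases le_total 0 (u i) with h | h
  · simp [h, abs_of_nonneg h]
  · simp [h, abs_of_nonpos h]

theorem lft_smul (u : Fin a → ℝ) {c : ℝ} (hc : 0 ≤ c) : lft (c • u) = c • lft u := by
  funext p
  simp only [lft, Pi.smul_apply, smul_eq_mul]
  split_ifs
  · rw [mul_max_of_nonneg _ _ hc, mul_zero]
  · rw [mul_max_of_nonneg _ _ hc, mul_zero, mul_neg]

theorem n1_smul (u : Fin a → ℝ) {c : ℝ} (hc : 0 ≤ c) : n1 (c • u) = c * n1 u := by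
  rw [← lft_sum, lft_smul u hc, ← lft_sum, Finset.mul_sum]; rfl

theorem n1_nonneg (u : Fin a → ℝ) : 0 ≤ n1 u := Finset.sum_nonneg fun _ _ => abs_nonneg _

theorem n1_pos {u : Fin a → ℝ} (h : u ≠ 0) : 0 < n1 u := by
  obtain ⟨i, hi⟩ := Function.ne_iff.mp h
  exact Finset.sum_pos' (fun _ _ => abs_nonneg _) ⟨i, Finset.mem_univ i, abs_pos.mpr hi⟩

theorem norm_le_n1 (u : Fin a → ℝ) : ‖u‖ ≤ n1 u := by
  rw [pi_norm_le_iff_of_nonneg (n1_nonneg u)]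
  intro i
  exact Finset.single_le_sum (f := fun i => |u i|) (fun _ _ => abs_nonneg _) (Finset.mem_univ i)

theorem sp_smul (u : Fin a → ℝ) {c : ℝ} (hc : 0 < c) : sp (c • u) = sp u := by
  ext p
  simp [sp, mem_spt, lft_smul u hc.le, hc.ne']

theorem nrm_smul (u : Fin a → ℝ) {c : ℝ} (hc : 0 < c) : nrm (c • u) = nrm u := by
  rw [nrm, nrm, n1_smul u hc.le, lft_smul u hc.le, smul_smul]
  congr 1
  field_simp

theorem jj_lft (u : Fin a → ℝ) : jj (lft u) = u := by
  funext i
  simp only [jj, lft, if_true, Bool.false_eq_true, if_false]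
  rcases le_total 0 (u i) with h | h
  · simp [h]
  · simp [h]

theorem jj_nrm (u : Fin a → ℝ) : jj (nrm u) = (n1 u)⁻¹ • u := by
  funext i
  have h := congrFun (jj_lft u) i
  simp only [jj] at h
  simp only [jj, nrm, Pi.smul_apply, smul_eq_mul]
  rw [← mul_sub, h]

theorem nrm_mem {D : Set (Finset (Fin a × Bool))} {u : Fin a → ℝ} (h : u ∈ Cn D) (hu : u ≠ 0) :
    nrm u ∈ Re D := by
  have hp := n1_pos hu
  refine ⟨sp u, h, ⟨?_, ?_⟩, ?_⟩
  · intro p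
    exact mul_nonneg (inv_nonneg.mpr hp.le) (lft_nonneg u p)
  · simp only [nrm, Pi.smul_apply, smul_eq_mul]
    rw [← Finset.mul_sum, lft_sum, inv_mul_cancel₀ hp.ne']
  · intro p hp
    have : lft u p = 0 := by
      by_contra h2
      exact hp (mem_spt.mpr h2)
    simp [nrm, this]

theorem lft_jj {D : Set (Finset (Fin a × Bool))} (hA : AF D) {y : Fin a × Bool → ℝ} (hy : y ∈ Re D) :
    lft (jj y) = y := by
  obtain ⟨σ, hσ, h1, h2⟩ := hy
  funext ⟨i, e⟩
  have ht := h1.1 (i, true)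
  have hf := h1.1 (i, false)
  have h3 : y (i, true) = 0 ∨ y (i, false) = 0 := by
    by_contra! h
    refine hA σ hσ i ⟨?_, ?_⟩
    · by_contra h4; exact h.1 (h2 _ h4)
    · by_contra h4; exact h.2 (h2 _ h4)
  cases e
  · simp only [lft, jj, Bool.false_eq_true, if_false]
    rcases h3 with h | h
    · rw [h]; simpa using hf
    · rw [h]; simpa using ht
  · simp only [lft, jj, if_true]
    rcases h3 with h | h
    · rw [h]; simpa using hf
    · rw [h]; simpa using ht

theorem n1_jj {D : Set (Finset (Fin a × Bool))} (hA : AF D) {y : Fin a × Bool → ℝ} (hy : y ∈ Re D) :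
    n1 (jj y) = 1 := by
  rw [← lft_sum, lft_jj hA hy]
  exact (Re_std hy).2

theorem jj_mem {D : Set (Finset (Fin a × Bool))} (hD : DC D) (hA : AF D) {y : Fin a × Bool → ℝ}
    (hy : y ∈ Re D) : jj y ∈ Cn D := by
  show spt (lft (jj y)) ∈ D
  rw [lft_jj hA hy]
  obtain ⟨σ, hσ, h⟩ := hy
  refine hD σ hσ _ ?_
  intro v hv
  by_contra h2
  rw [mem_spt] at hv
  exact hv (h.2 v h2)

theorem nrm_jj {D : Set (Finset (Fin a × Bool))} (hA : AF D) {y : Fin a × Bool → ℝ} (hy : y ∈ Re D) :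
    nrm (jj y) = y := by
  rw [nrm, n1_jj hA hy, lft_jj hA hy]; simp

theorem jj_ne {D : Set (Finset (Fin a × Bool))} (hA : AF D) {y : Fin a × Bool → ℝ} (hy : y ∈ Re D) :
    jj y ≠ 0 := by
  intro h
  have := n1_jj hA hy
  rw [h] at this
  simp [n1] at this

theorem Cn_smul {D : Set (Finset (Fin a × Bool))} {u : Fin a → ℝ} (h : u ∈ Cn D) {c : ℝ}
    (hc : 0 < c) : c • u ∈ Cn D := by
  show sp _ ∈ D
  rw [sp_smul u hc]; exact h

theorem sp_zero : sp (0 : Fin a → ℝ) = ∅ := by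
  ext p
  simp [sp, mem_spt, lft]

theorem cont_lft : Continuous (lft : (Fin a → ℝ) → _) := by
  refine continuous_pi fun p => ?_
  unfold lft
  split_ifs <;> fun_prop

theorem cont_n1 : Continuous (n1 : (Fin a → ℝ) → ℝ) := by
  unfold n1; fun_prop

theorem cont_nrm : ContinuousOn (nrm : (Fin a → ℝ) → _) {u | u ≠ 0} := by
  unfold nrm
  exact (cont_n1.continuousOn.inv₀ fun u hu => (n1_pos hu).ne').smul cont_lft.continuousOn

theorem cont_jj : Continuous (jj : (Fin a × Bool → ℝ) → _) := by
  unfold jj; fun_prop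

variable {D₁ : Set (Finset (Fin a × Bool))} {D₂ : Set (Finset (Fin b × Bool))}

/-- One half of a homotopy equivalence between realizations from a local map of cones. -/
theorem half (hD₁ : DC D₁) (hA₁ : AF D₁) (hA₂ : AF D₂)
    {r r1 s s1 : ℝ} (hr : 0 < r) (hrr : r < r1) (hs : 0 < s) (hss : s < s1)
    (h : (Fin a → ℝ) → (Fin b → ℝ)) (q : (Fin b → ℝ) → (Fin a → ℝ))
    (hc : ContinuousOn h {u | u ∈ Cn D₁ ∧ n1 u < r1}) (qc : ContinuousOn q {w | w ∈ Cn D₂ ∧ n1 w < s1})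
    (hh : ∀ y ∈ Re D₁, h (r • jj y) ∈ Cn D₂ ∧ h (r • jj y) ≠ 0 ∧ n1 (h (r • jj y)) < s1)
    (hq : ∀ w ∈ Cn D₂, n1 w < s1 → w ≠ 0 → q w ∈ Cn D₁ ∧ q w ≠ 0)
    (hqh : ∀ y ∈ Re D₁, q (h (r • jj y)) = r • jj y) :
    ContinuousOn (fun y => nrm (h (r • jj y))) (Re D₁) ∧
    (∀ y ∈ Re D₁, nrm (h (r • jj y)) ∈ Re D₂) ∧
    ∃ Hm : ℝ × (Fin a × Bool → ℝ) → (Fin a × Bool → ℝ),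
      ContinuousOn Hm (Set.Icc (0 : ℝ) 1 ×ˢ Re D₁) ∧
      (∀ t ∈ Set.Icc (0 : ℝ) 1, ∀ x ∈ Re D₁, Hm (t, x) ∈ Re D₁) ∧
      (∀ y ∈ Re D₁, Hm (0, y) = nrm (q (s • jj (nrm (h (r • jj y)))))) ∧
      (∀ y ∈ Re D₁, Hm (1, y) = y) := by
  have hin : ∀ y ∈ Re D₁, r • jj y ∈ {u | u ∈ Cn D₁ ∧ n1 u < r1} := fun y hy =>
    ⟨Cn_smul (jj_mem hD₁ hA₁ hy) hr, by rw [n1_smul _ hr.le, n1_jj hA₁ hy]; linarith⟩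
  have hc1 : ContinuousOn (fun y => h (r • jj y)) (Re D₁) :=
    hc.comp (cont_jj.const_smul r).continuousOn hin
  refine ⟨cont_nrm.comp hc1 fun y hy => (hh y hy).2.1,
    fun y hy => nrm_mem (hh y hy).1 (hh y hy).2.1, ?_⟩
  have hco : ∀ t ∈ Set.Icc (0 : ℝ) 1, ∀ y ∈ Re D₁,
      0 < (1 - t) * (s / n1 (h (r • jj y))) + t ∧
      n1 (((1 - t) * (s / n1 (h (r • jj y))) + t) • h (r • jj y)) < s1 := by
    rintro t ⟨h0, h1⟩ y hy
    obtain ⟨a1, a2, a3⟩ := hh y hy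
    have hp := n1_pos a2
    have hsp : 0 < s / n1 (h (r • jj y)) := by positivity
    have hpos : 0 < (1 - t) * (s / n1 (h (r • jj y))) + t := by
      rcases h0.eq_or_lt with rfl | h0
      · simpa using hsp
      · have : 0 ≤ (1 - t) * (s / n1 (h (r • jj y))) := mul_nonneg (by linarith) hsp.le
        linarith
    refine ⟨hpos, ?_⟩
    rw [n1_smul _ hpos.le]
    have : ((1 - t) * (s / n1 (h (r • jj y))) + t) * n1 (h (r • jj y)) =
      (1 - t) * s + t * n1 (h (r • jj y)) := by field_simp
    rw [this]
    rcases h1.eq_or_lt with rfl | h1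
    · simpa using a3
    · nlinarith
  have hcm : ∀ t ∈ Set.Icc (0 : ℝ) 1, ∀ y ∈ Re D₁,
      ((1 - t) * (s / n1 (h (r • jj y))) + t) • h (r • jj y) ∈ {w | w ∈ Cn D₂ ∧ n1 w < s1} :=
    fun t ht y hy => ⟨Cn_smul (hh y hy).1 (hco t ht y hy).1, (hco t ht y hy).2⟩
  have hcq : ∀ t ∈ Set.Icc (0 : ℝ) 1, ∀ y ∈ Re D₁,
      q (((1 - t) * (s / n1 (h (r • jj y))) + t) • h (r • jj y)) ∈ Cn D₁ ∧
      q (((1 - t) * (s / n1 (h (r • jj y))) + t) • h (r • jj y)) ≠ 0 :=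
    fun t ht y hy => hq _ (hcm t ht y hy).1 (hcm t ht y hy).2
      (smul_ne_zero (hco t ht y hy).1.ne' (hh y hy).2.1)
  refine ⟨fun p => nrm (q (((1 - p.1) * (s / n1 (h (r • jj p.2))) + p.1) • h (r • jj p.2))),
    ?_, ?_, ?_, ?_⟩
  · refine cont_nrm.comp (t := {u | u ≠ 0}) (qc.comp ?_ ?_) ?_
    · have h2 : ContinuousOn (fun p : ℝ × (Fin a × Bool → ℝ) => h (r • jj p.2))
          (Set.Icc (0 : ℝ) 1 ×ˢ Re D₁) := hc1.comp continuous_snd.continuousOn fun p hp => hp.2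
      have h3 : ContinuousOn (fun p : ℝ × (Fin a × Bool → ℝ) => n1 (h (r • jj p.2)))
          (Set.Icc (0 : ℝ) 1 ×ˢ Re D₁) := cont_n1.comp_continuousOn h2
      have h5 : ContinuousOn (fun p : ℝ × (Fin a × Bool → ℝ) => s / n1 (h (r • jj p.2)))
          (Set.Icc (0 : ℝ) 1 ×ˢ Re D₁) :=
        ContinuousOn.div continuousOn_const h3 fun p hp => (n1_pos (hh p.2 hp.2).2.1).ne'
      have h6 : ContinuousOn (fun p : ℝ × (Fin a × Bool → ℝ) => 1 - p.1)
          (Set.Icc (0 : ℝ) 1 ×ˢ Re D₁) := by fun_prop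
      have h7 : ContinuousOn (fun p : ℝ × (Fin a × Bool → ℝ) => p.1)
          (Set.Icc (0 : ℝ) 1 ×ˢ Re D₁) := by fun_prop
      exact ((h6.mul h5).add h7).smul h2
    · rintro ⟨t, y⟩ ⟨ht, hy⟩; exact hcm t ht y hy
    · rintro ⟨t, y⟩ ⟨ht, hy⟩; exact (hcq t ht y hy).2
  · intro t ht y hy
    exact nrm_mem (hcq t ht y hy).1 (hcq t ht y hy).2
  · intro y hy
    simp only [sub_zero, one_mul, add_zero]
    rw [jj_nrm, smul_smul, div_eq_mul_inv]
  · intro y hy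
    simp only [sub_self, zero_mul, zero_add, one_smul]
    rw [hqh y hy, nrm_smul _ hr, nrm_jj hA₁ hy]

theorem HE_of_local (hD₁ : DC D₁) (hA₁ : AF D₁) (hE₁ : ∅ ∈ D₁)
    (hD₂ : DC D₂) (hA₂ : AF D₂) (hE₂ : ∅ ∈ D₂) {r1 s1 : ℝ} (hr1 : 0 < r1) (hs1 : 0 < s1)
    (h : (Fin a → ℝ) → (Fin b → ℝ)) (q : (Fin b → ℝ) → (Fin a → ℝ))
    (hc : ContinuousOn h {u | u ∈ Cn D₁ ∧ n1 u < r1}) (qc : ContinuousOn q {w | w ∈ Cn D₂ ∧ n1 w < s1})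
    (h00 : h 0 = 0)
    (hh : ∀ u ∈ Cn D₁, n1 u < r1 → u ≠ 0 → h u ∈ Cn D₂ ∧ h u ≠ 0)
    (hq : ∀ w ∈ Cn D₂, n1 w < s1 → w ≠ 0 → q w ∈ Cn D₁ ∧ n1 (q w) < r1 ∧ q w ≠ 0)
    (hqh : ∀ u ∈ Cn D₁, n1 u < r1 → n1 (h u) < s1 → q (h u) = u)
    (hhq : ∀ w ∈ Cn D₂, n1 w < s1 → h (q w) = w) : HE D₁ D₂ := by
  have h0m : (0 : Fin a → ℝ) ∈ {u | u ∈ Cn D₁ ∧ n1 u < r1} :=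
    ⟨by show sp 0 ∈ D₁; rw [sp_zero]; exact hE₁, by simpa [n1] using hr1⟩
  obtain ⟨r, hr, hrr, hrs⟩ : ∃ r, 0 < r ∧ r < r1 ∧ ∀ u ∈ Cn D₁, n1 u ≤ r → n1 (h u) < s1 := by
    have h1 : ContinuousWithinAt (fun u => n1 (h u)) {u | u ∈ Cn D₁ ∧ n1 u < r1} 0 :=
      cont_n1.continuousAt.comp_continuousWithinAt (hc 0 h0m)
    have h2 : n1 (h 0) < s1 := by rw [h00]; simpa [n1] using hs1
    have h3 := h1.eventually_lt_const h2
    rw [eventually_nhdsWithin_iff] at h3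
    obtain ⟨ε, hε, h4⟩ := Metric.eventually_nhds_iff.mp h3
    refine ⟨min (r1 / 2) (ε / 2), by positivity, (min_le_left _ _).trans_lt (by linarith), ?_⟩
    intro u hu hn
    refine h4 ?_ ⟨hu, hn.trans_lt ((min_le_left _ _).trans_lt (by linarith))⟩
    rw [dist_zero_right]
    exact (norm_le_n1 u).trans_lt (hn.trans_lt ((min_le_right _ _).trans_lt (by linarith)))
  have hs : 0 < s1 / 2 := by linarith
  have hss : s1 / 2 < s1 := by linarith
  have hin₁ : ∀ y ∈ Re D₁, r • jj y ∈ Cn D₁ ∧ n1 (r • jj y) = r ∧ r • jj y ≠ 0 := fun y hy =>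
    ⟨Cn_smul (jj_mem hD₁ hA₁ hy) hr, by rw [n1_smul _ hr.le, n1_jj hA₁ hy, mul_one],
      smul_ne_zero hr.ne' (jj_ne hA₁ hy)⟩
  have hin₂ : ∀ y ∈ Re D₂, (s1 / 2) • jj y ∈ Cn D₂ ∧ n1 ((s1 / 2) • jj y) = s1 / 2 ∧
      (s1 / 2) • jj y ≠ 0 := fun y hy =>
    ⟨Cn_smul (jj_mem hD₂ hA₂ hy) hs, by rw [n1_smul _ hs.le, n1_jj hA₂ hy, mul_one],
      smul_ne_zero hs.ne' (jj_ne hA₂ hy)⟩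
  obtain ⟨a1, a2, Hm, a3, a4, a5, a6⟩ := half hD₁ hA₁ hA₂ hr hrr hs hss h q hc qc
    (fun y hy => by
      obtain ⟨b1, b2, b3⟩ := hin₁ y hy
      obtain ⟨c1, c2⟩ := hh _ b1 (by linarith) b3
      exact ⟨c1, c2, hrs _ b1 b2.le⟩)
    (fun w hw hn hw0 => ⟨(hq w hw hn hw0).1, (hq w hw hn hw0).2.2⟩)
    (fun y hy => by
      obtain ⟨b1, b2, b3⟩ := hin₁ y hy
      exact hqh _ b1 (by linarith) (hrs _ b1 b2.le))
  obtain ⟨b1, b2, Hm', b3, b4, b5, b6⟩ := half hD₂ hA₂ hA₁ hs hss hr hrr q h qc hc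
    (fun y hy => by
      obtain ⟨b1, b2, b3⟩ := hin₂ y hy
      obtain ⟨c1, c2, c3⟩ := hq _ b1 (by linarith) b3
      exact ⟨c1, c3, c2⟩)
    (fun w hw hn hw0 => hh w hw hn hw0)
    (fun y hy => by
      obtain ⟨b1, b2, b3⟩ := hin₂ y hy
      exact hhq _ b1 (by linarith))
  exact ⟨hD₁, hE₁, hD₂, hE₂, _, _, Hm, Hm', a1, a2, b1, b2, a3, a4, a5, a6, b3, b4, b5, b6⟩

end Cones

section Charts

variable {a m : ℕ} [Nonempty (Fin a)] [Nonempty (Fin m)]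

theorem chart_local (X : Set (Fin a → ℝ)) [ChartedSpace (EuclideanSpace ℝ (Fin m)) X]
    (x0 : Fin a → ℝ) (hx0 : x0 ∈ X) {ρ : ℝ} (hρ : 0 < ρ) :
    ∃ (r1 s1 : ℝ) (h : (Fin a → ℝ) → (Fin m → ℝ)) (q : (Fin m → ℝ) → (Fin a → ℝ)),
      0 < r1 ∧ r1 ≤ ρ ∧ 0 < s1 ∧ ContinuousOn h {u | x0 + u ∈ X ∧ n1 u < r1} ∧
      ContinuousOn q {w | n1 w < s1} ∧ h 0 = 0 ∧ q 0 = 0 ∧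
      (∀ w, n1 w < s1 → x0 + q w ∈ X ∧ n1 (q w) < r1) ∧
      (∀ u, x0 + u ∈ X → n1 u < r1 → n1 (h u) < s1 → q (h u) = u) ∧
      (∀ w, n1 w < s1 → h (q w) = w) := by
  classical
  set p : X := ⟨x0, hx0⟩ with hp
  set φ := chartAt (EuclideanSpace ℝ (Fin m)) p with hφ
  have hps : p ∈ φ.source := mem_chart_source _ p
  obtain ⟨ε, hε, hball⟩ := Metric.isOpen_iff.mp φ.open_source p hps
  set r1 := min ε ρ with hr1
  have hr1p : 0 < r1 := lt_min hε hρ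
  set e : (Fin m → ℝ) → EuclideanSpace ℝ (Fin m) := fun w => φ p + WithLp.toLp 2 w with he
  have hec : Continuous e := by
    refine continuous_const.add ?_
    exact PiLp.continuous_toLp 2 _
  have he0 : e 0 = φ p := by simp [he]
  have hsrc : ∀ u (hu : x0 + u ∈ X), n1 u < r1 → (⟨x0 + u, hu⟩ : X) ∈ φ.source := by
    intro u hu hn
    apply hball
    rw [Metric.mem_ball, Subtype.dist_eq, hp, dist_eq_norm]
    simp only [add_sub_cancel_left]
    exact (norm_le_n1 u).trans_lt (hn.trans_le (min_le_left _ _))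
  set q : (Fin m → ℝ) → (Fin a → ℝ) := fun w => (φ.symm (e w) : Fin a → ℝ) - x0 with hq
  have hq0 : q 0 = 0 := by
    simp only [hq]
    rw [he0, φ.left_inv hps]
    exact sub_self x0
  have hsymm : ContinuousOn φ.symm φ.target := φ.continuousOn_symm
  have htm : φ p ∈ φ.target := φ.map_source hps
  have hqc : ContinuousOn q (e ⁻¹' φ.target) := by
    refine ContinuousOn.sub ?_ continuousOn_const
    exact continuous_subtype_val.comp_continuousOn
      (hsymm.comp hec.continuousOn fun w hw => hw)
  have hopen : IsOpen (e ⁻¹' φ.target) := φ.open_target.preimage hec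
  have h0m : (0 : Fin m → ℝ) ∈ e ⁻¹' φ.target := by rw [Set.mem_preimage, he0]; exact htm
  have hqa : ContinuousAt (fun w => n1 (q w)) 0 :=
    cont_n1.continuousAt.comp (hqc.continuousAt (hopen.mem_nhds h0m))
  have hev : ∀ᶠ w in nhds (0 : Fin m → ℝ), w ∈ e ⁻¹' φ.target ∧ n1 (q w) < r1 := by
    have h1 : n1 (q 0) < r1 := by rw [hq0]; simpa [n1] using hr1p
    filter_upwards [hopen.mem_nhds h0m, hqa.eventually_lt_const h1] with w h2 h3 using ⟨h2, h3⟩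
  obtain ⟨s1, hs1, hs⟩ := Metric.eventually_nhds_iff.mp hev
  have hs' : ∀ w, n1 w < s1 → w ∈ e ⁻¹' φ.target ∧ n1 (q w) < r1 := fun w hw =>
    hs (by rw [dist_zero_right]; exact (norm_le_n1 w).trans_lt hw)
  set h : (Fin a → ℝ) → (Fin m → ℝ) := fun u =>
    if hu : x0 + u ∈ X then WithLp.ofLp (φ ⟨x0 + u, hu⟩ - φ p) else 0 with hh
  have heh : ∀ u (hu : x0 + u ∈ X), e (h u) = φ ⟨x0 + u, hu⟩ := by
    intro u hu
    simp [hh, he, hu]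
  have hxq : ∀ w, x0 + q w = (φ.symm (e w) : Fin a → ℝ) := fun w => by simp [hq]
  have hxqm : ∀ w, x0 + q w ∈ X := fun w => by rw [hxq]; exact (φ.symm (e w)).2
  refine ⟨r1, s1, h, q, hr1p, min_le_right _ _, hs1, ?_, hqc.mono fun w hw => (hs' w hw).1, ?_, hq0,
    fun w hw => ⟨hxqm w, (hs' w hw).2⟩, ?_, ?_⟩
  · rw [continuousOn_iff_continuous_domRestrict]
    have : ({u | x0 + u ∈ X ∧ n1 u < r1} : Set (Fin a → ℝ)).domRestrict h =
        fun u => WithLp.ofLp (φ ⟨x0 + u.1, u.2.1⟩ - φ p) := by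
      funext u
      show h u.1 = _
      simp only [hh]
      exact dif_pos u.2.1
    rw [this]
    refine (PiLp.continuous_ofLp 2 _).comp (Continuous.sub ?_ continuous_const)
    refine φ.continuousOn.comp_continuous ?_ ?_
    · exact Continuous.subtype_mk (continuous_const.add continuous_subtype_val) _
    · intro u; exact hsrc _ u.2.1 u.2.2
  · have : x0 + 0 ∈ X := by simpa using hx0
    simp only [hh]
    rw [dif_pos this]
    have h2 : (⟨x0 + 0, this⟩ : X) = p := by simp [hp]
    rw [h2, sub_self]; rfl
  · intro u hu hn hn2
    simp only [hq]
    rw [heh u hu, φ.left_inv (hsrc u hu hn)]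
    simp
  · intro w hw
    have h1 := hxqm w
    simp only [hh]
    rw [dif_pos h1]
    have h2 : (⟨x0 + q w, h1⟩ : X) = φ.symm (e w) := Subtype.ext (hxq w)
    rw [h2, φ.right_inv (hs' w hw).1]
    simp [he]

end Charts

end SkelProof



namespace SkelProof

set_option linter.unusedSectionVars false
set_option linter.unusedDecidableInType false
set_option linter.unusedFintypeInType false

section Faces

open CubeFace

variable {a : ℕ}

instance decNone (F : CubeFace a) : DecidablePred (fun i => F i = none) :=
  fun i => decEq (F i) none

/-- free the directions occurring in `T` -/
def freed (F : CubeFace a) (T : Finset (Fin a × Bool)) : CubeFace a :=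
  fun i => if (i, true) ∈ T ∨ (i, false) ∈ T then none else F i

/-- the local complex at a face, allowing free directions from `S` only -/
def DM (M : Set (CubeFace a)) (F : CubeFace a) (S : Finset (Fin a)) :
    Set (Finset (Fin a × Bool)) :=
  {T | (∀ i, ¬ ((i, true) ∈ T ∧ (i, false) ∈ T)) ∧ (∀ p ∈ T, F p.1 ≠ some p.2) ∧
    freed F T ∈ M ∧ ∀ p ∈ T, F p.1 = none → p.1 ∈ S}

theorem freed_mono (F : CubeFace a) {T T' : Finset (Fin a × Bool)} (h : T ⊆ T') :
    freed F T ≤ freed F T' := by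
  intro i
  unfold freed
  by_cases h1 : (i, true) ∈ T' ∨ (i, false) ∈ T'
  · left; rw [if_pos h1]
  · right
    rw [if_neg h1, if_neg]
    rintro (h2 | h2)
    · exact h1 (Or.inl (h h2))
    · exact h1 (Or.inr (h h2))

theorem freed_empty (F : CubeFace a) : freed F ∅ = F := by
  funext i; simp [freed]

theorem DM_dc {M : Set (CubeFace a)} (hM : IsSubcomplex M) (F : CubeFace a) (S : Finset (Fin a)) :
    DC (DM M F S) := by
  rintro σ ⟨h1, h2, h3, h4⟩ τ hτ
  exact ⟨fun i h => h1 i ⟨hτ h.1, hτ h.2⟩, fun p hp => h2 p (hτ hp),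
    hM.2 _ h3 _ (freed_mono F hτ), fun p hp => h4 p (hτ hp)⟩

theorem DM_af (M : Set (CubeFace a)) (F : CubeFace a) (S : Finset (Fin a)) : AF (DM M F S) :=
  fun _ hT => hT.1

theorem DM_em {M : Set (CubeFace a)} {F : CubeFace a} (hF : F ∈ M) (S : Finset (Fin a)) :
    ∅ ∈ DM M F S :=
  ⟨by simp, by simp, by rw [freed_empty]; exact hF, by simp⟩

theorem freed_congr {F : CubeFace a} {T T' : Finset (Fin a × Bool)} (i : Fin a) (hi : F i = none)
    (h : ∀ j, j ≠ i → ∀ e, ((j, e) ∈ T ↔ (j, e) ∈ T')) : freed F T = freed F T' := by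
  funext j
  unfold freed
  by_cases hj : j = i
  · subst hj; simp [hi]
  · have h1 := h j hj true
    have h2 := h j hj false
    by_cases h3 : (j, true) ∈ T ∨ (j, false) ∈ T
    · rw [if_pos h3, if_pos (by tauto)]
    · rw [if_neg h3, if_neg (by tauto)]

theorem DM_susp (M : Set (CubeFace a)) (F : CubeFace a) (S : Finset (Fin a)) (i : Fin a)
    (hi : F i = none) (hS : i ∉ S) :
    IsSusp (DM M F S) (DM M F (insert i S)) (i, true) (i, false) := by
  have key : ∀ e, ∀ T ∈ DM M F S, (i, e) ∉ T := fun e T hT h => hS (hT.2.2.2 _ h hi)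
  have insx : ∀ e, ∀ T ∈ DM M F S, insert (i, e) T ∈ DM M F (insert i S) := by
    intro e T hT
    refine ⟨?_, ?_, ?_, ?_⟩
    · intro j ⟨h1, h2⟩
      by_cases hj : j = i
      · subst hj
        cases e
        · rcases Finset.mem_insert.mp h1 with h | h
          · simp at h
          · exact key _ T hT h
        · rcases Finset.mem_insert.mp h2 with h | h
          · simp at h
          · exact key _ T hT h
      · simp only [Finset.mem_insert, Prod.mk.injEq, hj, false_and, false_or] at h1 h2
        exact hT.1 j ⟨h1, h2⟩
    · intro p hp
      rcases Finset.mem_insert.mp hp with rfl | h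
      · simp [hi]
      · exact hT.2.1 p h
    · rw [freed_congr (T' := T) i hi]
      · exact hT.2.2.1
      · intro j hj e'; simp [hj]
    · intro p hp hpn
      rcases Finset.mem_insert.mp hp with rfl | h
      · simp
      · exact Finset.mem_insert_of_mem (hT.2.2.2 p h hpn)
  refine ⟨by simp, key true, key false, ?_, insx true, insx false, ?_, ?_⟩
  · intro T hT
    exact ⟨hT.1, hT.2.1, hT.2.2.1, fun p hp h => Finset.mem_insert_of_mem (hT.2.2.2 p hp h)⟩
  · intro T hT hin
    refine ⟨fun j h => hT.1 j ⟨Finset.mem_of_mem_erase h.1, Finset.mem_of_mem_erase h.2⟩,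
      fun p hp => hT.2.1 p (Finset.mem_of_mem_erase hp), ?_, ?_⟩
    · rw [freed_congr (T' := T) i hi]
      · exact hT.2.2.1
      · intro j hj e'; simp [hj]
    · rintro ⟨j, e⟩ hp hpn
      rcases Finset.mem_insert.mp (hT.2.2.2 _ (Finset.mem_of_mem_erase hp) hpn) with h | h
      · simp only at h
        subst h
        exfalso
        cases e
        · exact hT.1 j ⟨hin, Finset.mem_of_mem_erase hp⟩
        · simp at hp
      · exact h
  · intro T hT h1 h2
    refine ⟨hT.1, hT.2.1, hT.2.2.1, ?_⟩
    rintro ⟨j, e⟩ hp hpn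
    rcases Finset.mem_insert.mp (hT.2.2.2 _ hp hpn) with h | h
    · simp only at h
      subst h
      cases e
      · exact absurd hp h2
      · exact absurd hp h1
    · exact h

theorem DM_eq (M : Set (CubeFace a)) (F : CubeFace a) (S : Finset (Fin a)) (i : Fin a)
    (hi : F i ≠ none) : DM M F (insert i S) = DM M F S := by
  ext T
  refine and_congr Iff.rfl (and_congr Iff.rfl (and_congr Iff.rfl ?_))
  refine forall_congr' fun p => forall_congr' fun _ => forall_congr' fun hp => ?_
  have : p.1 ≠ i := fun h => hi (h ▸ hp)
  simp [this]

theorem DM_shift (M : Set (CubeFace a)) (F : CubeFace a) (S : Finset (Fin a)) :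
    (∀ c, Triv (c + (S.filter (fun i => F i = none)).card) (DM M F S) ↔ Triv c (DM M F ∅)) ∧
    (∀ c, Sph (c + (S.filter (fun i => F i = none)).card) (DM M F S) ↔ Sph c (DM M F ∅)) ∧
    (∀ c, c < (S.filter (fun i => F i = none)).card → Triv c (DM M F S)) := by
  induction S using Finset.induction_on with
  | empty => simp
  | insert i S hS ih =>
    obtain ⟨h1, h2, h3⟩ := ih
    by_cases hi : F i = none
    · have hs := DM_susp M F S i hi hS
      have hc : ((insert i S).filter (fun i => F i = none)).card
          = (S.filter (fun i => F i = none)).card + 1 := by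
        rw [Finset.filter_insert, if_pos hi, Finset.card_insert_of_notMem (by simp [hS])]
      rw [hc]
      refine ⟨fun c => ?_, fun c => ?_, fun c hcc => ?_⟩
      · rw [← add_assoc, susp_triv hs, h1]
      · rw [← add_assoc, susp_sph hs, h2]
      · cases c with
        | zero => exact susp_triv_zero hs
        | succ c => exact (susp_triv hs c).mpr (h3 c (by omega))
    · have hc : ((insert i S).filter (fun i => F i = none)) = S.filter (fun i => F i = none) := by
        rw [Finset.filter_insert, if_neg hi]
      rw [hc, DM_eq M F S i hi]
      exact ⟨h1, h2, h3⟩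

theorem dim_eq (F : CubeFace a) :
    dim F = (Finset.univ.filter (fun i => F i = none)).card := by
  rfl

/-- the cross-polytope -/
def Crs (m : ℕ) : Set (Finset (Fin m × Bool)) :=
  DM (Set.univ : Set (CubeFace m)) (fun _ => none) Finset.univ

theorem crs_base (m : ℕ) : DM (Set.univ : Set (CubeFace m)) (fun _ => none) ∅ = {∅} := by
  ext T
  rw [Set.mem_singleton_iff]
  constructor
  · rintro ⟨-, -, -, h⟩
    rw [Finset.eq_empty_iff_forall_notMem]
    intro p hp
    simpa using h p hp rfl
  · rintro rfl
    exact DM_em (Set.mem_univ _) _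

theorem crs_sph (m : ℕ) : Sph m (Crs m) := by
  have h := ((DM_shift (Set.univ : Set (CubeFace m)) (fun _ => none) Finset.univ).2.1 0).mpr
    (by rw [crs_base]; exact point_sph)
  simpa [Crs] using h

theorem crs_triv (m c : ℕ) (hc : c ≠ m) : Triv c (Crs m) := by
  rcases lt_or_gt_of_ne hc with h | h
  · exact (DM_shift (Set.univ : Set (CubeFace m)) (fun _ => none) Finset.univ).2.2 c (by simpa using h)
  · obtain ⟨d, rfl⟩ := Nat.exists_eq_add_of_lt h
    have h := ((DM_shift (Set.univ : Set (CubeFace m)) (fun _ => none) Finset.univ).1 (d + 1)).mpr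
      (by rw [crs_base]; exact point_triv d)
    have h2 : d + 1 + (Finset.univ.filter (fun i : Fin m => (none : Option Bool) = none)).card
      = m + d + 1 := by simp; omega
    rw [← h2]
    exact h

variable [Nonempty (Fin a)]

theorem mem_sp_true (u : Fin a → ℝ) (i : Fin a) : (i, true) ∈ sp u ↔ 0 < u i := by
  simp [sp, mem_spt, lft]

theorem mem_sp_false (u : Fin a → ℝ) (i : Fin a) : (i, false) ∈ sp u ↔ u i < 0 := by
  simp [sp, mem_spt, lft]

noncomputable def ctr (F : CubeFace a) : Fin a → ℝ := fun i =>
  if F i = none then 1 / 2 else if F i = some true then 1 else 0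

theorem opt_cases (o : Option Bool) : o = none ∨ o = some true ∨ o = some false := by
  rcases o with _ | _ | _ <;> simp

theorem local_cone (M : Set (CubeFace a)) (hM : IsSubcomplex M) (F : CubeFace a) (u : Fin a → ℝ)
    (hu : ∀ i, |u i| < 1 / 2) : ctr F + u ∈ real M ↔ u ∈ Cn (DM M F Finset.univ) := by
  show _ ↔ sp u ∈ DM M F Finset.univ
  have hfr : ∀ i, freed F (sp u) i = if u i = 0 then F i else none := by
    intro i
    unfold freed
    have e1 := mem_sp_true u i
    have e2 := mem_sp_false u i
    by_cases h : u i = 0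
    · rw [if_pos h, if_neg]
      rw [e1, e2, h]; simp
    · rw [if_neg h, if_pos]
      rw [e1, e2]
      rcases lt_or_gt_of_ne h with h | h
      · exact Or.inr h
      · exact Or.inl h
  constructor
  · intro h
    simp only [real, Set.mem_iUnion] at h
    obtain ⟨G, hG, hx, hGx⟩ := h
    refine ⟨?_, ?_, hM.2 G hG _ ?_, fun p _ _ => Finset.mem_univ _⟩
    · intro i
      rw [mem_sp_true, mem_sp_false]
      intro h; linarith [h.1, h.2]
    · rintro ⟨i, e⟩ hp hF
      have h1 := hx i
      simp only [Pi.add_apply, ctr] at h1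
      simp only at hF
      cases e
      · rw [mem_sp_false] at hp
        simp [hF] at h1
        linarith
      · rw [mem_sp_true] at hp
        simp [hF] at h1
        linarith
    · intro i
      rw [hfr]
      have h2 := abs_lt.mp (hu i)
      obtain ⟨h3, h4⟩ := hGx i
      rcases opt_cases (G i) with h | h | h
      · exact Or.inl h
      · right
        have h5 := h4 h
        simp only [Pi.add_apply, ctr] at h5
        rw [h]
        rcases opt_cases (F i) with h' | h' | h'
        · simp [h'] at h5; linarith
        · simp [h'] at h5; simp [h5, h']
        · simp [h'] at h5; linarith
      · right
        have h5 := h3 h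
        simp only [Pi.add_apply, ctr] at h5
        rw [h]
        rcases opt_cases (F i) with h' | h' | h'
        · simp [h'] at h5; linarith
        · simp [h'] at h5; linarith
        · simp [h'] at h5; simp [h5, h']
  · rintro ⟨-, h2, h3, -⟩
    simp only [real, Set.mem_iUnion]
    refine ⟨_, h3, ?_, ?_⟩
    · intro i
      have h4 := abs_lt.mp (hu i)
      simp only [Pi.add_apply, ctr]
      rcases opt_cases (F i) with h | h | h
      · simp only [h, if_true]; constructor <;> linarith
      · have : u i ≤ 0 := by
          by_contra h5
          exact h2 _ ((mem_sp_true u i).mpr (not_le.mp h5)) h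
        simp [h]; constructor <;> linarith
      · have : 0 ≤ u i := by
          by_contra h5
          exact h2 _ ((mem_sp_false u i).mpr (not_le.mp h5)) h
        simp [h]; constructor <;> linarith
    · intro i
      rw [hfr]
      simp only [Pi.add_apply, ctr]
      by_cases h0 : u i = 0
      · rw [if_pos h0, h0]
        constructor
        · intro h; simp [h]
        · intro h; simp [h]
      · rw [if_neg h0]; simp

theorem face_HE {m : ℕ} [Nonempty (Fin m)] (M : Set (CubeFace a)) (hM : IsSubcomplex M)
    (hman : IsCompactManifold (↥(real M)) m) (F : CubeFace a) (hF : F ∈ M) :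
    HE (DM M F Finset.univ) (Crs m) := by
  obtain ⟨-, ⟨inst⟩⟩ := hman
  have hC : ∀ w : Fin m → ℝ, w ∈ Cn (Crs m) := by
    intro w
    refine ⟨?_, by simp, Set.mem_univ _, by simp⟩
    intro i
    rw [mem_sp_true, mem_sp_false]
    intro h; linarith [h.1, h.2]
  have hz : (0 : Fin a → ℝ) ∈ Cn (DM M F Finset.univ) := by
    show sp 0 ∈ DM M F Finset.univ
    rw [sp_zero]; exact DM_em hF _
  have hx0 : ctr F ∈ real M := by
    have := (local_cone M hM F 0 (by simp)).mpr hz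
    simpa using this
  obtain ⟨r1, s1, h, q, hr1, hrr, hs1, hc, qc, h0, q0, hq, hqh, hhq⟩ :=
    chart_local (m := m) (real M) (ctr F) hx0 (ρ := 1 / 2) (by norm_num)
  have hloc : ∀ u : Fin a → ℝ, n1 u < r1 → (ctr F + u ∈ real M ↔ u ∈ Cn (DM M F Finset.univ)) := by
    intro u hu
    apply local_cone M hM
    intro i
    calc |u i| ≤ ‖u‖ := norm_le_pi_norm u i
      _ ≤ n1 u := norm_le_n1 u
      _ < 1 / 2 := by linarith
  have n10 : n1 (0 : Fin m → ℝ) < s1 := by simpa [n1] using hs1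
  -- shrink the domain so that `h` lands in the ball
  have hS : ∃ r2, 0 < r2 ∧ r2 ≤ r1 ∧ ∀ u, ctr F + u ∈ real M → n1 u < r2 → n1 (h u) < s1 := by
    have h1 : ContinuousWithinAt (fun u => n1 (h u)) {u | ctr F + u ∈ real M ∧ n1 u < r1} 0 :=
      cont_n1.continuousAt.comp_continuousWithinAt (hc 0 ⟨by simpa using hx0, by simpa [n1] using hr1⟩)
    have h2 : n1 (h 0) < s1 := by rw [h0]; exact n10
    have h3 := h1.eventually_lt_const h2
    rw [eventually_nhdsWithin_iff] at h3
    obtain ⟨ε, hε, h4⟩ := Metric.eventually_nhds_iff.mp h3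
    refine ⟨min r1 ε, lt_min hr1 hε, min_le_left _ _, ?_⟩
    intro u hu hn
    refine h4 ?_ ⟨hu, hn.trans_le (min_le_left _ _)⟩
    rw [dist_zero_right]
    exact (norm_le_n1 u).trans_lt (hn.trans_le (min_le_right _ _))
  obtain ⟨r2, hr2, hr21, hr2s⟩ := hS
  have hT : ∃ s2, 0 < s2 ∧ s2 ≤ s1 ∧ ∀ w, n1 w < s2 → n1 (q w) < r2 := by
    have h1 : ContinuousWithinAt (fun u => n1 (q u)) {w | n1 w < s1} 0 :=
      cont_n1.continuousAt.comp_continuousWithinAt (qc 0 n10)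
    have h2 : n1 (q 0) < r2 := by rw [q0]; simpa [n1] using hr2
    have h3 := h1.eventually_lt_const h2
    rw [eventually_nhdsWithin_iff] at h3
    obtain ⟨ε, hε, h4⟩ := Metric.eventually_nhds_iff.mp h3
    refine ⟨min s1 ε, lt_min hs1 hε, min_le_left _ _, ?_⟩
    intro u hn
    refine h4 ?_ (hn.trans_le (min_le_left _ _))
    rw [dist_zero_right]
    exact (norm_le_n1 u).trans_lt (hn.trans_le (min_le_right _ _))
  obtain ⟨s2, hs2, hs21, hs2r⟩ := hT
  refine HE_of_local (DM_dc hM F _) (DM_af M F _) (DM_em hF _)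
    (DM_dc ⟨⟨fun _ => none, Set.mem_univ _⟩, fun _ _ _ _ => Set.mem_univ _⟩ _ _) (DM_af _ _ _)
    (DM_em (Set.mem_univ _) _) hr2 hs2 h q ?_ ?_ h0 ?_ ?_ ?_ ?_
  · refine hc.mono ?_
    rintro u ⟨h1, h2⟩
    exact ⟨(hloc u (by linarith)).mpr h1, by linarith⟩
  · refine qc.mono ?_
    rintro u ⟨h1, h2⟩
    exact lt_of_lt_of_le h2 hs21
  · intro u hu hn hu0
    refine ⟨hC _, fun hh0 => hu0 ?_⟩
    have hm := (hloc u (by linarith)).mpr hu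
    have := hqh u hm (by linarith) (hr2s u hm hn)
    rw [← this, hh0, q0]
  · intro w _ hn hw0
    have h1 := (hq w (by linarith)).1
    have h2 := hs2r w hn
    refine ⟨(hloc _ (by linarith)).mp h1, h2, fun hq0 => hw0 ?_⟩
    rw [← hhq w (by linarith), hq0, h0]
  · intro u hu hn hn2
    exact hqh u ((hloc u (by linarith)).mpr hu) (by linarith) (by linarith)
  · intro w _ hn
    exact hhq w (by linarith)

theorem face_sph {m : ℕ} [Nonempty (Fin m)] {M : Set (CubeFace a)} (hM : IsSubcomplex M)
    (hman : IsCompactManifold (↥(real M)) m) (F : CubeFace a) (hF : F ∈ M) (hd : dim F ≤ m) :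
    Sph (m - dim F) (DM M F ∅) ∧ ∀ c, c ≠ m - dim F → Triv c (DM M F ∅) := by
  have h := face_HE M hM hman F hF
  obtain ⟨h1, h2, -⟩ := DM_shift M F Finset.univ
  rw [← dim_eq] at h1 h2
  constructor
  · rw [← h2, Nat.sub_add_cancel hd]
    exact h.sph (crs_sph m)
  · intro c hc
    rw [← h1]
    exact h.triv (crs_triv m _ (by omega))

theorem vert_link (M : Set (CubeFace a)) (v : Fin a → Bool) (τ : Finset (Fin a × Bool))
    (hτ : τ ∈ DM M (toFace v) ∅) :
    Lk (DM M (toFace v) ∅) τ = DM M (freed (toFace v) τ) ∅ := by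
  have hne : ∀ p ∈ τ, p.2 = !(v p.1) := by
    intro p hp
    have := hτ.2.1 p hp
    simp only [toFace, ne_eq, Option.some.injEq] at this
    cases h1 : v p.1 <;> cases h2 : p.2 <;> simp_all
  have hff : ∀ T, freed (freed (toFace v) τ) T = freed (toFace v) (T ∪ τ) := by
    intro T
    funext i
    simp only [freed, Finset.mem_union]
    by_cases h1 : (i, true) ∈ T ∨ (i, false) ∈ T
    · rw [if_pos h1, if_pos (by tauto)]
    · rw [if_neg h1]
      by_cases h2 : (i, true) ∈ τ ∨ (i, false) ∈ τ
      · rw [if_pos h2, if_pos (by tauto)]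
      · rw [if_neg h2, if_neg (by tauto)]
  ext T
  constructor
  · rintro ⟨hdis, h1, h2, h3, h4⟩
    have key : ∀ p ∈ T, freed (toFace v) τ p.1 = some (v p.1) := by
      rintro ⟨i, e⟩ hp
      have h5 := h2 _ (Finset.mem_union_left τ hp)
      simp only [toFace, ne_eq, Option.some.injEq] at h5
      unfold freed
      rw [if_neg]
      · rfl
      · have hni : (i, e) ∉ τ := Finset.disjoint_left.mp hdis hp
        rintro (h | h)
        · have := hne _ h
          simp only at this
          apply hni
          convert h using 2
          clear hni h
          revert h5 this
          generalize v i = x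
          cases x <;> cases e <;> simp
        · have := hne _ h
          simp only at this
          apply hni
          convert h using 2
          clear hni h
          revert h5 this
          generalize v i = x
          cases x <;> cases e <;> simp
    refine ⟨fun i h => h1 i ⟨Finset.mem_union_left _ h.1, Finset.mem_union_left _ h.2⟩, ?_, ?_, ?_⟩
    · intro p hp
      rw [key p hp]
      exact h2 p (Finset.mem_union_left _ hp)
    · rw [hff]; exact h3
    · intro p hp h
      rw [key p hp] at h
      simp at h
  · rintro ⟨h1, h2, h3, h4⟩
    have key : ∀ p ∈ T, (p.1, true) ∉ τ ∧ (p.1, false) ∉ τ := by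
      intro p hp
      by_contra h
      have h5 : freed (toFace v) τ p.1 = none := by
        unfold freed
        rw [if_pos (by tauto)]
      simpa using h4 p hp h5
    have h2' : ∀ p ∈ T ∪ τ, (toFace v) p.1 ≠ some p.2 := by
      intro p hp
      rcases Finset.mem_union.mp hp with h | h
      · have h5 := h2 p h
        unfold freed at h5
        rwa [if_neg (by have := key p h; tauto)] at h5
      · exact hτ.2.1 p h
    refine ⟨?_, ?_, h2', ?_, ?_⟩
    · rw [Finset.disjoint_left]
      rintro ⟨i, e⟩ hp hp2
      have := key _ hp
      cases e
      · exact this.2 hp2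
      · exact this.1 hp2
    · intro i ⟨ht, hf⟩
      have a1 := h2' _ ht
      have a2 := h2' _ hf
      simp only [toFace, ne_eq, Option.some.injEq] at a1 a2
      cases h : v i <;> simp_all
    · rw [← hff]; exact h3
    · intro p _ h
      simp [toFace] at h

theorem dim_freed (M : Set (CubeFace a)) (v : Fin a → Bool) (τ : Finset (Fin a × Bool))
    (hτ : τ ∈ DM M (toFace v) ∅) : dim (freed (toFace v) τ) = τ.card := by
  rw [dim_eq, ← Finset.card_image_of_injOn (s := τ) (f := Prod.fst)]
  · congr 1
    ext i
    simp [freed, toFace]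
    tauto
  · rintro ⟨i, e⟩ h1 ⟨j, e'⟩ h2 h3
    simp only at h3
    subst h3
    have a1 := hτ.2.1 _ h1
    have a2 := hτ.2.1 _ h2
    simp only [toFace, ne_eq, Option.some.injEq] at a1 a2
    cases h : v i <;> cases e <;> cases e' <;> simp_all

theorem vert_HS {m : ℕ} [Nonempty (Fin m)] {M : Set (CubeFace a)} (hM : IsSubcomplex M)
    (hd : HasDim M m) (hman : IsCompactManifold (↥(real M)) m) (v : Fin a → Bool)
    (hv : v ∈ cvert M) : HS m (DM M (toFace v) ∅) := by
  refine ⟨DM_dc hM _ _, DM_em hv _, ?_, ?_, ?_⟩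
  · intro τ hτ
    rw [← dim_freed M v τ hτ]
    exact hd.1 _ hτ.2.2.1
  · intro τ hτ
    rw [vert_link M v τ hτ, ← dim_freed M v τ hτ]
    exact (face_sph hM hman _ hτ.2.2.1 (hd.1 _ hτ.2.2.1)).1
  · intro τ hτ c hc
    rw [vert_link M v τ hτ]
    rw [← dim_freed M v τ hτ] at hc
    exact (face_sph hM hman _ hτ.2.2.1 (hd.1 _ hτ.2.2.1)).2 c hc

end Faces

end SkelProof



namespace SkelProof

set_option linter.unusedSectionVars false
set_option linter.unusedDecidableInType false
set_option linter.unusedFintypeInType false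

section Cubes

open CubeFace

variable {a b : ℕ}

/-- the face through the vertex `v` with free directions `S` -/
def fc (v : Fin a → Bool) (S : Finset (Fin a)) : CubeFace a :=
  fun i => if i ∈ S then none else some (v i)

/-- flip the coordinates in `A` -/
def fl (v : Fin a → Bool) (A : Finset (Fin a)) : Fin a → Bool :=
  fun i => if i ∈ A then !(v i) else v i

theorem mem_fc {v w : Fin a → Bool} {S : Finset (Fin a)} :
    w ∈ verts (fc v S) ↔ ∀ i, i ∉ S → w i = v i := by
  refine forall_congr' fun i => ?_
  by_cases h : i ∈ S
  · simp [fc, h]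
  · simp [fc, toFace, h]

theorem mem_fc' {v w : Fin a → Bool} {S : Finset (Fin a)} :
    w ∈ verts (fc v S) ↔ ∃ A, A ⊆ S ∧ w = fl v A := by
  rw [mem_fc]
  constructor
  · intro h
    refine ⟨Finset.univ.filter (fun i => w i ≠ v i), ?_, ?_⟩
    · intro i hi
      by_contra h2
      exact (Finset.mem_filter.mp hi).2 (h i h2)
    · funext i
      by_cases h2 : w i = v i
      · simp [fl, h2]
      · simp only [fl, Finset.mem_filter, Finset.mem_univ, true_and, ne_eq, h2, not_false_eq_true,
          if_true]
        revert h2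
        generalize w i = x
        generalize v i = y
        cases x <;> cases y <;> simp
  · rintro ⟨A, hA, rfl⟩ i hi
    have : i ∉ A := fun h => hi (hA h)
    simp [fl, this]

theorem fc_eq_of_mem {v w : Fin a → Bool} {S : Finset (Fin a)} (h : w ∈ verts (fc v S)) :
    fc w S = fc v S := by
  rw [mem_fc] at h
  funext i
  by_cases hi : i ∈ S
  · simp [fc, hi]
  · simp [fc, hi, h i hi]

theorem exists_fc (F : CubeFace a) {v : Fin a → Bool} (h : v ∈ verts F) : ∃ S, F = fc v S := by
  refine ⟨Finset.univ.filter (fun i => F i = none), ?_⟩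
  funext i
  have h1 : F i = none ∨ some (v i) = F i := h i
  by_cases hi : F i = none
  · simp [fc, hi]
  · simp only [fc, Finset.mem_filter, Finset.mem_univ, true_and, hi, if_false]
    rcases h1 with h1 | h1
    · exact absurd h1 hi
    · exact h1.symm

theorem exists_vert (F : CubeFace a) : ∃ v, v ∈ verts F := by
  refine ⟨fun i => (F i).getD false, fun i => ?_⟩
  cases h : F i with
  | none => exact Or.inl rfl
  | some x => right; show some ((F i).getD false) = some x; rw [h]; rfl

theorem self_mem (v : Fin a → Bool) (S : Finset (Fin a)) : v ∈ verts (fc v S) :=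
  mem_fc.mpr fun _ _ => rfl

theorem dim_fc (v : Fin a → Bool) (S : Finset (Fin a)) : dim (fc v S) = S.card := by
  rw [dim_eq]
  congr 1
  ext i
  simp [fc]

theorem fc_empty (v : Fin a → Bool) : fc v ∅ = toFace v := by
  funext i; simp [fc, toFace]

theorem fc_mono (v : Fin a → Bool) {S S' : Finset (Fin a)} (h : S ⊆ S') : fc v S ≤ fc v S' := by
  intro i
  by_cases hi : i ∈ S'
  · left; simp [fc, hi]
  · right
    have : i ∉ S := fun h2 => hi (h h2)
    simp [fc, hi, this]

theorem fl_mem (v : Fin a → Bool) {A S : Finset (Fin a)} (h : A ⊆ S) : fl v A ∈ verts (fc v S) :=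
  mem_fc'.mpr ⟨A, h, rfl⟩

theorem fl_inj {v : Fin a → Bool} {A B : Finset (Fin a)} (h : fl v A = fl v B) : A = B := by
  ext i
  have := congrFun h i
  simp only [fl] at this
  by_cases h1 : i ∈ A <;> by_cases h2 : i ∈ B <;> simp_all

theorem fl_empty (v : Fin a → Bool) : fl v ∅ = v := by
  funext i; simp [fl]

theorem fl_insert (v : Fin a → Bool) {A : Finset (Fin a)} {i : Fin a} (h : i ∉ A) :
    fl (fl v {i}) A = fl v (insert i A) := by
  funext j
  by_cases hj : j = i
  · subst hj; simp [fl, h]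
  · by_cases h2 : j ∈ A <;> simp [fl, hj, h2]

theorem mem_of_verts_fc {v : Fin a → Bool} {S S' : Finset (Fin a)}
    (h : verts (fc v S) ⊆ verts (fc v S')) : S ⊆ S' := by
  intro i hi
  obtain ⟨A, hA, h2⟩ := mem_fc'.mp (h (fl_mem v (Finset.singleton_subset_iff.mpr hi)))
  rw [← fl_inj h2] at hA
  simpa using hA

theorem verts_inj {F G : CubeFace a} (h : verts F = verts G) : F = G := by
  obtain ⟨v, hv⟩ := exists_vert F
  obtain ⟨S, rfl⟩ := exists_fc F hv
  obtain ⟨S', rfl⟩ := exists_fc G (h ▸ hv)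
  rw [Finset.Subset.antisymm (mem_of_verts_fc h.subset) (mem_of_verts_fc h.symm.subset)]

theorem vert_mem {M : Set (CubeFace a)} (hM : IsSubcomplex M) {v w : Fin a → Bool}
    {S : Finset (Fin a)} (h : fc v S ∈ M) (hw : w ∈ verts (fc v S)) : w ∈ cvert M := by
  show toFace w ∈ M
  exact hM.2 _ h _ hw

/-- an isomorphism of `k`-skeleta, with its inverse -/
structure SkI (k : ℕ) (M : Set (CubeFace a)) (N : Set (CubeFace b))
    (f : (Fin a → Bool) → (Fin b → Bool)) (g : (Fin b → Bool) → (Fin a → Bool)) : Prop where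
  subM : IsSubcomplex M
  subN : IsSubcomplex N
  fm : ∀ v ∈ cvert M, f v ∈ cvert N
  gm : ∀ v ∈ cvert N, g v ∈ cvert M
  gf : ∀ v ∈ cvert M, g (f v) = v
  fg : ∀ v ∈ cvert N, f (g v) = v
  ff : ∀ F ∈ M, dim F ≤ k → ∃ G ∈ N, verts G = f '' verts F
  gg : ∀ G ∈ N, dim G ≤ k → ∃ F ∈ M, verts F = g '' verts G

variable {k : ℕ} {M : Set (CubeFace a)} {N : Set (CubeFace b)}
    {f : (Fin a → Bool) → (Fin b → Bool)} {g : (Fin b → Bool) → (Fin a → Bool)}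

theorem SkI.symm (h : SkI k M N f g) : SkI k N M g f :=
  ⟨h.subN, h.subM, h.gm, h.fm, h.fg, h.gf, h.gg, h.ff⟩

theorem SkI.inj (h : SkI k M N f g) {v w : Fin a → Bool} (hv : v ∈ cvert M) (hw : w ∈ cvert M)
    (he : f v = f w) : v = w := by
  rw [← h.gf v hv, he, h.gf w hw]

theorem SkI.edge (h : SkI k M N f g) (hk : 2 ≤ k) {v : Fin a → Bool} {i : Fin a}
    (he : fc v {i} ∈ M) : ∃ j, fc (f v) {j} ∈ N ∧ f (fl v {i}) = fl (f v) {j} := by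
  have hv : v ∈ cvert M := vert_mem h.subM he (self_mem _ _)
  have hv' : fl v {i} ∈ cvert M := vert_mem h.subM he (fl_mem v (Finset.Subset.refl _))
  have hne : v ≠ fl v {i} := by
    intro h2
    have h3 : fl v ∅ = fl v {i} := by rw [fl_empty]; exact h2
    simpa using fl_inj h3
  obtain ⟨G, hG, hGv⟩ := h.ff _ he (by rw [dim_fc]; simp; omega)
  have hfv : f v ∈ verts G := by rw [hGv]; exact ⟨v, self_mem _ _, rfl⟩
  obtain ⟨S, rfl⟩ := exists_fc G hfv
  have key : ∀ w ∈ verts (fc (f v) S), w = f v ∨ w = f (fl v {i}) := by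
    intro w hw
    rw [hGv] at hw
    obtain ⟨x, hx, rfl⟩ := hw
    obtain ⟨A, hA, rfl⟩ := mem_fc'.mp hx
    rcases Finset.subset_singleton_iff.mp hA with rfl | rfl
    · left; rw [fl_empty]
    · right; rfl
  have key2 : ∀ j ∈ S, f (fl v {i}) = fl (f v) {j} := by
    intro j hj
    rcases key _ (fl_mem (f v) (Finset.singleton_subset_iff.mpr hj)) with h2 | h2
    · have h3 : fl (f v) {j} = fl (f v) ∅ := by rw [fl_empty]; exact h2
      simpa using fl_inj h3
    · exact h2.symm
  have hSn : S.Nonempty := by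
    rw [Finset.nonempty_iff_ne_empty]
    rintro rfl
    have h2 : f (fl v {i}) ∈ verts (fc (f v) ∅) := by
      rw [hGv]; exact ⟨_, fl_mem v (Finset.Subset.refl _), rfl⟩
    obtain ⟨A, hA, h3⟩ := mem_fc'.mp h2
    rw [Finset.subset_empty.mp hA, fl_empty] at h3
    exact hne (h.inj hv hv' h3.symm)
  obtain ⟨j, hj⟩ := hSn
  refine ⟨j, ?_, key2 j hj⟩
  exact h.subN.2 _ hG _ (fc_mono _ (Finset.singleton_subset_iff.mpr hj))

variable [Nonempty (Fin a)] [Nonempty (Fin b)]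

/-- the induced map on directions -/
noncomputable def pd (f : (Fin a → Bool) → (Fin b → Bool)) (v : Fin a → Bool) (i : Fin a) : Fin b :=
  Classical.epsilon fun j => f (fl v {i}) = fl (f v) {j}

theorem pd_unique {v : Fin a → Bool} {i : Fin a} {j : Fin b} (h : f (fl v {i}) = fl (f v) {j}) :
    pd f v i = j := by
  have h2 := Classical.epsilon_spec (p := fun j => f (fl v {i}) = fl (f v) {j}) ⟨j, h⟩
  have h3 : fl (f v) {pd f v i} = fl (f v) {j} := by rw [← h]; exact h2.symm
  simpa using fl_inj h3

theorem SkI.pd_spec (h : SkI k M N f g) (hk : 2 ≤ k) {v : Fin a → Bool} {i : Fin a}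
    (he : fc v {i} ∈ M) : fc (f v) {pd f v i} ∈ N ∧ f (fl v {i}) = fl (f v) {pd f v i} := by
  obtain ⟨j, h1, h2⟩ := h.edge hk he
  rw [pd_unique h2]
  exact ⟨h1, h2⟩

theorem SkI.pd_inv (h : SkI k M N f g) (hk : 2 ≤ k) {v : Fin a → Bool} {i : Fin a}
    (he : fc v {i} ∈ M) : pd g (f v) (pd f v i) = i := by
  apply pd_unique
  rw [← (h.pd_spec hk he).2, h.gf _ (vert_mem h.subM he (fl_mem v (Finset.Subset.refl _))),
    h.gf _ (vert_mem h.subM he (self_mem _ _))]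

theorem SkI.square (h : SkI k M N f g) (hk : 2 ≤ k) {v : Fin a → Bool} {i j : Fin a} (hij : i ≠ j)
    (hs : fc v {i, j} ∈ M) : pd f (fl v {i}) j = pd f v j := by
  have hei : fc v {i} ∈ M := h.subM.2 _ hs _ (fc_mono v (by simp))
  have hej : fc v {j} ∈ M := h.subM.2 _ hs _ (fc_mono v (by simp))
  obtain ⟨-, hi⟩ := h.pd_spec hk hei
  obtain ⟨-, hj⟩ := h.pd_spec hk hej
  have hne : pd f v i ≠ pd f v j := by
    intro h2
    apply hij
    rw [← h.pd_inv hk hei, h2, h.pd_inv hk hej]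
  obtain ⟨G, hG, hGv⟩ := h.ff _ hs (by rw [dim_fc, Finset.card_pair hij]; exact hk)
  have hfv : f v ∈ verts G := by rw [hGv]; exact ⟨v, self_mem _ _, rfl⟩
  obtain ⟨S, rfl⟩ := exists_fc G hfv
  have hin : ∀ l, l ∈ ({i, j} : Finset (Fin a)) → f (fl v {l}) = fl (f v) {pd f v l} → pd f v l ∈ S := by
    intro l hl h2
    have h3 : fl (f v) {pd f v l} ∈ verts (fc (f v) S) := by
      rw [hGv, ← h2]; exact ⟨_, fl_mem v (Finset.singleton_subset_iff.mpr hl), rfl⟩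
    obtain ⟨A, hA, h4⟩ := mem_fc'.mp h3
    rw [← fl_inj h4] at hA
    simpa using hA
  have hiS := hin i (by simp) hi
  have hjS := hin j (by simp) hj
  have hm : fl (f v) {pd f v i, pd f v j} ∈ verts (fc (f v) S) := by
    apply fl_mem
    intro l hl
    simp only [Finset.mem_insert, Finset.mem_singleton] at hl
    rcases hl with rfl | rfl <;> assumption
  rw [hGv] at hm
  obtain ⟨x, hx, hfx⟩ := hm
  obtain ⟨A, hA, rfl⟩ := mem_fc'.mp hx
  have hAi : i ∈ A := by
    by_contra hc
    have h2 : A ⊆ {j} := by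
      intro l hl
      have := hA hl
      simp only [Finset.mem_insert, Finset.mem_singleton] at this ⊢
      rcases this with rfl | h3
      · exact absurd hl hc
      · exact h3
    rcases Finset.subset_singleton_iff.mp h2 with rfl | rfl
    · rw [fl_empty] at hfx
      have h3 : fl (f v) ∅ = fl (f v) {pd f v i, pd f v j} := by rw [fl_empty]; exact hfx
      have h4 := fl_inj h3
      have h5 : pd f v i ∈ (∅ : Finset (Fin b)) := by rw [h4]; simp
      simp at h5
    · rw [hj] at hfx
      have h4 := fl_inj hfx
      have h5 : pd f v i ∈ ({pd f v j} : Finset (Fin b)) := by rw [h4]; simp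
      exact hne (Finset.mem_singleton.mp h5)
  have hAj : j ∈ A := by
    by_contra hc
    have h2 : A = {i} := by
      apply Finset.Subset.antisymm
      · intro l hl
        have := hA hl
        simp only [Finset.mem_insert, Finset.mem_singleton] at this ⊢
        rcases this with h3 | rfl
        · exact h3
        · exact absurd hl hc
      · simpa using hAi
    subst h2
    rw [hi] at hfx
    have h4 := fl_inj hfx
    have h5 : pd f v j ∈ ({pd f v i} : Finset (Fin b)) := by rw [h4]; simp
    exact hne (Finset.mem_singleton.mp h5).symm
  have hAe : A = {i, j} := by
    apply Finset.Subset.antisymm hA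
    intro l hl
    simp only [Finset.mem_insert, Finset.mem_singleton] at hl
    rcases hl with rfl | rfl <;> assumption
  apply pd_unique
  rw [fl_insert v (by simpa using hij), hi, fl_insert (f v) (by simpa using hne), ← hAe]
  exact hfx

theorem SkI.flips (h : SkI k M N f g) (hk : 2 ≤ k) (S A : Finset (Fin a)) (hA : A ⊆ S) :
    ∀ v, fc v S ∈ M → f (fl v A) = fl (f v) (A.image (pd f v)) := by
  induction A using Finset.induction_on with
  | empty => intro v _; simp [fl_empty]
  | insert i A hi ih =>
    intro v hv
    have hiS : i ∈ S := hA (by simp)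
    have hAS : A ⊆ S := fun l hl => hA (by simp [hl])
    have hei : fc v {i} ∈ M := h.subM.2 _ hv _ (fc_mono v (by simpa using hiS))
    have h1 : fc (fl v {i}) S = fc v S := fc_eq_of_mem (fl_mem v (by simpa using hiS))
    have h2 := ih hAS (fl v {i}) (by rw [h1]; exact hv)
    rw [fl_insert v hi, (h.pd_spec hk hei).2] at h2
    have h3 : A.image (pd f (fl v {i})) = A.image (pd f v) := by
      apply Finset.image_congr
      intro j hj
      have hj' : j ∈ A := hj
      have hne : i ≠ j := by
        rintro rfl
        exact hi hj'
      apply h.square hk hne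
      refine h.subM.2 _ hv _ (fc_mono v ?_)
      intro l hl
      simp only [Finset.mem_insert, Finset.mem_singleton] at hl
      rcases hl with rfl | rfl
      · exact hiS
      · exact hAS hj'
    rw [h2, h3, Finset.image_insert, fl_insert]
    intro hc
    obtain ⟨j, hj, hje⟩ := Finset.mem_image.mp hc
    have hej : fc v {j} ∈ M := h.subM.2 _ hv _ (fc_mono v (by simpa using hAS hj))
    apply hi
    rw [← h.pd_inv hk hei, ← hje, h.pd_inv hk hej]
    exact hj

theorem SkI.image_verts (h : SkI k M N f g) (hk : 2 ≤ k) {S : Finset (Fin a)} {v : Fin a → Bool}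
    (hv : fc v S ∈ M) : f '' verts (fc v S) = verts (fc (f v) (S.image (pd f v))) := by
  ext w
  constructor
  · rintro ⟨x, hx, rfl⟩
    obtain ⟨A, hA, rfl⟩ := mem_fc'.mp hx
    rw [h.flips hk S A hA v hv]
    exact fl_mem _ (Finset.image_subset_image hA)
  · intro hw
    obtain ⟨B, hB, rfl⟩ := mem_fc'.mp hw
    obtain ⟨A, hA, rfl⟩ := Finset.subset_image_iff.mp hB
    have hA' : A ⊆ S := hA
    exact ⟨fl v A, fl_mem v hA', h.flips hk S A hA' v hv⟩

theorem SkI.low (h : SkI k M N f g) (hk : 2 ≤ k) {S : Finset (Fin a)} {v : Fin a → Bool}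
    (hv : fc v S ∈ M) (hS : S.card ≤ k) : fc (f v) (S.image (pd f v)) ∈ N := by
  obtain ⟨G, hG, hGv⟩ := h.ff _ hv (by rw [dim_fc]; exact hS)
  rw [h.image_verts hk hv] at hGv
  rw [← verts_inj hGv]
  exact hG

/-- link vertices at `v` -/
def LX (M : Set (CubeFace a)) (v : Fin a → Bool) : Set (Fin a × Bool) :=
  {p | p.2 = !(v p.1) ∧ fc v {p.1} ∈ M}

theorem freed_eq_fc (v : Fin a → Bool) (T : Finset (Fin a × Bool)) :
    freed (toFace v) T = fc v (T.image Prod.fst) := by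
  funext i
  have : i ∈ T.image Prod.fst ↔ ((i, true) ∈ T ∨ (i, false) ∈ T) := by
    simp; tauto
  unfold freed fc
  by_cases h : (i, true) ∈ T ∨ (i, false) ∈ T
  · rw [if_pos h, if_pos (this.mpr h)]
  · rw [if_neg h, if_neg (fun h2 => h (this.mp h2))]
    rfl

theorem mem_link {v : Fin a → Bool} {T : Finset (Fin a × Bool)} (hT : ∀ p ∈ T, p ∈ LX M v) :
    T ∈ DM M (toFace v) ∅ ↔ fc v (T.image Prod.fst) ∈ M := by
  rw [← freed_eq_fc]
  constructor
  · intro h; exact h.2.2.1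
  · intro h
    refine ⟨?_, ?_, h, ?_⟩
    · intro i ⟨h1, h2⟩
      have a1 := (hT _ h1).1
      have a2 := (hT _ h2).1
      simp only at a1 a2
      rw [← a2] at a1
      simp at a1
    · intro p hp
      have a1 := (hT _ hp).1
      simp only [toFace, ne_eq, Option.some.injEq]
      rw [a1]
      cases v p.1 <;> simp
    · intro p _ h
      simp [toFace] at h

theorem link_LX (hM : IsSubcomplex M) {v : Fin a → Bool} {T : Finset (Fin a × Bool)}
    (hT : T ∈ DM M (toFace v) ∅) : ∀ p ∈ T, p ∈ LX M v := by
  intro p hp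
  constructor
  · have := hT.2.1 p hp
    simp only [toFace, ne_eq, Option.some.injEq] at this
    revert this
    generalize v p.1 = x
    generalize p.2 = y
    cases x <;> cases y <;> simp
  · refine hM.2 _ hT.2.2.1 _ ?_
    rw [freed_eq_fc]
    apply fc_mono
    exact Finset.singleton_subset_iff.mpr (Finset.mem_image_of_mem _ hp)

theorem SkI.main (h : SkI k M N f g) (hk : 2 ≤ k) {m n : ℕ} (hm : m + 1 ≤ 2 * k) (hn : n + 1 ≤ 2 * k)
    (hMS : ∀ v ∈ cvert M, HS m (DM M (toFace v) ∅)) (hNS : ∀ v ∈ cvert N, HS n (DM N (toFace v) ∅))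
    (F : CubeFace a) (hF : F ∈ M) : ∃ G ∈ N, verts G = f '' verts F := by
  obtain ⟨v, hv⟩ := exists_vert F
  obtain ⟨S, rfl⟩ := exists_fc F hv
  have hvM : v ∈ cvert M := vert_mem h.subM hF hv
  have hgf := h.gf v hvM
  set φ : Fin a × Bool → Fin b × Bool := fun p => (pd f v p.1, !(f v (pd f v p.1))) with hφ
  set ψ : Fin b × Bool → Fin a × Bool := fun p => (pd g (f v) p.1, !(v (pd g (f v) p.1))) with hψ
  have hφX : ∀ p ∈ LX M v, φ p ∈ LX N (f v) := fun p hp => ⟨rfl, (h.pd_spec hk hp.2).1⟩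
  have hψX : ∀ p ∈ LX N (f v), ψ p ∈ LX M v := by
    intro p hp
    have := (h.symm.pd_spec hk hp.2).1
    rw [hgf] at this
    exact ⟨rfl, this⟩
  have him : ∀ T : Finset (Fin a × Bool), (T.image φ).image Prod.fst
      = (T.image Prod.fst).image (pd f v) := by
    intro T
    rw [Finset.image_image, Finset.image_image]
    rfl
  have hmain := comb_main (φ := φ) (ψ := ψ) (X := LX M v) (X' := LX N (f v))
    (L := DM M (toFace v) ∅) (L' := DM N (toFace (f v)) ∅) (e := m) (e' := n) (k := k)
    (by
      intro p hp
      have h1 := h.pd_inv hk hp.2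
      simp only [hφ, hψ]
      rw [h1, ← hp.1])
    hφX
    (by
      intro p hp
      have h1 := h.symm.pd_inv hk hp.2
      rw [hgf] at h1
      simp only [hφ, hψ]
      rw [h1, ← hp.1])
    hψX (hMS v hvM) (hNS _ (h.fm v hvM)) (fun T hT => link_LX h.subM hT)
    (fun T hT => link_LX h.subN hT) hm hn
    (by
      intro T hT hc
      have hT' : ∀ p ∈ T.image φ, p ∈ LX N (f v) := by
        intro p hp
        obtain ⟨p', hp', rfl⟩ := Finset.mem_image.mp hp
        exact hφX p' (hT p' hp')
      rw [mem_link hT, mem_link hT', him]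
      constructor
      · intro h2
        exact h.low hk h2 (Finset.card_image_le.trans hc)
      · intro h2
        have h3 := h.symm.low hk h2 ((Finset.card_image_le.trans Finset.card_image_le).trans hc)
        rw [hgf, Finset.image_image] at h3
        convert h3 using 2
        symm
        rw [Finset.image_image]
        apply Finset.image_congr
        intro p hp
        exact h.pd_inv hk (hT p hp).2)
  set T : Finset (Fin a × Bool) := S.image fun i => (i, !(v i)) with hTd
  have hTf : T.image Prod.fst = S := by
    rw [hTd, Finset.image_image]
    exact Finset.image_id
  have hTX : ∀ p ∈ T, p ∈ LX M v := by
    intro p hp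
    obtain ⟨i, hi, rfl⟩ := Finset.mem_image.mp hp
    exact ⟨rfl, h.subM.2 _ hF _ (fc_mono v (by simpa using hi))⟩
  have hT' : ∀ p ∈ T.image φ, p ∈ LX N (f v) := by
    intro p hp
    obtain ⟨p', hp', rfl⟩ := Finset.mem_image.mp hp
    exact hφX p' (hTX p' hp')
  have h3 := hmain T hTX
  rw [mem_link hTX, mem_link hT', him, hTf] at h3
  exact ⟨_, h3.mp hF, (h.image_verts hk hF).symm⟩

end Cubes

end SkelProof

open CubeFace in
open SkelProof in
theorem skelproof_final
    {a b m n k : ℕ} (hnm : n ≤ m) (hn : 3 ≤ n) (hk : m / 2 + 1 ≤ k)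
    (M : Set (CubeFace a)) (hM : IsSubcomplex M) (hMd : HasDim M m)
    (hmanM : IsCompactManifold (↥(real M)) m)
    (N : Set (CubeFace b)) (hN : IsSubcomplex N) (hNd : HasDim N n)
    (hmanN : IsCompactManifold (↥(real N)) n)
    (hskel : Iso (skel k M) (skel k N)) :
    Iso M N := by
  have nonem : ∀ {c l : ℕ} {K : Set (CubeFace c)}, HasDim K l → 3 ≤ l → Nonempty (Fin c) := by
    intro c l K hK hl
    obtain ⟨F, -, hF⟩ := hK.2
    rw [dim_eq] at hF
    have : 0 < (Finset.univ.filter (fun i => F i = none)).card := by omega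
    obtain ⟨i, -⟩ := Finset.card_pos.mp this
    exact ⟨i⟩
  have := nonem hMd (by omega)
  have := nonem hNd hn
  have : Nonempty (Fin m) := ⟨⟨0, by omega⟩⟩
  have : Nonempty (Fin n) := ⟨⟨0, by omega⟩⟩
  have hcv : ∀ {c : ℕ} (K : Set (CubeFace c)), cvert (skel k K) = cvert K := by
    intro c K
    ext v
    constructor
    · intro h; exact h.1
    · intro h
      refine ⟨h, ?_⟩
      rw [← fc_empty, dim_fc]; simp
  obtain ⟨f, hbij, hf⟩ := hskel
  rw [hcv, hcv] at hbij
  rw [hcv] at hf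
  have hsub : ∀ {c : ℕ} {K : Set (CubeFace c)}, IsSubcomplex K → ∀ F ∈ K, verts F ⊆ cvert K := by
    intro c K hK F hF v hv
    exact hK.2 F hF _ hv
  set g := Function.invFunOn f (cvert M) with hg
  have hgm : ∀ w ∈ cvert N, g w ∈ cvert M := fun w hw =>
    Function.invFunOn_mem (hbij.surjOn hw)
  have hfg : ∀ w ∈ cvert N, f (g w) = w := fun w hw =>
    Function.invFunOn_eq (hbij.surjOn hw)
  have hgf : ∀ v ∈ cvert M, g (f v) = v := fun v hv =>
    hbij.injOn (hgm _ (hbij.mapsTo hv)) hv (hfg _ (hbij.mapsTo hv))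
  have hfgi : ∀ W ⊆ cvert N, f '' (g '' W) = W := by
    intro W hW
    rw [Set.image_image]
    ext w
    constructor
    · rintro ⟨x, hx, rfl⟩
      simp only [hfg x (hW hx)]; exact hx
    · intro hw; exact ⟨w, hw, hfg w (hW hw)⟩
  have hgfi : ∀ W ⊆ cvert M, g '' (f '' W) = W := by
    intro W hW
    rw [Set.image_image]
    ext w
    constructor
    · rintro ⟨x, hx, rfl⟩
      simp only [hgf x (hW hx)]; exact hx
    · intro hw; exact ⟨w, hw, hgf w (hW hw)⟩
  have hS : SkI k M N f g := by
    refine ⟨hM, hN, fun v hv => hbij.mapsTo hv, hgm, hgf, hfg, ?_, ?_⟩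
    · intro F hF hd
      obtain ⟨G, hG, h⟩ := (hf (verts F) (hsub hM F hF)).mp ⟨F, ⟨hF, hd⟩, rfl⟩
      exact ⟨G, hG.1, h⟩
    · intro G hG hd
      have h1 : g '' verts G ⊆ cvert M := by
        rintro _ ⟨w, hw, rfl⟩
        exact hgm w (hsub hN G hG hw)
      obtain ⟨F, hF, h⟩ := (hf _ h1).mpr ⟨G, ⟨hG, hd⟩, (hfgi _ (hsub hN G hG)).symm⟩
      exact ⟨F, hF.1, h⟩
  have hMS := fun v hv => vert_HS hM hMd hmanM v hv
  have hNS := fun v hv => vert_HS hN hNd hmanN v hv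
  have k2 : 2 ≤ k := by omega
  have hm1 : m + 1 ≤ 2 * k := by omega
  have hn1 : n + 1 ≤ 2 * k := by omega
  refine ⟨f, hbij, fun W hW => ⟨?_, ?_⟩⟩
  · rintro ⟨F, hF, rfl⟩
    exact hS.main k2 hm1 hn1 hMS hNS F hF
  · rintro ⟨G, hG, hGW⟩
    obtain ⟨F, hF, h⟩ := hS.symm.main k2 hn1 hm1 hNS hMS G hG
    exact ⟨F, hF, by rw [h, hGW, hgfi W hW]⟩


open CubeFace in
/-- let `M ⊆ I^a`, `N ⊆ I^b` be cubical manifolds of dimensions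
`m ≥ n ≥ 3`, and let `k ≥ ⌊m/2⌋ + 1`. If the `k`-skeletons of `M` and `N` are
isomorphic, then `M ≅ N`. -/
theorem skeleton_determines_manifolds_of_different_dimensions
    {a b m n k : ℕ} (hnm : n ≤ m) (hn : 3 ≤ n) (hk : m / 2 + 1 ≤ k)
    (M : Set (CubeFace a)) (hM : IsSubcomplex M) (hMd : HasDim M m)
    (hmanM : IsCompactManifold (↥(real M)) m)
    (N : Set (CubeFace b)) (hN : IsSubcomplex N) (hNd : HasDim N n)
    (hmanN : IsCompactManifold (↥(real N)) n)
    (hskel : Iso (skel k M) (skel k N)) :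
    Iso M N := by
  exact skelproof_final hnm hn hk M hM hMd hmanM N hN hNd hmanN hskel
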